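/- arXiv:2203.02970 — 5 statements merged into one kernel-verified Lean document; each statement's English description precedes it below -/
import Mathlib

section
/- Let k ≥ 2, let f : ℂ^k → ℂ^k be a diffeomorphism, and let S be a compact f-invariant set. Then S is uniformly hyperbolic if and only if for every orbit z = (f^i(z₀))_{i∈ℤ} with z₀ ∈ S, the bounded linear operator DF(z; f) on l_∞(ℤ, ℂ^k), given by ξ ↦ (ξ_{i+1} − Df(z_i)ξ_i)_{i∈ℤ}, is invertible, with sup over all such orbits z of ‖DF(z; f)⁻¹‖ finite. -/
noncomputable section
open Set Metric Topology Filter ENNReal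

/-- `ℂ^k` with its standard Hermitian norm. -/
abbrev Ck (k : ℕ) := EuclideanSpace ℂ (Fin k)

/-- A set `S` is invariant under `f` if `f⁻¹(S) = S`. -/
def Invariant {α : Type*} (f : α → α) (S : Set α) : Prop := f ⁻¹' S = S

/-- The full orbit `(z_i)_{i∈ℤ}` of `z0` under a diffeomorphism `f` with inverse `finv`:
`z_i = f^i(z₀)` for `i ≥ 0` and `z_i = finv^{|i|}(z₀)` for `i < 0`. -/
def orbitZ {E : Type*} (f finv : E → E) (z0 : E) : ℤ → E :=
  fun i => if 0 ≤ i then f^[i.toNat] z0 else finv^[(-i).toNat] z0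
/-- Uniform hyperbolicity of a compact invariant set of a diffeomorphism `f`
(with inverse `finv`): a splitting `ℂ^k = Eˢ_z ⊕ Eᵘ_z` varying continuously with
`z` (encoded by the projection `P z` onto `Eˢ_z` along `Eᵘ_z`), invariant under
`Df`, with uniform contraction rates `(λ_s, λ_u)` on `Eˢ` under forward iterates
and on `Eᵘ` under backward iterates. -/
def IsHyperbolicSet {E : Type*} [NormedAddCommGroup E] [NormedSpace ℂ E]
    (f finv : E → E) (S : Set E) : Prop :=
  ∃ (Es Eu : E → Submodule ℂ E) (P : E → E →L[ℂ] E) (Cs Cu lams lamu : ℝ),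
    0 < Cs ∧ 0 < Cu ∧ 0 < lams ∧ lams < 1 ∧ 1 < lamu ∧
    ContinuousOn P S ∧
    (∀ z ∈ S, ∀ v : E, P z v ∈ Es z ∧ v - P z v ∈ Eu z) ∧
    (∀ z ∈ S, ∀ v ∈ Es z, P z v = v) ∧
    (∀ z ∈ S, ∀ v ∈ Eu z, P z v = 0) ∧
    (∀ z ∈ S, (Es z).map (fderiv ℂ f z).toLinearMap = Es (f z)) ∧
    (∀ z ∈ S, (Eu z).map (fderiv ℂ f z).toLinearMap = Eu (f z)) ∧
    (∀ z ∈ S, ∀ n : ℕ, 1 ≤ n → ∀ v ∈ Es z, ‖fderiv ℂ (f^[n]) z v‖ ≤ Cs * lams ^ n * ‖v‖) ∧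
    (∀ z ∈ S, ∀ n : ℕ, 1 ≤ n → ∀ v ∈ Eu z, ‖fderiv ℂ (finv^[n]) z v‖ ≤ Cu * (lamu ^ n)⁻¹ * ‖v‖)


/-- A pair of mutually inverse entire maps. -/
structure IsBiholomorphism {E : Type*} [NormedAddCommGroup E] [NormedSpace ℂ E]
    (f finv : E → E) : Prop where
  differentiable : Differentiable ℂ f
  differentiable_inv : Differentiable ℂ finv
  leftInverse : Function.LeftInverse finv f
  rightInverse : Function.RightInverse finv f

/-- The derivative at `z` of the `i`-th iterate of `f`, for `i ∈ ℤ`. -/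
def orbitDeriv {E : Type*} [NormedAddCommGroup E] [NormedSpace ℂ E]
    (f finv : E → E) (z : E) (i : ℤ) : E →L[ℂ] E :=
  fderiv ℂ (fun w => orbitZ f finv w i) z

theorem orbitZ_natCast {α : Type*} {f finv : α → α} (z : α) (n : ℕ) : orbitZ f finv z n = f^[n] z := by
  simp [orbitZ]

theorem orbitZ_neg_natCast {α : Type*} {f finv : α → α} (z : α) (n : ℕ) : orbitZ f finv z (-n) = finv^[n] z := by
  rcases n with _ | n
  · simp [orbitZ]
  · have : ¬ (0 : ℤ) ≤ -((n + 1 : ℕ) : ℤ) := by omega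
    simp only [orbitZ, if_neg this]
    simp

theorem orbitZ_zero {α : Type*} {f finv : α → α} (z : α) : orbitZ f finv z 0 = z := by simp [orbitZ]

theorem orbitZ_one {α : Type*} {f finv : α → α} (z : α) : orbitZ f finv z 1 = f z := by simp [orbitZ]

section Cocycle

variable {E : Type*} [NormedAddCommGroup E] [NormedSpace ℂ E] {f finv : E → E}

/-- The derivative of an entire map on a finite-dimensional space is continuous. -/
theorem continuous_fderiv_of_differentiable_complex {F : Type*} [NormedAddCommGroup F]
    [NormedSpace ℂ F] [ProperSpace E] {g : E → F} (hg : Differentiable ℂ g) :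
    Continuous (fderiv ℂ g) := by
  rw [continuous_iff_continuousAt]
  intro z
  rw [Metric.continuousAt_iff]
  intro ε hε
  have huc : UniformContinuousOn g (closedBall z 2) :=
    (isCompact_closedBall z 2).uniformContinuousOn_of_continuous hg.continuous.continuousOn
  rw [Metric.uniformContinuousOn_iff] at huc
  obtain ⟨δ, hδ, H⟩ := huc (ε / 2) (by positivity)
  refine ⟨min δ 1, by positivity, fun {w} hw => ?_⟩
  rw [dist_eq_norm]
  refine lt_of_le_of_lt (b := ε / 2) ?_ (by linarith)
  refine ContinuousLinearMap.opNorm_le_of_unit_norm (𝕜 := ℂ) (by positivity) fun v hv => ?_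
  have hline : ∀ y : E, HasDerivAt (fun ζ : ℂ => y + ζ • v) v 0 := fun y => by
    simpa using ((hasDerivAt_id (0 : ℂ)).smul_const v).const_add y
  have hcomp : ∀ y : E, HasDerivAt (fun ζ : ℂ => g (y + ζ • v)) (fderiv ℂ g y v) 0 := fun y => by
    have := (hg (y + (0 : ℂ) • v)).hasFDerivAt.comp_hasDerivAt (0 : ℂ) (hline y)
    simpa [Function.comp_def] using this
  have hd := ((hcomp w).sub (hcomp z)).deriv
  have hdiff : Differentiable ℂ
      ((fun ζ : ℂ => g (w + ζ • v)) - fun ζ : ℂ => g (z + ζ • v)) := by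
    intro ζ
    refine DifferentiableAt.sub ?_ ?_
    · exact (hg _).comp ζ (by fun_prop)
    · exact (hg _).comp ζ (by fun_prop)
  have hb := Complex.norm_deriv_le_of_forall_mem_sphere_norm_le (c := 0) (C := ε / 2) one_pos
    hdiff.diffContOnCl (fun ζ hζ => ?_)
  · rw [hd] at hb
    simpa using hb
  · have hζ1 : ‖ζ‖ = 1 := by simpa using hζ
    have hzv : ‖ζ • v‖ = 1 := by rw [norm_smul, hζ1, hv, one_mul]
    have hwz : dist w z < 1 := hw.trans_le (min_le_right _ _)
    rw [Pi.sub_apply, ← dist_eq_norm]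
    refine (H _ ?_ _ ?_ ?_).le
    · rw [mem_closedBall, dist_eq_norm]
      rw [dist_eq_norm] at hwz
      calc ‖w + ζ • v - z‖ = ‖(w - z) + ζ • v‖ := by congr 1; abel
        _ ≤ ‖w - z‖ + ‖ζ • v‖ := norm_add_le _ _
        _ ≤ 2 := by linarith
    · rw [mem_closedBall, dist_eq_norm, add_sub_cancel_left, hzv]
      norm_num
    · rw [dist_add_right]
      exact hw.trans_le (min_le_left _ _)

namespace IsBiholomorphism

/-- The underlying bijection. -/
def toPerm (h : IsBiholomorphism f finv) : Equiv.Perm E := ⟨f, finv, h.leftInverse, h.rightInverse⟩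

theorem orbitZ_eq_zpow (h : IsBiholomorphism f finv) (z : E) (i : ℤ) :
    orbitZ f finv z i = (h.toPerm ^ i) z := by
  unfold orbitZ
  have key : ∀ n : ℕ, (h.toPerm ^ n) z = f^[n] z := fun n => by
    rw [← Equiv.Perm.iterate_eq_pow]; rfl
  have key' : ∀ n : ℕ, (h.toPerm⁻¹ ^ n) z = finv^[n] z := fun n => by
    rw [← Equiv.Perm.iterate_eq_pow]; rfl
  split_ifs with hi
  · lift i to ℕ using hi
    simp [key]
  · obtain ⟨n, rfl⟩ : ∃ n : ℕ, i = -n := ⟨(-i).toNat, by omega⟩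
    simp [← key']

theorem orbitZ_add (h : IsBiholomorphism f finv) (z : E) (i j : ℤ) :
    orbitZ f finv z (i + j) = orbitZ f finv (orbitZ f finv z i) j := by
  simp only [h.orbitZ_eq_zpow]
  rw [add_comm, zpow_add, Equiv.Perm.mul_apply]

end IsBiholomorphism

theorem orbitDeriv_natCast (z : E) (n : ℕ) :
    orbitDeriv f finv z n = fderiv ℂ (f^[n]) z := by
  simp only [orbitDeriv, orbitZ_natCast]

theorem orbitDeriv_neg_natCast (z : E) (n : ℕ) :
    orbitDeriv f finv z (-n) = fderiv ℂ (finv^[n]) z := by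
  simp only [orbitDeriv, orbitZ_neg_natCast]

theorem orbitDeriv_zero_apply (z v : E) : orbitDeriv f finv z 0 v = v := by
  simp [orbitDeriv, orbitZ_zero]

theorem orbitDeriv_one (z : E) : orbitDeriv f finv z 1 = fderiv ℂ f z := by
  simp only [orbitDeriv, orbitZ_one]

namespace IsBiholomorphism

theorem orbitZ_add_one (h : IsBiholomorphism f finv) (z : E) (i : ℤ) :
    orbitZ f finv z (i + 1) = f (orbitZ f finv z i) := by
  rw [h.orbitZ_add, orbitZ_one]

theorem differentiable_orbitZ (h : IsBiholomorphism f finv) (i : ℤ) :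
    Differentiable ℂ fun w => orbitZ f finv w i := by
  rcases Int.eq_nat_or_neg i with ⟨n, rfl | rfl⟩
  · simpa only [orbitZ_natCast] using h.differentiable.iterate n
  · simpa only [orbitZ_neg_natCast] using h.differentiable_inv.iterate n

theorem orbitDeriv_add (h : IsBiholomorphism f finv) (z : E) (i j : ℤ) (v : E) :
    orbitDeriv f finv z (i + j) v =
      orbitDeriv f finv (orbitZ f finv z i) j (orbitDeriv f finv z i v) := by
  have := fderiv_comp z (h.differentiable_orbitZ j (orbitZ f finv z i))
    (h.differentiable_orbitZ i z)
  simp only [orbitDeriv, h.orbitZ_add]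
  exact congrArg (fun L => L v) this

theorem orbitDeriv_add_one (h : IsBiholomorphism f finv) (z : E) (i : ℤ) (v : E) :
    orbitDeriv f finv z (i + 1) v = fderiv ℂ f (orbitZ f finv z i) (orbitDeriv f finv z i v) := by
  rw [h.orbitDeriv_add, orbitDeriv_one]

/-- Shifting the base point along the orbit. -/
theorem orbitDeriv_orbitZ (h : IsBiholomorphism f finv) (z : E) (i j : ℤ) (v : E) :
    orbitDeriv f finv (orbitZ f finv z i) (j - i) (orbitDeriv f finv z i v) =
      orbitDeriv f finv z j v := by
  rw [← h.orbitDeriv_add, add_sub_cancel]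

theorem orbitDeriv_neg_apply_self (h : IsBiholomorphism f finv) (z : E) (i : ℤ) (v : E) :
    orbitDeriv f finv (orbitZ f finv z i) (-i) (orbitDeriv f finv z i v) = v := by
  rw [← h.orbitDeriv_add, add_neg_cancel, orbitDeriv_zero_apply]

theorem orbitDeriv_self_neg_apply (h : IsBiholomorphism f finv) (z : E) (i : ℤ) (v : E) :
    orbitDeriv f finv z i (orbitDeriv f finv (orbitZ f finv z i) (-i) v) = v := by
  have := h.orbitDeriv_neg_apply_self (orbitZ f finv z i) (-i) v
  rwa [neg_neg, ← h.orbitZ_add, add_neg_cancel, orbitZ_zero] at this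

theorem fderiv_injective (h : IsBiholomorphism f finv) (z : E) :
    Function.Injective (fderiv ℂ f z) := by
  rw [← orbitDeriv_one (finv := finv)]
  exact Function.LeftInverse.injective (h.orbitDeriv_neg_apply_self z 1)

theorem orbitZ_mem (h : IsBiholomorphism f finv) {S : Set E} (hS : Invariant f S) {z : E}
    (hz : z ∈ S) (i : ℤ) : orbitZ f finv z i ∈ S := by
  have hiff : ∀ i, orbitZ f finv z (i + 1) ∈ S ↔ orbitZ f finv z i ∈ S := fun i => by
    rw [h.orbitZ_add_one, ← mem_preimage, hS]
  induction i using Int.induction_on with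
  | zero => rwa [orbitZ_zero]
  | succ i ih => exact (hiff _).2 ih
  | pred i ih => exact (hiff _).1 (by rwa [sub_add_cancel])

/-- A solution of the variational equation along an orbit is transported by the derivative. -/
theorem eq_orbitDeriv_of_forall (h : IsBiholomorphism f finv) {z : E} {g : ℤ → E}
    (hg : ∀ i, g (i + 1) = fderiv ℂ f (orbitZ f finv z i) (g i)) (i : ℤ) :
    g i = orbitDeriv f finv z i (g 0) := by
  induction i using Int.induction_on with
  | zero => rw [orbitDeriv_zero_apply]
  | succ i ih => rw [hg, h.orbitDeriv_add_one, ← ih]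
  | pred i ih =>
    apply h.fderiv_injective (orbitZ f finv z (-i - 1))
    rw [← hg, ← h.orbitDeriv_add_one, sub_add_cancel, ih]

theorem eq_orbitDeriv_of_nonneg (h : IsBiholomorphism f finv) {z : E} {g : ℤ → E}
    (hg : ∀ i, 0 ≤ i → g (i + 1) = fderiv ℂ f (orbitZ f finv z i) (g i)) (n : ℕ) :
    g n = orbitDeriv f finv z n (g 0) := by
  induction n with
  | zero => simp [orbitDeriv_zero_apply]
  | succ n ih => rw [Nat.cast_succ, hg _ (Int.natCast_nonneg n), h.orbitDeriv_add_one, ← ih]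

theorem eq_orbitDeriv_of_neg (h : IsBiholomorphism f finv) {z : E} {g : ℤ → E}
    (hg : ∀ i, i < 0 → g (i + 1) = fderiv ℂ f (orbitZ f finv z i) (g i)) (n : ℕ) :
    g (-n) = orbitDeriv f finv z (-n) (g 0) := by
  induction n with
  | zero => simp [orbitDeriv_zero_apply]
  | succ n ih =>
    apply h.fderiv_injective (orbitZ f finv z (-(n + 1 : ℕ)))
    rw [← hg _ (by omega), ← h.orbitDeriv_add_one,
      show -((n + 1 : ℕ) : ℤ) + 1 = -n by push_cast; ring, ih]

theorem continuous_orbitDeriv (h : IsBiholomorphism f finv) [ProperSpace E] (i : ℤ) :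
    Continuous fun z => orbitDeriv f finv z i :=
  continuous_fderiv_of_differentiable_complex (h.differentiable_orbitZ i)

theorem exists_norm_fderiv_le (h : IsBiholomorphism f finv) [ProperSpace E] {S : Set E}
    (hS : IsCompact S) : ∃ L : ℝ, 0 ≤ L ∧ ∀ z ∈ S, ‖fderiv ℂ f z‖ ≤ L := by
  obtain ⟨L, hL⟩ := hS.exists_bound_of_continuousOn
    (continuous_fderiv_of_differentiable_complex h.differentiable).continuousOn
  exact ⟨max L 0, le_max_right _ _, fun z hz => (hL z hz).trans (le_max_left _ _)⟩

end IsBiholomorphism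

end Cocycle

section HyperbolicToInvertible

variable {E : Type*} [NormedAddCommGroup E] [NormedSpace ℂ E] {f finv : E → E}

namespace IsBiholomorphism

/-- A `Df`-invariant family of subspaces over `S` is transported by all iterates. -/
theorem orbitDeriv_mem (h : IsBiholomorphism f finv) {S : Set E} (hS : Invariant f S)
    {W : E → Submodule ℂ E} (hW : ∀ z ∈ S, (W z).map (fderiv ℂ f z).toLinearMap = W (f z))
    {z : E} (hz : z ∈ S) {v : E} (hv : v ∈ W z) (i : ℤ) :
    orbitDeriv f finv z i v ∈ W (orbitZ f finv z i) := by
  induction i using Int.induction_on with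
  | zero => rwa [orbitDeriv_zero_apply, orbitZ_zero]
  | succ i ih =>
    rw [h.orbitZ_add_one, h.orbitDeriv_add_one, ← hW _ (h.orbitZ_mem hS hz _)]
    exact Submodule.mem_map_of_mem ih
  | pred i ih =>
    rw [← sub_add_cancel (-(i : ℤ)) 1, h.orbitZ_add_one, h.orbitDeriv_add_one,
      ← hW _ (h.orbitZ_mem hS hz _)] at ih
    obtain ⟨u, hu, hu'⟩ := ih
    rwa [← h.fderiv_injective _ hu']

end IsBiholomorphism

/-- A hyperbolic set with a common rate `r < 1` and constant `C`, in terms of the derivative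
cocycle along orbits. -/
theorem IsHyperbolicSet.exists_dichotomy [ProperSpace E] {S : Set E}
    (hS : IsCompact S) (hyp : IsHyperbolicSet f finv S) :
    ∃ (Es Eu : E → Submodule ℂ E) (P : E → E →L[ℂ] E) (C r : ℝ),
      0 ≤ C ∧ 0 ≤ r ∧ r < 1 ∧
      (∀ z ∈ S, ∀ v : E, P z v ∈ Es z ∧ v - P z v ∈ Eu z) ∧
      (∀ z ∈ S, ∀ v ∈ Es z, P z v = v) ∧
      (∀ z ∈ S, ∀ v ∈ Eu z, P z v = 0) ∧
      (∀ z ∈ S, (Es z).map (fderiv ℂ f z).toLinearMap = Es (f z)) ∧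
      (∀ z ∈ S, (Eu z).map (fderiv ℂ f z).toLinearMap = Eu (f z)) ∧
      (∀ z ∈ S, ∀ n : ℕ, ∀ v : E, ‖orbitDeriv f finv z n (P z v)‖ ≤ C * r ^ n * ‖v‖) ∧
      (∀ z ∈ S, ∀ n : ℕ, ∀ v : E, ‖orbitDeriv f finv z (-n) (v - P z v)‖ ≤ C * r ^ n * ‖v‖) := by
  obtain ⟨Es, Eu, P, Cs, Cu, ls, lu, hCs, hCu, hls, hls1, hlu, hP, hdec, hPs, hPu, hEs, hEu,
    hs, hu⟩ := hyp
  obtain ⟨c, hc⟩ := hS.exists_bound_of_continuousOn hP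
  have hlu0 : 0 < lu := by linarith
  have hlui : lu⁻¹ < 1 := inv_lt_one_of_one_lt₀ hlu
  have hlui0 : 0 < lu⁻¹ := inv_pos.2 hlu0
  set r := max ls lu⁻¹
  set D := 1 + Cs + Cu
  set c' := 1 + |c|
  have hPb : ∀ z ∈ S, ∀ v, ‖P z v‖ ≤ c' * ‖v‖ := fun z hz v =>
    (P z).le_of_opNorm_le ((hc z hz).trans ((le_abs_self c).trans (by simp [c']))) v
  have hQb : ∀ z ∈ S, ∀ v, ‖v - P z v‖ ≤ c' * ‖v‖ := fun z hz v => by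
    have h1 := (P z).le_of_opNorm_le ((hc z hz).trans (le_abs_self c)) v
    have h2 := norm_sub_le v (P z v)
    simp only [c']
    linarith
  have hr0 : 0 < r := lt_max_of_lt_left hls
  have hD : 0 < D := by positivity
  have hc' : 0 < c' := by positivity
  have comb : ∀ (n : ℕ) (K l : ℝ) (L : E →L[ℂ] E) (w v : E), (n = 0 → L w = w) →
      (1 ≤ n → ‖L w‖ ≤ K * l ^ n * ‖w‖) → 0 ≤ K → K ≤ D → 0 ≤ l → l ≤ r →
      ‖w‖ ≤ c' * ‖v‖ → ‖L w‖ ≤ D * c' * r ^ n * ‖v‖ := by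
    intro n K l L w v h0 h1 hK hKD hl hlr hw
    have hmain : ‖L w‖ ≤ D * r ^ n * ‖w‖ := by
      rcases Nat.eq_zero_or_pos n with rfl | hn
      · rw [h0 rfl, pow_zero, mul_one]
        have : 1 ≤ D := by simp only [D]; linarith
        nlinarith [norm_nonneg w]
      · refine (h1 hn).trans ?_
        gcongr
    calc ‖L w‖ ≤ D * r ^ n * ‖w‖ := hmain
      _ ≤ D * r ^ n * (c' * ‖v‖) := by gcongr
      _ = D * c' * r ^ n * ‖v‖ := by ring
  refine ⟨Es, Eu, P, D * c', r, by positivity, hr0.le, max_lt hls1 hlui, hdec, hPs, hPu, hEs, hEu,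
    fun z hz n v => ?_, fun z hz n v => ?_⟩
  · refine comb n Cs ls _ _ v ?_ ?_ hCs.le (by simp only [D]; linarith) hls.le (le_max_left _ _)
      (hPb z hz v)
    · rintro rfl
      exact orbitDeriv_zero_apply _ _
    · intro hn
      rw [orbitDeriv_natCast]
      exact hs z hz n hn _ (hdec z hz v).1
  · refine comb n Cu lu⁻¹ _ _ v ?_ ?_ hCu.le (by simp only [D]; linarith) hlui0.le
      (le_max_right _ _) (hQb z hz v)
    · rintro rfl
      exact orbitDeriv_zero_apply _ _
    · intro hn
      rw [orbitDeriv_neg_natCast, inv_pow]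
      exact hu z hz n hn _ (hdec z hz v).2

/-- Along orbits in a hyperbolic set the inhomogeneous variational equation has bounded solutions,
unique among bounded sequences, with a uniform bound. -/
theorem IsHyperbolicSet.exists_bounded_solution [ProperSpace E]
    (h : IsBiholomorphism f finv) {S : Set E} (hS : IsCompact S) (hinv : Invariant f S)
    (hyp : IsHyperbolicSet f finv S) :
    ∃ R : ℝ, 0 ≤ R ∧ ∀ z ∈ S,
      (∀ (η : ℤ → E) (K : ℝ), (∀ i, ‖η i‖ ≤ K) → ∃ ξ : ℤ → E, (∀ i, ‖ξ i‖ ≤ R * K) ∧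
        ∀ i, ξ (i + 1) - fderiv ℂ f (orbitZ f finv z i) (ξ i) = η i) ∧
      (∀ (ξ : ℤ → E) (K : ℝ), (∀ i, ‖ξ i‖ ≤ K) →
        (∀ i, ξ (i + 1) = fderiv ℂ f (orbitZ f finv z i) (ξ i)) → ∀ i, ξ i = 0) := by
  obtain ⟨Es, Eu, P, C, r, hC, hr, hr1, hdec, hPs, hPu, hEs, hEu, hs, hu⟩ :=
    hyp.exists_dichotomy hS
  refine ⟨C * (1 - r)⁻¹ + C * (1 - r)⁻¹, by have := sub_pos.2 hr1; positivity, fun z hz =>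
    ⟨fun η K hK => ?_, fun ξ K hK hξ i => ?_⟩⟩
  · set o := orbitZ f finv z
    have ho : ∀ i, o i ∈ S := h.orbitZ_mem hinv hz
    have hoadd : ∀ i j, orbitZ f finv (o i) j = o (i + j) := fun i j => (h.orbitZ_add z i j).symm
    have hstep : ∀ (i j : ℤ) (v : E), fderiv ℂ f (o (i + j)) (orbitDeriv f finv (o i) j v) =
        orbitDeriv f finv (o i) (j + 1) v := fun i j v => by
      rw [h.orbitDeriv_add_one, hoadd]
    set u : ℤ → ℕ → E := fun i n => orbitDeriv f finv (o (i - n)) n (P (o (i - n)) (η (i - n - 1)))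
    set w : ℤ → ℕ → E := fun i n => orbitDeriv f finv (o (i + n)) (-n)
      (η (i + n - 1) - P (o (i + n)) (η (i + n - 1)))
    have hub : ∀ i n, ‖u i n‖ ≤ C * K * r ^ n := fun i n => by
      refine (hs _ (ho _) n _).trans ?_
      calc C * r ^ n * ‖η (i - n - 1)‖ ≤ C * r ^ n * K := by gcongr; exact hK _
        _ = C * K * r ^ n := by ring
    have hwb : ∀ i n, ‖w i n‖ ≤ C * K * r ^ n := fun i n => by
      refine (hu _ (ho _) n _).trans ?_
      calc C * r ^ n * ‖η (i + n - 1)‖ ≤ C * r ^ n * K := by gcongr; exact hK _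
        _ = C * K * r ^ n := by ring
    have hgeo : HasSum (fun n => C * K * r ^ n) (C * K * (1 - r)⁻¹) :=
      (hasSum_geometric_of_lt_one hr hr1).mul_left _
    have hK0 : 0 ≤ K := (norm_nonneg _).trans (hK 0)
    have hus : ∀ i, Summable (u i) := fun i => Summable.of_norm_bounded hgeo.summable (hub i)
    have hws : ∀ i, Summable (w i) := fun i => Summable.of_norm_bounded hgeo.summable (hwb i)
    have hu0 : ∀ i, u (i + 1) 0 = P (o (i + 1)) (η i) := fun i => by
      simp [u, orbitDeriv_zero_apply]
    have hw0 : ∀ i, w (i + 1) 0 = η i - P (o (i + 1)) (η i) := fun i => by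
      simp [w, orbitDeriv_zero_apply]
    have hu1 : ∀ i n, u (i + 1) (n + 1) = fderiv ℂ f (o i) (u i n) := fun i n => by
      have := hstep (i - n) n (P (o (i - n)) (η (i - n - 1)))
      rw [sub_add_cancel] at this
      simp only [u]
      rw [this, show i + 1 - ((n + 1 : ℕ) : ℤ) = i - n by push_cast; ring, Nat.cast_succ]
    have hw1 : ∀ i n, fderiv ℂ f (o i) (w i (n + 1)) = w (i + 1) n := fun i n => by
      have := hstep (i + (n + 1 : ℕ)) (-(n + 1 : ℕ))
        (η (i + (n + 1 : ℕ) - 1) - P (o (i + (n + 1 : ℕ))) (η (i + (n + 1 : ℕ) - 1)))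
      rw [add_neg_cancel_right] at this
      simp only [w]
      rw [this, show i + ((n + 1 : ℕ) : ℤ) = i + 1 + n by push_cast; ring,
        show -((n + 1 : ℕ) : ℤ) + 1 = -n by push_cast; ring]
    have hws' : ∀ i, Summable fun n => w i (n + 1) := fun i => (summable_nat_add_iff 1).2 (hws i)
    refine ⟨fun i => (∑' n, u i n) - ∑' n, w i (n + 1), fun i => ?_, fun i => ?_⟩
    · have h1 : ‖∑' n, u i n‖ ≤ C * K * (1 - r)⁻¹ := tsum_of_norm_bounded hgeo (hub i)
      have h2 : ‖∑' n, w i (n + 1)‖ ≤ C * K * (1 - r)⁻¹ := tsum_of_norm_bounded hgeo fun n =>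
        (hwb i (n + 1)).trans (by gcongr ?_ * ?_; exact pow_le_pow_of_le_one hr hr1.le (by simp))
      calc _ ≤ ‖∑' n, u i n‖ + ‖∑' n, w i (n + 1)‖ := norm_sub_le _ _
        _ ≤ C * K * (1 - r)⁻¹ + C * K * (1 - r)⁻¹ := add_le_add h1 h2
        _ = _ := by ring
    · have e1 : ∑' n, u (i + 1) n = P (o (i + 1)) (η i) + fderiv ℂ f (o i) (∑' n, u i n) := by
        rw [(hus (i + 1)).tsum_eq_zero_add, hu0, (fderiv ℂ f (o i)).map_tsum (hus i)]
        simp only [hu1]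
      have e2 : fderiv ℂ f (o i) (∑' n, w i (n + 1)) =
          (η i - P (o (i + 1)) (η i)) + ∑' n, w (i + 1) (n + 1) := by
        rw [(fderiv ℂ f (o i)).map_tsum (hws' i), ← hw0, ← (hws (i + 1)).tsum_eq_zero_add]
        simp only [hw1]
      beta_reduce
      rw [e1, map_sub, e2]
      abel
  · set o := orbitZ f finv z
    have ho : ∀ i, o i ∈ S := h.orbitZ_mem hinv hz
    have hoadd : ∀ i j, orbitZ f finv (o i) j = o (i + j) := fun i j => (h.orbitZ_add z i j).symm
    have hval : ∀ j, orbitDeriv f finv (o j) (i - j) (ξ j) = ξ i := fun j => by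
      rw [h.eq_orbitDeriv_of_forall hξ j, h.eq_orbitDeriv_of_forall hξ i]
      exact h.orbitDeriv_orbitZ z j i _
    have hsplit : ∀ j, orbitDeriv f finv (o j) (i - j) (P (o j) (ξ j)) = P (o i) (ξ i) ∧
        orbitDeriv f finv (o j) (i - j) (ξ j - P (o j) (ξ j)) = ξ i - P (o i) (ξ i) := fun j => by
      have hi : orbitZ f finv (o j) (i - j) = o i := by rw [hoadd, add_sub_cancel]
      have m1 := h.orbitDeriv_mem hinv hEs (ho j) (hdec _ (ho j) (ξ j)).1 (i - j)
      have m2 := h.orbitDeriv_mem hinv hEu (ho j) (hdec _ (ho j) (ξ j)).2 (i - j)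
      rw [hi] at m1 m2
      have key : orbitDeriv f finv (o j) (i - j) (P (o j) (ξ j)) = P (o i) (ξ i) := by
        have := hPu _ (ho i) _ m2
        rw [map_sub, hval, map_sub, hPs _ (ho i) _ m1] at this
        exact (sub_eq_zero.1 this).symm
      exact ⟨key, by rw [map_sub, hval, key]⟩
    have hlim : Tendsto (fun n : ℕ => C * r ^ n * K) atTop (𝓝 0) := by
      simpa using ((tendsto_pow_atTop_nhds_zero_of_lt_one hr hr1).const_mul C).mul_const K
    have z1 : P (o i) (ξ i) = 0 := by
      refine norm_le_zero_iff.1 (ge_of_tendsto' hlim fun n => ?_)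
      have := hs _ (ho (i - n)) n (ξ (i - n))
      have e := (hsplit (i - n)).1
      rw [_root_.sub_sub_cancel] at e
      rw [e] at this
      exact this.trans (by gcongr; exact hK _)
    have z2 : ξ i - P (o i) (ξ i) = 0 := by
      refine norm_le_zero_iff.1 (ge_of_tendsto' hlim fun n => ?_)
      have := hu _ (ho (i + n)) n (ξ (i + n))
      have e := (hsplit (i + n)).2
      rw [sub_add_cancel_left] at e
      rw [e] at this
      exact this.trans (by gcongr; exact hK _)
    rwa [z1, sub_zero] at z2

/-- The operator `ξ ↦ (ξ_{i+1} − A_i ξ_i)_i` on `l_∞` for a bounded sequence of operators `A`. -/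
theorem exists_variationOp (A : ℤ → E →L[ℂ] E) {L : ℝ} (hL0 : 0 ≤ L) (hL : ∀ i, ‖A i‖ ≤ L) :
    ∃ D : lp (fun _ : ℤ => E) ∞ →L[ℂ] lp (fun _ : ℤ => E) ∞,
      ∀ ξ i, D ξ i = ξ (i + 1) - A i (ξ i) := by
  have bound : ∀ (ξ : lp (fun _ : ℤ => E) ∞) (i : ℤ),
      ‖ξ (i + 1) - A i (ξ i)‖ ≤ (1 + L) * ‖ξ‖ := fun ξ i => by
    have h1 := lp.norm_apply_le_norm (by simp) ξ (i + 1)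
    have h2 := (A i).le_of_opNorm_le_of_le (hL i) (lp.norm_apply_le_norm (by simp) ξ i)
    have h3 := norm_sub_le (ξ (i + 1)) (A i (ξ i))
    linarith
  let D₀ : lp (fun _ : ℤ => E) ∞ →ₗ[ℂ] lp (fun _ : ℤ => E) ∞ :=
    { toFun := fun ξ => ⟨fun i => ξ (i + 1) - A i (ξ i),
        memℓp_infty ⟨(1 + L) * ‖ξ‖, forall_mem_range.2 (bound ξ)⟩⟩
      map_add' := fun ξ ζ => by
        ext1
        funext i
        simp only [lp.coeFn_add, Pi.add_apply, map_add]
        abel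
      map_smul' := fun a ξ => by
        ext1
        funext i
        simp only [lp.coeFn_smul, Pi.smul_apply, map_smul, smul_sub, RingHom.id_apply] }
  exact ⟨D₀.mkContinuous (1 + L) fun ξ =>
    lp.norm_le_of_forall_le (by positivity) (bound ξ), fun ξ i => rfl⟩

theorem IsHyperbolicSet.exists_equiv [ProperSpace E]
    (h : IsBiholomorphism f finv) {S : Set E} (hS : IsCompact S) (hinv : Invariant f S)
    (hyp : IsHyperbolicSet f finv S) :
    ∃ M : ℝ, ∀ z ∈ S,
      ∃ T : (lp (fun _ : ℤ => E) ∞) ≃L[ℂ] (lp (fun _ : ℤ => E) ∞),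
        (∀ ξ : lp (fun _ : ℤ => E) ∞, ∀ i : ℤ,
          T ξ i = ξ (i + 1) - fderiv ℂ f (orbitZ f finv z i) (ξ i)) ∧
        ‖(T.symm : (lp (fun _ : ℤ => E) ∞) →L[ℂ] (lp (fun _ : ℤ => E) ∞))‖ ≤ M := by
  obtain ⟨R, hR, hsol⟩ := hyp.exists_bounded_solution h hS hinv
  obtain ⟨L, hL0, hL⟩ := h.exists_norm_fderiv_le hS
  refine ⟨R, fun z hz => ?_⟩
  obtain ⟨hex, huniq⟩ := hsol z hz
  obtain ⟨D, hD⟩ := exists_variationOp (fun i => fderiv ℂ f (orbitZ f finv z i)) hL0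
    fun i => hL _ (h.orbitZ_mem hinv hz i)
  have hinj : D.ker = ⊥ := by
    rw [eq_bot_iff]
    intro ξ hξ
    rw [Submodule.mem_bot]
    ext1
    funext i
    refine huniq ξ ‖ξ‖ (lp.norm_apply_le_norm (by simp) ξ) (fun j => ?_) i
    have hz0 : D ξ = 0 := hξ
    have := hD ξ j
    rw [hz0] at this
    exact sub_eq_zero.1 this.symm
  have hpre : ∀ η, ∃ ξ, ‖ξ‖ ≤ R * ‖η‖ ∧ D ξ = η := fun η => by
    obtain ⟨ξ, hξ, hξη⟩ := hex η ‖η‖ (lp.norm_apply_le_norm (by simp) η)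
    refine ⟨⟨ξ, memℓp_infty ⟨R * ‖η‖, forall_mem_range.2 hξ⟩⟩,
      lp.norm_le_of_forall_le (by positivity) hξ, ?_⟩
    ext1
    funext i
    rw [hD]
    exact hξη i
  have hsurj : D.range = ⊤ := by
    rw [eq_top_iff]
    intro η _
    obtain ⟨ξ, -, hξ⟩ := hpre η
    exact ⟨ξ, hξ⟩
  refine ⟨ContinuousLinearEquiv.ofBijective D hinj hsurj, hD, ?_⟩
  refine ContinuousLinearMap.opNorm_le_bound _ hR fun η => ?_
  obtain ⟨ξ, hξ, rfl⟩ := hpre η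
  have := ContinuousLinearEquiv.ofBijective_symm_apply_apply D hinj hsurj ξ
  rw [ContinuousLinearEquiv.coe_coe, this]
  exact hξ

end HyperbolicToInvertible

section InvertibleToHyperbolic

variable {E : Type*} [NormedAddCommGroup E] [NormedSpace ℂ E] {f finv : E → E}

/-- The vectors whose images under a sequence of operators form a bounded sequence. -/
def boundedSubspace (L : ℕ → E →L[ℂ] E) : Submodule ℂ E where
  carrier := {v | ∃ C : ℝ, ∀ n, ‖L n v‖ ≤ C}
  zero_mem' := ⟨0, fun n => by simp⟩
  add_mem' := by
    rintro v w ⟨C, hC⟩ ⟨D, hD⟩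
    exact ⟨C + D, fun n => by rw [map_add]; exact norm_add_le_of_le (hC n) (hD n)⟩
  smul_mem' := by
    rintro a v ⟨C, hC⟩
    exact ⟨‖a‖ * C, fun n => by rw [map_smul, norm_smul]; gcongr; exact hC n⟩

theorem mem_boundedSubspace {L : ℕ → E →L[ℂ] E} {v : E} :
    v ∈ boundedSubspace L ↔ ∃ C : ℝ, ∀ n, ‖L n v‖ ≤ C := Iff.rfl

/-- The vectors with bounded forward orbit under the derivative cocycle. -/
def stableSubspace (f finv : E → E) (z : E) : Submodule ℂ E :=
  boundedSubspace fun n => orbitDeriv f finv z n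

/-- The vectors with bounded backward orbit under the derivative cocycle. -/
def unstableSubspace (f finv : E → E) (z : E) : Submodule ℂ E :=
  boundedSubspace fun n => orbitDeriv f finv z (-n)

/-- `ξ ↦ (ξ_{i+1} − Df(z_i)ξ_i)_i` is invertible on `l_∞` along the orbit of `z`, with inverse of
norm at most `M`. -/
def HasGreenBound (f finv : E → E) (M : ℝ) (z : E) : Prop :=
  ∃ T : (lp (fun _ : ℤ => E) ∞) ≃L[ℂ] (lp (fun _ : ℤ => E) ∞),
    (∀ ξ : lp (fun _ : ℤ => E) ∞, ∀ i : ℤ,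
      T ξ i = ξ (i + 1) - fderiv ℂ f (orbitZ f finv z i) (ξ i)) ∧
    ‖(T.symm : (lp (fun _ : ℤ => E) ∞) →L[ℂ] (lp (fun _ : ℤ => E) ∞))‖ ≤ M

/-- A priori estimate: a residual up to `K` plus a small multiple of the sequence controls the
sequence. -/
theorem HasGreenBound.norm_le {M : ℝ} {z : E} (hM : 0 < M) (hz : HasGreenBound f finv M z)
    {g : ℤ → E} {B K : ℝ} (hB : ∀ i, ‖g i‖ ≤ B)
    (hK : ∀ i, ‖g (i + 1) - fderiv ℂ f (orbitZ f finv z i) (g i)‖ ≤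
      K + (2 * M)⁻¹ * ‖g (i + 1)‖) (i : ℤ) : ‖g i‖ ≤ 2 * M * K := by
  obtain ⟨T, hT, hTM⟩ := hz
  set ξ : lp (fun _ : ℤ => E) ∞ := ⟨g, memℓp_infty ⟨B, forall_mem_range.2 hB⟩⟩
  have h1 : ‖T ξ‖ ≤ K + (2 * M)⁻¹ * ‖ξ‖ := lp.norm_le_of_forall_le' _ fun i => by
    rw [hT]
    refine (hK i).trans ?_
    gcongr
    exact lp.norm_apply_le_norm (by simp) ξ (i + 1)
  have h2 : ‖ξ‖ ≤ M * ‖T ξ‖ := by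
    have := ContinuousLinearMap.le_of_opNorm_le _ hTM (T ξ)
    simpa using this
  have h3 : ‖ξ‖ ≤ M * K + ‖ξ‖ / 2 := by
    calc ‖ξ‖ ≤ M * (K + (2 * M)⁻¹ * ‖ξ‖) := h2.trans (by gcongr)
      _ = M * K + ‖ξ‖ / 2 := by field_simp
  have h4 : ‖g i‖ ≤ ‖ξ‖ := lp.norm_apply_le_norm (by simp) ξ i
  linarith

theorem HasGreenBound.mono {M M' : ℝ} {z : E} (hz : HasGreenBound f finv M z) (hM : M ≤ M') :
    HasGreenBound f finv M' z :=
  let ⟨T, hT, hTM⟩ := hz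
  ⟨T, hT, hTM.trans hM⟩

theorem HasGreenBound.eq_zero {M : ℝ} {z : E} (h : IsBiholomorphism f finv) (hM : 0 < M)
    (hz : HasGreenBound f finv M z) {v : E} (hs : v ∈ stableSubspace f finv z)
    (hu : v ∈ unstableSubspace f finv z) : v = 0 := by
  obtain ⟨C, hC⟩ := mem_boundedSubspace.1 hs
  obtain ⟨D, hD⟩ := mem_boundedSubspace.1 hu
  have := hz.norm_le hM (g := fun i => orbitDeriv f finv z i v) (B := max C D) (K := 0)
    (fun i => by
      rcases Int.eq_nat_or_neg i with ⟨n, rfl | rfl⟩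
      · exact (hC n).trans (le_max_left _ _)
      · exact (hD n).trans (le_max_right _ _))
    (fun i => by rw [h.orbitDeriv_add_one, sub_self, norm_zero]; positivity) 0
  rw [orbitDeriv_zero_apply, mul_zero] at this
  exact norm_le_zero_iff.1 this

theorem HasGreenBound.exists_splitting {M : ℝ} {z : E} (h : IsBiholomorphism f finv) (hM : 0 < M)
    (hz : HasGreenBound f finv M z) (v : E) :
    ∃ s ∈ stableSubspace f finv z, v - s ∈ unstableSubspace f finv z ∧ ‖s‖ ≤ 2 * M * ‖v‖ := by
  obtain ⟨T, hT, hTM⟩ := id hz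
  set ξ := T.symm (lp.single ∞ (-1) v)
  have hξb : ∀ i, ‖ξ i‖ ≤ ‖ξ‖ := lp.norm_apply_le_norm (by simp) ξ
  have hξ : ∀ i, ξ (i + 1) - fderiv ℂ f (orbitZ f finv z i) (ξ i) =
      if i = -1 then v else 0 := fun i => by
    rw [← hT, T.apply_symm_apply, lp.single_apply]
    by_cases hi : i = -1
    · subst hi; simp
    · simp [hi]
  have hne : ∀ i, i ≠ -1 → ξ (i + 1) = fderiv ℂ f (orbitZ f finv z i) (ξ i) := fun i hi =>
    sub_eq_zero.1 (by rw [hξ, if_neg hi])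
  refine ⟨ξ 0, mem_boundedSubspace.2 ⟨‖ξ‖, fun n => ?_⟩,
    mem_boundedSubspace.2 ⟨max ‖ξ‖ ‖v - ξ 0‖, fun n => ?_⟩, ?_⟩
  · rw [← h.eq_orbitDeriv_of_nonneg (g := ξ) (fun i hi => hne i (by omega)) n]
    exact hξb _
  · set g : ℤ → E := fun i => if i < 0 then -ξ i else v - ξ 0
    have hg0 : g 0 = v - ξ 0 := by simp [g]
    suffices hg : ∀ i, i < 0 → g (i + 1) = fderiv ℂ f (orbitZ f finv z i) (g i) by
      have e := h.eq_orbitDeriv_of_neg hg n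
      rw [hg0] at e
      rw [← e]
      simp only [g]
      split_ifs
      · rw [norm_neg]
        exact (hξb _).trans (le_max_left _ _)
      · exact le_max_right _ _
    intro i hi
    simp only [g, if_pos hi, map_neg]
    by_cases h1 : i = -1
    · subst h1
      have := hξ (-1)
      simp only [neg_add_cancel, if_true] at this
      rw [← this]
      simp
    · rw [if_pos (by omega), hne i h1]
  · refine hz.norm_le hM hξb (fun i => ?_) 0
    rw [hξ]
    have : 0 ≤ (2 * M)⁻¹ * ‖ξ (i + 1)‖ := by positivity
    split_ifs
    · linarith
    · rw [norm_zero]; positivity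

theorem abs_pow_min_sub_le {μ : ℝ} (hμ : 1 ≤ μ) (n N : ℕ) :
    |μ ^ min (n + 1) N - μ ^ min n N| ≤ (μ - 1) * μ ^ min n N := by
  have h0 : 0 < μ ^ min n N := by positivity
  rcases lt_or_ge n N with hn | hn
  · rw [min_eq_left (by omega), min_eq_left hn.le, pow_succ, abs_of_nonneg]
    · linarith
    · nlinarith [pow_pos (zero_lt_one.trans_le hμ) n]
  · rw [min_eq_right (by omega), min_eq_right hn, sub_self, abs_zero]
    have : 0 ≤ μ - 1 := by linarith
    positivity

theorem HasGreenBound.norm_stable_le {M : ℝ} {z : E} (h : IsBiholomorphism f finv) (hM : 0 < M)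
    (hz : HasGreenBound f finv M z) {v : E} (hv : v ∈ stableSubspace f finv z) (N : ℕ) :
    (1 + (2 * M)⁻¹) ^ N * ‖orbitDeriv f finv z N v‖ ≤ 2 * M * ‖v‖ := by
  obtain ⟨C, hC⟩ := mem_boundedSubspace.1 hv
  set μ := 1 + (2 * M)⁻¹ with hμ
  have hμ1 : 1 ≤ μ := by rw [hμ]; simp [hM.le]
  have hμ0 : 0 < μ := by linarith
  have hC0 : 0 ≤ C := (norm_nonneg _).trans (hC 0)
  set g : ℤ → E := fun i =>
    if 0 ≤ i then (μ ^ min i.toNat N : ℝ) • orbitDeriv f finv z i v else 0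
  have hg : ∀ n : ℕ, g n = (μ ^ min n N : ℝ) • orbitDeriv f finv z n v := fun n => by simp [g]
  have hgneg : ∀ i < 0, g i = 0 := fun i hi => if_neg (by omega)
  have hgn : ∀ n : ℕ, ‖g n‖ = μ ^ min n N * ‖orbitDeriv f finv z n v‖ := fun n => by
    rw [hg, norm_smul, Real.norm_of_nonneg (by positivity)]
  have := hz.norm_le hM (g := g) (B := μ ^ N * C) (K := ‖v‖) (fun i => ?_) (fun i => ?_) N
  · rwa [hgn, min_self] at this
  · rcases lt_or_ge i 0 with hi | hi
    · rw [hgneg i hi, norm_zero]; positivity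
    · lift i to ℕ using hi
      rw [hgn]
      gcongr
      · exact min_le_right _ _
      · exact hC i
  · rcases lt_or_ge i 0 with hi | hi
    · rw [hgneg i hi, map_zero, sub_zero]
      rcases eq_or_ne i (-1) with rfl | hi1
      · have e : g (-1 + 1) = v := by
          have := hg 0
          rw [Nat.cast_zero] at this
          simp [this, orbitDeriv_zero_apply]
        rw [e]
        have : 0 ≤ (2 * M)⁻¹ * ‖v‖ := by positivity
        linarith
      · rw [hgneg _ (by omega), norm_zero]; positivity
    · lift i to ℕ using hi
      have e : g (i + 1) - fderiv ℂ f (orbitZ f finv z i) (g i) =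
          (μ ^ min (i + 1) N - μ ^ min i N : ℝ) • orbitDeriv f finv z (i + 1) v := by
        have := hg (i + 1)
        rw [Nat.cast_succ] at this
        rw [this, hg, ← Complex.coe_smul (μ ^ min i N), map_smul, Complex.coe_smul,
          ← h.orbitDeriv_add_one, sub_smul]
      have e2 := hgn (i + 1)
      rw [Nat.cast_succ] at e2
      rw [e, e2, norm_smul, Real.norm_eq_abs]
      have hb := abs_pow_min_sub_le hμ1 i N
      have hle : μ ^ min i N ≤ μ ^ min (i + 1) N := by gcongr; simp
      have : |μ ^ min (i + 1) N - μ ^ min i N| ≤ (2 * M)⁻¹ * μ ^ min (i + 1) N :=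
        hb.trans (by rw [hμ, add_sub_cancel_left]; gcongr)
      calc _ ≤ (2 * M)⁻¹ * μ ^ min (i + 1) N * ‖orbitDeriv f finv z (i + 1) v‖ := by gcongr
        _ ≤ _ := by linarith [norm_nonneg v]

theorem HasGreenBound.norm_unstable_le {M L : ℝ} {z : E} (h : IsBiholomorphism f finv)
    (hM : 0 < M) (hz : HasGreenBound f finv M z) (hL : ‖fderiv ℂ f z‖ ≤ L) {v : E}
    (hv : v ∈ unstableSubspace f finv z) (N : ℕ) :
    (1 + (2 * M)⁻¹) ^ N * ‖orbitDeriv f finv z (-N) v‖ ≤ 2 * M * (L * ‖v‖) := by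
  obtain ⟨C, hC⟩ := mem_boundedSubspace.1 hv
  set μ := 1 + (2 * M)⁻¹ with hμ
  have hμ1 : 1 ≤ μ := by rw [hμ]; simp [hM.le]
  have hμ0 : 0 < μ := by linarith
  have hC0 : 0 ≤ C := (norm_nonneg _).trans (hC 0)
  have hL0 : 0 ≤ L := (norm_nonneg _).trans hL
  set g : ℤ → E := fun i =>
    if i ≤ 0 then (μ ^ min (-i).toNat N : ℝ) • orbitDeriv f finv z i v else 0
  have hg : ∀ n : ℕ, g (-n) = (μ ^ min n N : ℝ) • orbitDeriv f finv z (-n) v := fun n => by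
    simp [g]
  have hgpos : ∀ i > 0, g i = 0 := fun i hi => if_neg (by omega)
  have hgn : ∀ n : ℕ, ‖g (-n)‖ = μ ^ min n N * ‖orbitDeriv f finv z (-n) v‖ := fun n => by
    rw [hg, norm_smul, Real.norm_of_nonneg (by positivity)]
  have := hz.norm_le hM (g := g) (B := μ ^ N * C) (K := L * ‖v‖) (fun i => ?_) (fun i => ?_) (-N)
  · rwa [hgn, min_self] at this
  · rcases lt_or_ge 0 i with hi | hi
    · rw [hgpos i hi, norm_zero]; positivity
    · obtain ⟨n, rfl⟩ : ∃ n : ℕ, i = -n := ⟨(-i).toNat, by omega⟩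
      rw [hgn]
      gcongr
      · exact min_le_right _ _
      · exact hC n
  · rcases lt_trichotomy i 0 with hi | rfl | hi
    · obtain ⟨n, rfl⟩ : ∃ n : ℕ, i = -(n + 1 : ℕ) := ⟨(-i - 1).toNat, by omega⟩
      have e1 : -((n + 1 : ℕ) : ℤ) + 1 = -n := by push_cast; ring
      have e : g (-(n + 1 : ℕ) + 1) - fderiv ℂ f (orbitZ f finv z (-(n + 1 : ℕ)))
          (g (-(n + 1 : ℕ))) =
          (μ ^ min n N - μ ^ min (n + 1) N : ℝ) • orbitDeriv f finv z (-n) v := by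
        rw [hg (n + 1), ← Complex.coe_smul (μ ^ min (n + 1) N), map_smul, Complex.coe_smul,
          ← h.orbitDeriv_add_one, e1, hg, sub_smul]
      rw [e, e1, hgn, norm_smul, Real.norm_eq_abs, abs_sub_comm]
      have hb := abs_pow_min_sub_le hμ1 n N
      rw [hμ, add_sub_cancel_left, ← hμ] at hb
      have : 0 ≤ L * ‖v‖ := by positivity
      calc _ ≤ (2 * M)⁻¹ * μ ^ min n N * ‖orbitDeriv f finv z (-n) v‖ := by gcongr
        _ ≤ _ := by linarith
    · have e : g 0 = v := by
        have := hg 0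
        rw [Nat.cast_zero, neg_zero] at this
        simp [this, orbitDeriv_zero_apply]
      rw [hgpos (0 + 1) (by norm_num), e, zero_sub, norm_neg, norm_zero, mul_zero, add_zero,
        orbitZ_zero]
      exact (fderiv ℂ f z).le_of_opNorm_le hL v
    · rw [hgpos i hi, hgpos _ (by omega), map_zero, sub_zero, norm_zero]
      positivity

namespace IsBiholomorphism

theorem map_fderiv_eq (h : IsBiholomorphism f finv) {W : E → Submodule ℂ E} {z : E}
    (hW : ∀ v, fderiv ℂ f z v ∈ W (f z) ↔ v ∈ W z) :
    (W z).map (fderiv ℂ f z).toLinearMap = W (f z) := by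
  ext u
  constructor
  · rintro ⟨v, hv, rfl⟩
    exact (hW v).2 hv
  · intro hu
    have hsurj := h.orbitDeriv_self_neg_apply z 1 u
    rw [orbitDeriv_one] at hsurj
    exact ⟨_, (hW _).1 (by rwa [hsurj]), hsurj⟩

theorem map_stableSubspace (h : IsBiholomorphism f finv) (z : E) :
    (stableSubspace f finv z).map (fderiv ℂ f z).toLinearMap = stableSubspace f finv (f z) := by
  refine h.map_fderiv_eq fun v => ?_
  have key : ∀ n : ℕ, orbitDeriv f finv (f z) n (fderiv ℂ f z v) =
      orbitDeriv f finv z (n + 1 : ℕ) v := fun n => by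
    rw [Nat.cast_succ, add_comm, h.orbitDeriv_add, orbitZ_one, orbitDeriv_one]
  simp only [stableSubspace, mem_boundedSubspace, key]
  constructor
  · rintro ⟨C, hC⟩
    refine ⟨max C ‖orbitDeriv f finv z (0 : ℕ) v‖, fun n => ?_⟩
    rcases n with _ | n
    · exact le_max_right _ _
    · exact (hC n).trans (le_max_left _ _)
  · rintro ⟨C, hC⟩
    exact ⟨C, fun n => hC (n + 1)⟩

theorem map_unstableSubspace (h : IsBiholomorphism f finv) (z : E) :
    (unstableSubspace f finv z).map (fderiv ℂ f z).toLinearMap =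
      unstableSubspace f finv (f z) := by
  refine h.map_fderiv_eq fun v => ?_
  have key : ∀ n : ℕ, orbitDeriv f finv (f z) (-(n + 1 : ℕ)) (fderiv ℂ f z v) =
      orbitDeriv f finv z (-n) v := fun n => by
    rw [show -(n : ℤ) = 1 + -(n + 1 : ℕ) by push_cast; ring, h.orbitDeriv_add, orbitZ_one,
      orbitDeriv_one]
  simp only [unstableSubspace, mem_boundedSubspace]
  constructor
  · rintro ⟨C, hC⟩
    exact ⟨C, fun n => key n ▸ hC (n + 1)⟩
  · rintro ⟨C, hC⟩
    refine ⟨max C ‖orbitDeriv f finv (f z) (-(0 : ℕ)) (fderiv ℂ f z v)‖, fun n => ?_⟩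
    rcases n with _ | n
    · exact le_max_right _ _
    · rw [key]
      exact (hC n).trans (le_max_left _ _)

end IsBiholomorphism

theorem tendsto_clm_apply {α : Type*} {l : Filter α} {A : α → E →L[ℂ] E} {B : E →L[ℂ] E}
    {v : α → E} {w : E} (hA : Tendsto A l (𝓝 B)) (hv : Tendsto v l (𝓝 w)) :
    Tendsto (fun a => A a (v a)) l (𝓝 (B w)) :=
  (isBoundedBilinearMap_apply.continuous.tendsto (B, w)).comp (hA.prodMk_nhds hv)

/-- Uniform invertibility of the variational operators along the orbits in `S` gives uniform
hyperbolicity: the stable and unstable spaces are the spaces of vectors with bounded forward and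
backward orbits. -/
theorem isHyperbolicSet_of_hasGreenBound [FiniteDimensional ℂ E] (h : IsBiholomorphism f finv)
    {S : Set E} (hS : IsCompact S) {M : ℝ} (hgreen : ∀ z ∈ S, HasGreenBound f finv M z) :
    IsHyperbolicSet f finv S := by
  have : ProperSpace E := FiniteDimensional.proper ℂ E
  have : ProperSpace (E →L[ℂ] E) := FiniteDimensional.proper ℂ (E →L[ℂ] E)
  wlog hM : 0 < M generalizing M
  · exact this (fun z hz => (hgreen z hz).mono (le_max_left M 1)) (by positivity)
  obtain ⟨L, hL0, hL⟩ := h.exists_norm_fderiv_le hS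
  have hP : ∀ z, ∃ P : E →L[ℂ] E, z ∈ S → (∀ v, P v ∈ stableSubspace f finv z ∧
      v - P v ∈ unstableSubspace f finv z) ∧ ‖P‖ ≤ 2 * M := fun z => by
    by_cases hz : z ∈ S
    · have hspl := (hgreen z hz).exists_splitting h hM
      have hcompl : IsCompl (stableSubspace f finv z) (unstableSubspace f finv z) := by
        refine ⟨Submodule.disjoint_def.2 fun v => (hgreen z hz).eq_zero h hM,
          codisjoint_iff.2 (eq_top_iff.2 fun v _ => ?_)⟩
        obtain ⟨s, hs, hu, -⟩ := hspl v
        exact Submodule.mem_sup.2 ⟨s, hs, v - s, hu, add_sub_cancel s v⟩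
      have hval : ∀ v, ∀ s ∈ stableSubspace f finv z, v - s ∈ unstableSubspace f finv z →
          Submodule.projection _ _ hcompl v = s := fun v s hs hu => by
        rw [← add_sub_cancel s v, map_add, Submodule.projection_apply_of_mem_right hcompl hu, add_zero]
        exact Submodule.projection_apply_left hcompl ⟨s, hs⟩
      refine ⟨(Submodule.projection _ _ hcompl).toContinuousLinearMap, fun _ => ⟨fun v => ?_, ?_⟩⟩
      · obtain ⟨s, hs, hu, -⟩ := hspl v
        rw [LinearMap.coe_toContinuousLinearMap', hval v s hs hu]
        exact ⟨hs, hu⟩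
      · refine ContinuousLinearMap.opNorm_le_bound _ (by positivity) fun v => ?_
        obtain ⟨s, hs, hu, hsv⟩ := hspl v
        rwa [LinearMap.coe_toContinuousLinearMap', hval v s hs hu]
    · exact ⟨0, fun h => absurd h hz⟩
  choose P hP using hP
  have huniq : ∀ z ∈ S, ∀ v, ∀ s ∈ stableSubspace f finv z, v - s ∈ unstableSubspace f finv z →
      P z v = s := fun z hz v s hs hu => by
    obtain ⟨hs', hu'⟩ := (hP z hz).1 v
    refine sub_eq_zero.1 ((hgreen z hz).eq_zero h hM (sub_mem hs' hs) ?_)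
    have := sub_mem hu hu'
    rwa [_root_.sub_sub_sub_cancel_left] at this
  set μ := 1 + (2 * M)⁻¹ with hμ
  have hμ1 : 1 < μ := by rw [hμ]; simp [hM]
  have hμ0 : 0 < μ := by linarith
  have hs : ∀ z ∈ S, ∀ v ∈ stableSubspace f finv z, ∀ n : ℕ,
      ‖orbitDeriv f finv z n v‖ ≤ 2 * M * μ⁻¹ ^ n * ‖v‖ := fun z hz v hv n => by
    have := (hgreen z hz).norm_stable_le h hM hv n
    rw [inv_pow, mul_right_comm, ← div_eq_mul_inv, le_div_iff₀ (by positivity)]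
    linarith
  have hu : ∀ z ∈ S, ∀ v ∈ unstableSubspace f finv z, ∀ n : ℕ,
      ‖orbitDeriv f finv z (-n) v‖ ≤ 2 * M * (L + 1) * (μ ^ n)⁻¹ * ‖v‖ := fun z hz v hv n => by
    have := (hgreen z hz).norm_unstable_le h hM (hL z hz) hv n
    rw [mul_right_comm, ← div_eq_mul_inv, le_div_iff₀ (by positivity)]
    have : 0 ≤ 2 * M * ‖v‖ := by positivity
    linarith
  refine ⟨stableSubspace f finv, unstableSubspace f finv, P, 2 * M, 2 * M * (L + 1), μ⁻¹, μ,
    by positivity, by positivity, by positivity, inv_lt_one_of_one_lt₀ hμ1, hμ1, ?_,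
    fun z hz => (hP z hz).1, fun z hz v hv => huniq z hz v v hv (by simp),
    fun z hz v hv => huniq z hz v 0 (zero_mem _) (by simpa),
    fun z _ => h.map_stableSubspace z, fun z _ => h.map_unstableSubspace z,
    fun z hz n _ v hv => ?_, fun z hz n _ v hv => ?_⟩
  · intro z hz
    refine (isCompact_closedBall (0 : E →L[ℂ] E) (2 * M)).tendsto_nhds_of_unique_mapClusterPt
      ?_ fun Q _ hQ => ?_
    · filter_upwards [self_mem_nhdsWithin] with w hw
      simpa using (hP w hw).2
    · obtain ⟨U, hU, hUQ⟩ := mapClusterPt_iff_ultrafilter.1 hQ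
      have hUS : ∀ᶠ w in (U : Filter E), w ∈ S := hU self_mem_nhdsWithin
      have hUz : (U : Filter E) ≤ 𝓝 z := hU.trans nhdsWithin_le_nhds
      have hΦ : ∀ i, Tendsto (fun w => orbitDeriv f finv w i) U (𝓝 (orbitDeriv f finv z i)) :=
        fun i => ((h.continuous_orbitDeriv i).tendsto z).mono_left hUz
      ext1 v
      have hPv : Tendsto (fun w => P w v) U (𝓝 (Q v)) := tendsto_clm_apply hUQ tendsto_const_nhds
      have hPv' : Tendsto (fun w => v - P w v) U (𝓝 (v - Q v)) := hPv.const_sub v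
      have hpow : ∀ n : ℕ, μ⁻¹ ^ n ≤ 1 := fun n =>
        pow_le_one₀ (by positivity) (inv_le_one_of_one_le₀ hμ1.le)
      refine (huniq z hz v (Q v) ?_ ?_).symm
      · refine mem_boundedSubspace.2 ⟨2 * M * ‖Q v‖, fun n => ?_⟩
        refine le_of_tendsto_of_tendsto (tendsto_clm_apply (hΦ n) hPv).norm
          (hPv.norm.const_mul (2 * M)) ?_
        filter_upwards [hUS] with w hw
        refine (hs w hw _ ((hP w hw).1 v).1 n).trans ?_
        exact mul_le_mul_of_nonneg_right (mul_le_of_le_one_right (by positivity) (hpow n))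
          (norm_nonneg _)
      · refine mem_boundedSubspace.2 ⟨2 * M * (L + 1) * ‖v - Q v‖, fun n => ?_⟩
        refine le_of_tendsto_of_tendsto (tendsto_clm_apply (hΦ (-n)) hPv').norm
          (hPv'.norm.const_mul (2 * M * (L + 1))) ?_
        filter_upwards [hUS] with w hw
        refine (hu w hw _ ((hP w hw).1 v).2 n).trans ?_
        rw [← inv_pow]
        exact mul_le_mul_of_nonneg_right (mul_le_of_le_one_right (by positivity) (hpow n))
          (norm_nonneg _)
  · rw [← orbitDeriv_natCast (finv := finv)]
    exact hs z hz v hv n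
  · rw [← orbitDeriv_neg_natCast (f := f)]
    exact hu z hz v hv n

end InvertibleToHyperbolic

/-- A compact invariant set `S` of a diffeomorphism `f` of `ℂ^k` (`k ≥ 2`) is
uniformly hyperbolic iff for every orbit `z = (f^i(z₀))_{i∈ℤ}` with `z₀ ∈ S`, the
bounded linear operator `DF(z; f) : ξ ↦ (ξ_{i+1} − Df(z_i)ξ_i)_i` on `l_∞(ℤ, ℂ^k)`
is invertible, with the operator norms of the inverses uniformly bounded. -/
theorem hyperbolic_iff_DF_invertible (k : ℕ) (hk : 2 ≤ k)
    (f finv : Ck k → Ck k) (hf : Differentiable ℂ f) (hfinv : Differentiable ℂ finv)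
    (hli : Function.LeftInverse finv f) (hri : Function.RightInverse finv f)
    (S : Set (Ck k)) (hS : IsCompact S) (hinvS : Invariant f S) :
    IsHyperbolicSet f finv S ↔
      ∃ M : ℝ, ∀ z0 ∈ S,
        ∃ T : (lp (fun _ : ℤ => Ck k) ∞) ≃L[ℂ] (lp (fun _ : ℤ => Ck k) ∞),
          (∀ ξ : lp (fun _ : ℤ => Ck k) ∞, ∀ i : ℤ,
            T ξ i = ξ (i + 1) - fderiv ℂ f (orbitZ f finv z0 i) (ξ i)) ∧
          ‖(T.symm : (lp (fun _ : ℤ => Ck k) ∞) →L[ℂ] (lp (fun _ : ℤ => Ck k) ∞))‖ ≤ M := by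
  have h : IsBiholomorphism f finv := ⟨hf, hfinv, hli, hri⟩
  exact ⟨fun hyp => hyp.exists_equiv h hS hinvS,
    fun ⟨_, hM⟩ => isHyperbolicSet_of_hasGreenBound h hS hM⟩
end
end

section
/- Let f : ℂ → ℂ be holomorphic and let S be a compact f-invariant set. Then S is uniformly expanding if and only if for every forward orbit (x_i)_{i≥0} with x₀ ∈ S and x_i = f^i(x₀), and every bounded sequence (η_i)_{i≥0} in ℂ, the recurrence ξ_{i+1} − f'(x_i)·ξ_i = η_i for all i ≥ 0 has a unique bounded solution (ξ_i)_{i≥0}. -/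
noncomputable section
open Set Metric Topology Filter ENNReal

/-- A set `S` is uniformly expanding for `f : ℂ → ℂ`:
`∃ C > 0, λ > 1` with `|D(fⁿ)(z)| ≥ C·λⁿ` for all `z ∈ S`, `n ≥ 1`. -/
def IsExpandingOn (f : ℂ → ℂ) (S : Set ℂ) : Prop :=
  ∃ C > 0, ∃ lam > 1, ∀ z ∈ S, ∀ n : ℕ, 1 ≤ n → C * lam ^ n ≤ ‖deriv (f^[n]) z‖

/-- Chain rule for iterates. -/
theorem deriv_iterate_add {f : ℂ → ℂ} (hf : Differentiable ℂ f) (m n : ℕ) (x : ℂ) :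
    deriv (f^[m + n]) x = deriv (f^[m]) (f^[n] x) * deriv (f^[n]) x := by
  rw [Function.iterate_add]
  exact deriv_comp x (hf.iterate m _) (hf.iterate n x)

theorem Invariant.iterate_mem {α : Type*} {f : α → α} {S : Set α} (h : Invariant f S) {x : α}
    (hx : x ∈ S) (n : ℕ) : f^[n] x ∈ S := by
  have hmaps : MapsTo f S S := fun y hy => by
    have : y ∈ f ⁻¹' S := by rw [h]; exact hy
    exact this
  exact hmaps.iterate n hx

/-- If every point of a compact invariant set has an unbounded derivative cocycle along its
orbit, then the set is uniformly expanding. -/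
theorem isExpandingOn_of_unbounded {f : ℂ → ℂ} (hf : Differentiable ℂ f) {S : Set ℂ}
    (hS : IsCompact S) (hinv : Invariant f S)
    (h : ∀ x ∈ S, ∀ R : ℝ, ∃ n, R < ‖deriv (f^[n]) x‖) : IsExpandingOn f S := by
  have hcont : ∀ n, Continuous fun x => ‖deriv (f^[n]) x‖ := fun n =>
    ((hf.iterate n).contDiff (n := 1)).continuous_deriv le_rfl |>.norm
  obtain ⟨N, hN⟩ : ∃ N : ℕ, S ⊆ ⋃ n ≤ N, {x | 2 < ‖deriv (f^[n]) x‖} := by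
    refine hS.elim_directed_cover (fun N : ℕ => ⋃ n ≤ N, {x | 2 < ‖deriv (f^[n]) x‖}) ?_ ?_ ?_
    · exact fun N => isOpen_biUnion fun n _ => isOpen_lt continuous_const (hcont n)
    · intro x hx
      obtain ⟨n, hn⟩ := h x hx 2
      simp only [mem_iUnion]
      exact ⟨n, n, le_rfl, hn⟩
    · exact Monotone.directed_le fun a b hab =>
        biUnion_mono (fun n hn => le_trans hn hab) fun _ _ => Subset.rfl
  have hN' : ∀ x ∈ S, ∃ n, 1 ≤ n ∧ n ≤ N ∧ 2 < ‖deriv (f^[n]) x‖ := by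
    intro x hx
    have := hN hx
    simp only [mem_iUnion] at this
    obtain ⟨n, hn, h2⟩ := this
    refine ⟨n, Nat.one_le_iff_ne_zero.2 ?_, hn, h2⟩
    rintro rfl
    simp only [Function.iterate_zero, mem_ofPred_eq, deriv_id, norm_one] at h2
    norm_num at h2
  obtain ⟨a, ha0, ha1, ha⟩ : ∃ a : ℝ, 0 < a ∧ a ≤ 1 ∧ ∀ x ∈ S, a ≤ ‖deriv f x‖ := by
    obtain ⟨a, ha0, ha⟩ := hS.exists_forall_le' (a := 0) (hcont 1).continuousOn fun x hx => by
      obtain ⟨n, hn, -, h2⟩ := hN' x hx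
      obtain ⟨k, rfl⟩ := Nat.exists_eq_add_of_le' hn
      rw [deriv_iterate_add hf, norm_mul] at h2
      refine norm_pos_iff.2 fun h0 => ?_
      rw [h0, norm_zero, mul_zero] at h2
      norm_num at h2
    exact ⟨min a 1, lt_min ha0 one_pos, min_le_right _ _,
      fun x hx => (min_le_left _ _).trans (ha x hx)⟩
  have hpow : ∀ n, ∀ x ∈ S, a ^ n ≤ ‖deriv (f^[n]) x‖ := by
    intro n
    induction n with
    | zero => intro x _; simp
    | succ n ih =>
      intro x hx
      rw [deriv_iterate_add hf, norm_mul, pow_succ]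
      gcongr
      · exact ih _ (hinv.iterate_mem hx 1)
      · exact ha x hx
  obtain ⟨lam, hlam1, hlam⟩ : ∃ lam : ℝ, 1 < lam ∧ lam ^ N ≤ 2 := by
    have hnhds : ∀ᶠ t : ℝ in 𝓝[>] 1, t ^ N < 2 := by
      refine ((continuous_pow N).tendsto' (1 : ℝ) 1 (one_pow N)).eventually_lt_const
        _root_.one_lt_two |>.filter_mono nhdsWithin_le_nhds
    obtain ⟨t, ht, ht1⟩ := (hnhds.and self_mem_nhdsWithin).exists
    exact ⟨t, ht1, ht.le⟩
  refine ⟨a ^ N / 2, by positivity, lam, hlam1, fun x hx n _ => ?_⟩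
  induction n using Nat.strong_induction_on generalizing x with
  | _ n ih =>
    rcases le_or_gt n N with hn | hn
    · calc a ^ N / 2 * lam ^ n ≤ a ^ N / 2 * 2 := by
            gcongr
            exact (pow_le_pow_right₀ hlam1.le hn).trans hlam
        _ = a ^ N := by ring
        _ ≤ a ^ n := pow_le_pow_of_le_one ha0.le ha1 hn
        _ ≤ _ := hpow n x hx
    · obtain ⟨k, hk1, hkN, hk⟩ := hN' x hx
      obtain ⟨m, rfl⟩ := Nat.exists_eq_add_of_le' (hkN.trans hn.le)
      rw [deriv_iterate_add hf, norm_mul, pow_add, ← mul_assoc]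
      gcongr
      · exact ih m (by omega) _ (hinv.iterate_mem hx k) (by omega)
      · exact ((pow_le_pow_right₀ hlam1.le hkN).trans hlam).trans hk.le

/-- A solution of the homogeneous recurrence is a multiple of the derivative cocycle. -/
theorem eq_deriv_iterate_mul {f : ℂ → ℂ} (hf : Differentiable ℂ f) {x : ℂ} {ξ : ℕ → ℂ}
    (h : ∀ i, ξ (i + 1) - deriv f (f^[i] x) * ξ i = 0) (n : ℕ) :
    ξ n = deriv (f^[n]) x * ξ 0 := by
  induction n with
  | zero => simp
  | succ n ih =>
    rw [sub_eq_zero.1 (h n), ih, add_comm n 1, deriv_iterate_add hf, mul_assoc,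
      Function.iterate_one]

/-- Along an orbit in a uniformly expanding set, the inhomogeneous recurrence has a bounded
solution, given by an absolutely convergent series. -/
theorem IsExpandingOn.exists_bounded_solution {f : ℂ → ℂ} (hf : Differentiable ℂ f) {S : Set ℂ}
    (hinv : Invariant f S) (h : IsExpandingOn f S) {x : ℂ} (hx : x ∈ S) {η : ℕ → ℂ} {R : ℝ}
    (hη : ∀ i, ‖η i‖ ≤ R) :
    ∃ ξ : ℕ → ℂ, (∃ R : ℝ, ∀ i, ‖ξ i‖ ≤ R) ∧
      ∀ i : ℕ, ξ (i + 1) - deriv f (f^[i] x) * ξ i = η i := by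
  obtain ⟨C, hC, lam, hlam, hexp⟩ := h
  have hR : 0 ≤ R := (norm_nonneg _).trans (hη 0)
  have hlam0 : 0 < lam := one_pos.trans hlam
  set b : ℕ → ℝ := fun k => R / C * lam⁻¹ ^ (k + 1) with hb
  have hbs : Summable b :=
    ((summable_nat_add_iff 1).2 (summable_geometric_of_lt_one (by positivity)
      (inv_lt_one_of_one_lt₀ hlam))).mul_left _
  set t : ℕ → ℕ → ℂ := fun i k => η (i + k) / deriv (f^[k + 1]) (f^[i] x) with ht
  have htb : ∀ i k, ‖t i k‖ ≤ b k := by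
    intro i k
    have := hexp _ (hinv.iterate_mem hx i) (k + 1) (by omega)
    calc ‖t i k‖ = ‖η (i + k)‖ / ‖deriv (f^[k + 1]) (f^[i] x)‖ := norm_div _ _
      _ ≤ R / (C * lam ^ (k + 1)) := by gcongr; exact hη _
      _ = b k := by simp only [hb, inv_pow]; field_simp
  have hts : ∀ i, Summable (t i) := fun i => .of_norm_bounded hbs (htb i)
  refine ⟨fun i => -∑' k, t i k, ⟨∑' k, b k, fun i => ?_⟩, fun i => ?_⟩
  · rw [norm_neg]
    exact tsum_of_norm_bounded hbs.hasSum (htb i)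
  · have hd : deriv f (f^[i] x) ≠ 0 := by
      have := hexp _ (hinv.iterate_mem hx i) 1 le_rfl
      rw [Function.iterate_one] at this
      exact norm_pos_iff.1 (lt_of_lt_of_le (by positivity) this)
    have hstep : ∀ k, deriv f (f^[i] x) * t i k =
        η (i + k) / deriv (f^[k]) (f^[i + 1] x) := by
      intro k
      simp only [ht]
      rw [deriv_iterate_add hf, Function.iterate_one, ← Function.iterate_succ_apply' f i x]
      rw [mul_comm (deriv (f^[k]) _), ← mul_div_assoc, mul_div_mul_left _ _ hd]
    have hsum : deriv f (f^[i] x) * ∑' k, t i k = η i + ∑' k, t (i + 1) k := by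
      rw [← tsum_mul_left, ((hts i).mul_left _).tsum_eq_zero_add]
      congr 1
      · rw [hstep]; simp
      · refine tsum_congr fun k => ?_
        rw [hstep]
        simp only [ht, add_assoc, add_comm k 1]
    simp only
    linear_combination hsum

/-- A compact invariant set `S` of a holomorphic map `f : ℂ → ℂ` is uniformly
expanding iff for every forward orbit `(f^i(x₀))_{i≥0}` with `x₀ ∈ S` and every
bounded sequence `(η_i)`, the recurrence `ξ_{i+1} − f'(x_i)·ξ_i = η_i` (`i ≥ 0`)
has a unique bounded solution. -/
theorem expanding_iff_unique_bounded_solution (f : ℂ → ℂ) (hf : Differentiable ℂ f)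
    (S : Set ℂ) (hS : IsCompact S) (hinvS : Invariant f S) :
    IsExpandingOn f S ↔
      ∀ x0 ∈ S, ∀ η : ℕ → ℂ, (∃ R : ℝ, ∀ i, ‖η i‖ ≤ R) →
        ∃ ξ : ℕ → ℂ,
          ((∃ R : ℝ, ∀ i, ‖ξ i‖ ≤ R) ∧
            ∀ i : ℕ, ξ (i + 1) - deriv f (f^[i] x0) * ξ i = η i) ∧
          ∀ ξ' : ℕ → ℂ,
            ((∃ R : ℝ, ∀ i, ‖ξ' i‖ ≤ R) ∧
              ∀ i : ℕ, ξ' (i + 1) - deriv f (f^[i] x0) * ξ' i = η i) →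
            ξ' = ξ := by
  constructor
  · rintro h x0 hx0 η ⟨R, hη⟩
    obtain ⟨ξ, ⟨A, hA⟩, hξ⟩ := h.exists_bounded_solution hf hinvS hx0 hη
    refine ⟨ξ, ⟨⟨A, hA⟩, hξ⟩, ?_⟩
    rintro ξ' ⟨⟨B, hB⟩, hξ'⟩
    have hhom := eq_deriv_iterate_mul hf (x := x0) (ξ := fun i => ξ' i - ξ i)
      fun i => by linear_combination hξ' i - hξ i
    have hzero : ξ' 0 - ξ 0 = 0 := by
      by_contra hne
      obtain ⟨C, hC, lam, hlam, hexp⟩ := h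
      have hpos : 0 < C * ‖ξ' 0 - ξ 0‖ := mul_pos hC (norm_pos_iff.2 hne)
      obtain ⟨n, hn⟩ := pow_unbounded_of_one_lt ((B + A) / (C * ‖ξ' 0 - ξ 0‖)) hlam
      rw [div_lt_iff₀ hpos] at hn
      have hmono : lam ^ n ≤ lam ^ (n + 1) := pow_le_pow_right₀ hlam.le n.le_succ
      have hlow := hexp x0 hx0 (n + 1) (by omega)
      have hup : ‖ξ' (n + 1) - ξ (n + 1)‖ ≤ B + A :=
        (norm_sub_le _ _).trans (add_le_add (hB _) (hA _))
      rw [hhom (n + 1), norm_mul] at hup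
      have h1 := mul_le_mul_of_nonneg_right hlow (norm_nonneg (ξ' 0 - ξ 0))
      have h2 := mul_le_mul_of_nonneg_right hmono hpos.le
      linarith
    funext n
    have := hhom n
    simp only [hzero, mul_zero] at this
    exact sub_eq_zero.1 this
  · intro h
    refine isExpandingOn_of_unbounded hf hS hinvS fun x hx R => ?_
    by_contra! hbd
    obtain ⟨ξ, -, huniq⟩ := h x hx 0 ⟨0, fun i => by simp⟩
    have h0 := huniq 0 ⟨⟨0, fun i => by simp⟩, fun i => by simp⟩
    have h1 := huniq (fun n => deriv (f^[n]) x) ⟨⟨R, hbd⟩, fun i => by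
      rw [add_comm i 1, deriv_iterate_add hf]
      simp⟩
    have := congrFun (h1.trans h0.symm) 0
    simp at this
end
end

section
/- Let f : ℂ → ℂ be holomorphic and let S be a compact f-invariant set. Then S is uniformly expanding if and only if for every forward orbit x⁺ = (f^i(x₀))_{i≥0} with x₀ ∈ S, the bounded linear operator DF(x⁺; f) on l_∞(ℤ⁺, ℂ), given by (ξ_i)_{i≥0} ↦ (ξ_{i+1} − f'(x_i)ξ_i)_{i≥0}, is invertible, with sup over all such orbits x⁺ of ‖DF(x⁺; f)⁻¹‖ finite. -/
noncomputable section
open Set Metric Topology Filter ENNReal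

/-- The chain rule for iterates. -/
theorem deriv_iterate_eq_prod {f : ℂ → ℂ} (hf : Differentiable ℂ f) (x : ℂ) (n : ℕ) :
    deriv f^[n] x = ∏ k ∈ Finset.range n, deriv f (f^[k] x) := by
  induction n with
  | zero => simp [Function.iterate_zero]
  | succ n ih =>
    rw [Function.iterate_succ', deriv_comp x (hf _) (hf.iterate n x), ih,
      Finset.prod_range_succ, mul_comm]

/-- The weighted difference operator `(ξ_i) ↦ (ξ_{i+1} - a_i ξ_i)` on bounded sequences, for a
bounded sequence of weights. -/
def weightedDiff (a : ℕ → ℂ) (A : ℝ) (hA : ∀ i, ‖a i‖ ≤ A) :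
    lp (fun _ : ℕ => ℂ) ∞ →ₗ[ℂ] lp (fun _ : ℕ => ℂ) ∞ where
  toFun ξ := ⟨fun i => ξ (i + 1) - a i * ξ i, memℓp_infty ⟨‖ξ‖ + A * ‖ξ‖, by
    rintro _ ⟨i, rfl⟩
    refine (norm_sub_le _ _).trans (add_le_add (lp.norm_apply_le_norm top_ne_zero ξ _) ?_)
    rw [norm_mul]
    exact mul_le_mul (hA i) (lp.norm_apply_le_norm top_ne_zero ξ i) (norm_nonneg _)
      ((norm_nonneg _).trans (hA i))⟩⟩
  map_add' ξ η := by
    ext i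
    simp only [lp.coeFn_add, Pi.add_apply]
    ring
  map_smul' c ξ := by
    ext i
    simp only [lp.coeFn_smul, Pi.smul_apply, smul_eq_mul, RingHom.id_apply]
    ring

theorem weightedDiff_apply (a : ℕ → ℂ) (A : ℝ) (hA : ∀ i, ‖a i‖ ≤ A)
    (ξ : lp (fun _ : ℕ => ℂ) ∞) (i : ℕ) :
    weightedDiff a A hA ξ i = ξ (i + 1) - a i * ξ i := rfl

theorem norm_weightedDiff_le (a : ℕ → ℂ) (A : ℝ) (hA : ∀ i, ‖a i‖ ≤ A)
    (ξ : lp (fun _ : ℕ => ℂ) ∞) : ‖weightedDiff a A hA ξ‖ ≤ (1 + A) * ‖ξ‖ := by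
  have hA0 : 0 ≤ A := (norm_nonneg _).trans (hA 0)
  refine lp.norm_le_of_forall_le (by positivity) fun i => ?_
  rw [weightedDiff_apply, add_mul, one_mul]
  refine (norm_sub_le _ _).trans (add_le_add (lp.norm_apply_le_norm top_ne_zero ξ _) ?_)
  rw [norm_mul]
  exact mul_le_mul (hA i) (lp.norm_apply_le_norm top_ne_zero ξ i) (norm_nonneg _) hA0

theorem weightedDiff_injective {a : ℕ → ℂ} {A : ℝ} (hA : ∀ i, ‖a i‖ ≤ A) {C lam : ℝ}
    (hC : 0 < C) (hlam : 1 < lam)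
    (h : ∀ i n, 1 ≤ n → C * lam ^ n ≤ ‖∏ k ∈ Finset.range n, a (i + k)‖) :
    Function.Injective (weightedDiff a A hA) := by
  rw [injective_iff_map_eq_zero]
  intro ξ hξ
  have hrec : ∀ i, ξ (i + 1) = a i * ξ i := fun i => by
    rw [← sub_eq_zero, ← weightedDiff_apply a A hA, hξ]
    rfl
  have hprod : ∀ i n, ξ (i + n) = (∏ k ∈ Finset.range n, a (i + k)) * ξ i := by
    intro i n
    induction n with
    | zero => simp
    | succ n ih => rw [← add_assoc, hrec, ih, Finset.prod_range_succ]; ring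
  ext i
  change ξ i = 0
  by_contra hne
  have hpos : 0 < C * ‖ξ i‖ := mul_pos hC (norm_pos_iff.mpr hne)
  obtain ⟨n, hn⟩ := pow_unbounded_of_one_lt (‖ξ‖ / (C * ‖ξ i‖)) hlam
  rw [div_lt_iff₀ hpos] at hn
  have hle : ‖ξ (i + (n + 1))‖ ≤ ‖ξ‖ := lp.norm_apply_le_norm top_ne_zero ξ _
  rw [hprod, norm_mul] at hle
  have h1 := mul_le_mul_of_nonneg_right (h i (n + 1) (by omega)) (norm_nonneg (ξ i))
  have h2 : lam ^ n * (C * ‖ξ i‖) ≤ lam ^ (n + 1) * (C * ‖ξ i‖) :=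
    mul_le_mul_of_nonneg_right (pow_le_pow_right₀ hlam.le n.le_succ) hpos.le
  linarith

theorem exists_weightedDiff_eq {a : ℕ → ℂ} {A : ℝ} (hA : ∀ i, ‖a i‖ ≤ A) {C lam : ℝ}
    (hC : 0 < C) (hlam : 1 < lam)
    (h : ∀ i n, 1 ≤ n → C * lam ^ n ≤ ‖∏ k ∈ Finset.range n, a (i + k)‖)
    (η : lp (fun _ : ℕ => ℂ) ∞) :
    ∃ ξ, weightedDiff a A hA ξ = η ∧ ‖ξ‖ ≤ C⁻¹ * (1 - lam⁻¹)⁻¹ * ‖η‖ := by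
  have hlam0 : 0 < lam := zero_lt_one.trans hlam
  have hinv : lam⁻¹ < 1 := inv_lt_one_of_one_lt₀ hlam
  have hsub : 0 < 1 - lam⁻¹ := sub_pos.mpr hinv
  set u : ℕ → ℕ → ℂ := fun i k => η (i + k) / ∏ j ∈ Finset.range (k + 1), a (i + j) with hu
  have hbound : ∀ i k, ‖u i k‖ ≤ C⁻¹ * ‖η‖ * lam⁻¹ ^ k := by
    intro i k
    have hp : C * lam ^ k ≤ ‖∏ j ∈ Finset.range (k + 1), a (i + j)‖ :=
      (mul_le_mul_of_nonneg_left (pow_le_pow_right₀ hlam.le k.le_succ) hC.le).trans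
        (h i (k + 1) (by omega))
    calc ‖u i k‖ ≤ ‖η‖ / (C * lam ^ k) := by
          rw [hu, norm_div]
          exact div_le_div₀ (norm_nonneg _) (lp.norm_apply_le_norm top_ne_zero η _)
            (by positivity) hp
      _ = C⁻¹ * ‖η‖ * lam⁻¹ ^ k := by
          rw [inv_pow]
          field_simp
  have hgeom : HasSum (fun k => C⁻¹ * ‖η‖ * lam⁻¹ ^ k) (C⁻¹ * ‖η‖ * (1 - lam⁻¹)⁻¹) :=
    (hasSum_geometric_of_lt_one (by positivity) hinv).mul_left _
  have hsum : ∀ i, Summable (u i) := fun i => .of_norm_bounded hgeom.summable (hbound i)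
  have hle : ∀ i, ‖-∑' k, u i k‖ ≤ C⁻¹ * (1 - lam⁻¹)⁻¹ * ‖η‖ := fun i => by
    rw [norm_neg, mul_right_comm]
    exact tsum_of_norm_bounded hgeom (hbound i)
  have hmem : Memℓp (E := fun _ : ℕ => ℂ) (fun i => -∑' k, u i k) ∞ :=
    memℓp_infty ⟨_, by rintro _ ⟨i, rfl⟩; exact hle i⟩
  refine ⟨⟨_, hmem⟩, ?_, lp.norm_le_of_forall_le (by positivity) hle⟩
  ext i
  rw [weightedDiff_apply]
  change -∑' k, u (i + 1) k - a i * -∑' k, u i k = η i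
  have hne : a i ≠ 0 := by
    have := (mul_pos hC (pow_pos hlam0 1)).trans_le (h i 1 le_rfl)
    simpa using this
  have hzero : a i * u i 0 = η i := by
    simp only [hu, zero_add, Finset.prod_range_one, add_zero]
    field_simp
  have hsucc : ∀ k, a i * u i (k + 1) = u (i + 1) k := fun k => by
    simp only [hu]
    rw [Finset.prod_range_succ' _ (k + 1), add_zero, mul_comm _ (a i), ← mul_div_assoc,
      mul_div_mul_left _ _ hne]
    simp only [add_assoc, add_comm 1]
  rw [mul_neg, sub_neg_eq_add, (hsum i).tsum_eq_zero_add, mul_add, hzero, ← tsum_mul_left]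
  simp only [hsucc]
  ring

/-- A sequence whose tails are controlled by the preceding term decays geometrically. -/
theorem le_mul_pow_of_sum_Ico_le {b : ℕ → ℝ} {M : ℝ} (hM : 0 < M) {n : ℕ}
    (h : ∀ i ≤ n, ∑ j ∈ Finset.Ico i n, b (j + 1) ≤ M * b i) :
    b n ≤ (1 + M) * b 0 * (M / (1 + M)) ^ n := by
  have key : ∀ i ≤ n,
      b i + ∑ j ∈ Finset.Ico i n, b (j + 1) ≤ (1 + M) * b 0 * (M / (1 + M)) ^ i := by
    intro i
    induction i with
    | zero => intro hi; have := h 0 hi; rw [pow_zero]; linarith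
    | succ i ih =>
      intro hi
      have h1 := ih (by omega)
      have h2 := h i (by omega)
      rw [Finset.sum_eq_sum_Ico_succ_bot (by omega)] at h1 h2
      set s := b (i + 1) + ∑ j ∈ Finset.Ico (i + 1) n, b (j + 1)
      have h3 : s ≤ M / (1 + M) * (b i + s) := by
        rw [div_mul_eq_mul_div, le_div_iff₀ (by positivity)]
        linarith
      calc s ≤ M / (1 + M) * (b i + s) := h3
        _ ≤ M / (1 + M) * ((1 + M) * b 0 * (M / (1 + M)) ^ i) := by gcongr
        _ = _ := by ring
  simpa using key n le_rfl

theorem prod_range_ne_zero_of_continuousLinearEquiv {a : ℕ → ℂ}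
    {T : lp (fun _ : ℕ => ℂ) ∞ ≃L[ℂ] lp (fun _ : ℕ => ℂ) ∞}
    (hT : ∀ ξ : lp (fun _ : ℕ => ℂ) ∞, ∀ i : ℕ, T ξ i = ξ (i + 1) - a i * ξ i) (n : ℕ) :
    ∏ k ∈ Finset.range n, a k ≠ 0 := by
  intro h0
  set p : ℕ → ℂ := fun n => ∏ k ∈ Finset.range n, a k with hp
  have hzero : ∀ m, n ≤ m → p m = 0 := fun m hm =>
    zero_dvd_iff.mp (h0 ▸ Finset.prod_dvd_prod_of_subset _ _ a (Finset.range_mono hm))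
  have hmem : Memℓp (E := fun _ : ℕ => ℂ) p ∞ :=
    (memℓp_zero ((Set.finite_lt_nat n).subset fun i hi => by
      by_contra hlt
      exact hi (hzero i (not_lt.mp hlt)))).of_exponent_ge zero_le
  have hker : T ⟨p, hmem⟩ = 0 := by
    ext i
    rw [hT]
    change p (i + 1) - a i * p i = 0
    simp only [hp, Finset.prod_range_succ]
    ring
  have : p 0 = 0 := congrArg (fun ξ : lp (fun _ : ℕ => ℂ) ∞ => ξ 0)
    (T.map_eq_zero_iff.mp hker)
  simp [hp] at this

theorem le_norm_prod_range_of_norm_symm_le {a : ℕ → ℂ} {M : ℝ} (hM : 0 < M)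
    {T : lp (fun _ : ℕ => ℂ) ∞ ≃L[ℂ] lp (fun _ : ℕ => ℂ) ∞}
    (hT : ∀ ξ : lp (fun _ : ℕ => ℂ) ∞, ∀ i : ℕ, T ξ i = ξ (i + 1) - a i * ξ i)
    (hTM : ‖(T.symm : lp (fun _ : ℕ => ℂ) ∞ →L[ℂ] lp (fun _ : ℕ => ℂ) ∞)‖ ≤ M) (n : ℕ) :
    (1 + M)⁻¹ * ((1 + M) / M) ^ n ≤ ‖∏ k ∈ Finset.range n, a k‖ := by
  set p : ℕ → ℂ := fun n => ∏ k ∈ Finset.range n, a k with hp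
  have hne : ∀ m, p m ≠ 0 := prod_range_ne_zero_of_continuousLinearEquiv hT
  set x : ℕ → ℂ := fun i => p i * ((∑ j ∈ Finset.Ico i n, ‖p (j + 1)‖⁻¹ : ℝ) : ℂ) with hx
  have hmem : Memℓp (E := fun _ : ℕ => ℂ) x ∞ :=
    (memℓp_zero ((Set.finite_lt_nat n).subset fun i hi => by
      by_contra hlt
      have hle : n ≤ i := not_lt.mp hlt
      exact hi (by simp [hx, Finset.Ico_eq_empty_of_le hle]))).of_exponent_ge
        zero_le
  set ξ : lp (fun _ : ℕ => ℂ) ∞ := ⟨x, hmem⟩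
  have hTξ : ‖T ξ‖ ≤ 1 := by
    refine lp.norm_le_of_forall_le zero_le_one fun i => ?_
    rw [hT]
    change ‖x (i + 1) - a i * x i‖ ≤ 1
    have hps : p (i + 1) = p i * a i := Finset.prod_range_succ _ _
    rcases lt_or_ge i n with hi | hi
    · have : x (i + 1) - a i * x i = -(p (i + 1) * ((‖p (i + 1)‖⁻¹ : ℝ) : ℂ)) := by
        simp only [hx]
        rw [Finset.sum_eq_sum_Ico_succ_bot hi, Complex.ofReal_add, hps]
        ring
      rw [this, norm_neg, norm_mul, Complex.norm_real, norm_inv, norm_norm,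
        mul_inv_cancel₀ (norm_ne_zero_iff.mpr (hne _))]
    · simp [hx, Finset.Ico_eq_empty_of_le hi, Finset.Ico_eq_empty_of_le (hi.trans i.le_succ)]
  have hξ : ‖ξ‖ ≤ M := by
    have := (T.symm : lp (fun _ : ℕ => ℂ) ∞ →L[ℂ] lp (fun _ : ℕ => ℂ) ∞).le_of_opNorm_le_of_le
      hTM hTξ
    simpa using this
  have htail : ∀ i ≤ n, ∑ j ∈ Finset.Ico i n, ‖p (j + 1)‖⁻¹ ≤ M * ‖p i‖⁻¹ := fun i _ => by
    have h1 : ‖x i‖ ≤ M := (lp.norm_apply_le_norm top_ne_zero ξ i).trans hξ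
    rw [hx, norm_mul, Complex.norm_real, Real.norm_of_nonneg (by positivity), mul_comm] at h1
    rwa [← div_eq_mul_inv, le_div_iff₀ (norm_pos_iff.mpr (hne i))]
  have hfin := le_mul_pow_of_sum_Ico_le (b := fun i => ‖p i‖⁻¹) hM htail
  have hp0 : p 0 = 1 := Finset.prod_range_zero _
  simp only [hp0, norm_one, inv_one, mul_one] at hfin
  have hinv := inv_anti₀ (inv_pos.mpr (norm_pos_iff.mpr (hne n))) hfin
  rwa [inv_inv, mul_inv, ← inv_pow, inv_div] at hinv

/-- A compact invariant set `S` of a holomorphic map `f : ℂ → ℂ` is uniformly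
expanding iff for every forward orbit `x⁺ = (f^i(x₀))_{i≥0}` with `x₀ ∈ S`, the
bounded linear operator `DF(x⁺; f) : (ξ_i) ↦ (ξ_{i+1} − f'(x_i)ξ_i)` on
`l_∞(ℤ⁺, ℂ)` is invertible, with the norms of the inverses uniformly bounded. -/
theorem expanding_iff_DF_invertible (f : ℂ → ℂ) (hf : Differentiable ℂ f)
    (S : Set ℂ) (hS : IsCompact S) (hinvS : Invariant f S) :
    IsExpandingOn f S ↔
      ∃ M : ℝ, ∀ x0 ∈ S,
        ∃ T : (lp (fun _ : ℕ => ℂ) ∞) ≃L[ℂ] (lp (fun _ : ℕ => ℂ) ∞),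
          (∀ ξ : lp (fun _ : ℕ => ℂ) ∞, ∀ i : ℕ,
            T ξ i = ξ (i + 1) - deriv f (f^[i] x0) * ξ i) ∧
          ‖(T.symm : (lp (fun _ : ℕ => ℂ) ∞) →L[ℂ] (lp (fun _ : ℕ => ℂ) ∞))‖ ≤ M := by
  constructor
  · rintro ⟨C, hC, lam, hlam, hexp⟩
    have hmaps : MapsTo f S S := hinvS.ge
    obtain ⟨A, hA⟩ := hS.exists_bound_of_continuousOn
      (hf.contDiff.continuous_deriv le_rfl).continuousOn
    refine ⟨C⁻¹ * (1 - lam⁻¹)⁻¹, fun x0 hx0 => ?_⟩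
    have horb : ∀ i, f^[i] x0 ∈ S := fun i => hmaps.iterate i hx0
    set a : ℕ → ℂ := fun i => deriv f (f^[i] x0) with ha
    have hbd : ∀ i, ‖a i‖ ≤ A := fun i => hA _ (horb i)
    have hprod : ∀ i n, 1 ≤ n → C * lam ^ n ≤ ‖∏ k ∈ Finset.range n, a (i + k)‖ := by
      intro i n hn
      have := hexp _ (horb i) n hn
      rw [deriv_iterate_eq_prod hf] at this
      simpa only [ha, add_comm i, Function.iterate_add_apply] using this
    have hinj := weightedDiff_injective hbd hC hlam hprod
    have hsol := exists_weightedDiff_eq hbd hC hlam hprod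
    let e := LinearEquiv.ofBijective (weightedDiff a A hbd)
      ⟨hinj, fun η => (hsol η).imp fun _ => And.left⟩
    have hsymm : ∀ η, ‖e.symm η‖ ≤ C⁻¹ * (1 - lam⁻¹)⁻¹ * ‖η‖ := by
      intro η
      obtain ⟨ξ, rfl, hξ⟩ := hsol η
      have : e.symm (weightedDiff a A hbd ξ) = ξ := e.symm_apply_apply ξ
      rwa [this]
    refine ⟨e.toContinuousLinearEquivOfBounds _ _ (norm_weightedDiff_le a A hbd) hsymm,
      fun ξ i => rfl, ContinuousLinearMap.opNorm_le_bound _ ?_ hsymm⟩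
    have : 0 < 1 - lam⁻¹ := sub_pos.mpr (inv_lt_one_of_one_lt₀ hlam)
    positivity
  · rintro ⟨M, hM⟩
    have hpos : 0 < max M 1 := lt_max_of_lt_right one_pos
    refine ⟨(1 + max M 1)⁻¹, by positivity, (1 + max M 1) / max M 1, ?_, fun z hz n _ => ?_⟩
    · rw [gt_iff_lt, one_lt_div hpos]
      linarith
    · obtain ⟨T, hT, hTM⟩ := hM z hz
      rw [deriv_iterate_eq_prod hf]
      exact le_norm_prod_range_of_norm_symm_le hpos hT (hTM.trans (le_max_left _ _)) n
end
end

section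
/- Let k ≥ 2, let f : ℂ^k → ℂ^k be a diffeomorphism, and let S be a compact f-invariant set which is chain recurrent. Then S is uniformly hyperbolic if and only if S is quasi-hyperbolic, i.e. for every orbit (z_i)_{i∈ℤ} with z₀ ∈ S and z_i = f^i(z₀), the homogeneous recurrence ξ_{i+1} − Df(z_i)·ξ_i = 0 for all i ∈ ℤ has no nonzero bounded solution (ξ_i)_{i∈ℤ}. -/
noncomputable section
open Set Metric Topology Filter ENNReal

/-- A compact invariant set `S` is chain recurrent for `f`: every point of `S` can
be joined to itself by ε-chains in `S` for every `ε > 0`. -/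
def IsChainRecurrent {E : Type*} [NormedAddCommGroup E] (f : E → E) (S : Set E) : Prop :=
  ∀ z ∈ S, ∀ ε > (0 : ℝ), ∃ n : ℕ, 1 ≤ n ∧ ∃ w : ℕ → E,
    (∀ j ≤ n, w j ∈ S) ∧ w 0 = z ∧ w n = z ∧ ∀ j < n, ‖f (w j) - w (j + 1)‖ < ε

section General

variable {V : Type*} [NormedAddCommGroup V] [NormedSpace ℂ V]

/-- A complex differentiable map on a proper space has a continuous derivative. -/
theorem continuous_fderiv_of_differentiable {E F : Type*} [NormedAddCommGroup E]
    [NormedSpace ℂ E] [FiniteDimensional ℂ E] [NormedAddCommGroup F] [NormedSpace ℂ F]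
    {f : E → F} (hf : Differentiable ℂ f) : Continuous (fderiv ℂ f) := by
  have : ProperSpace E := FiniteDimensional.proper ℂ E
  refine continuous_clm_apply.2 fun v => Metric.continuous_iff.2 fun z₀ ε hε => ?_
  have huc : UniformContinuousOn f (closedBall z₀ (1 + ‖v‖)) :=
    (isCompact_closedBall _ _).uniformContinuousOn_of_continuous hf.continuous.continuousOn
  obtain ⟨δ, hδ, H⟩ := Metric.uniformContinuousOn_iff.1 huc (ε / 2) (half_pos hε)
  refine ⟨min δ 1, lt_min hδ one_pos, fun z hz => ?_⟩
  have hline : ∀ (y : E) (ζ : ℂ), HasDerivAt (fun ζ : ℂ => f (y + ζ • v))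
      (fderiv ℂ f (y + ζ • v) v) ζ := by
    intro y ζ
    have h1 : HasDerivAt (fun ζ : ℂ => y + ζ • v) v ζ := by
      simpa using ((hasDerivAt_id ζ).smul_const v).const_add y
    exact (hf (y + ζ • v)).hasFDerivAt.comp_hasDerivAt ζ h1
  have hd : ∀ ζ : ℂ, HasDerivAt (fun ζ : ℂ => f (z + ζ • v) - f (z₀ + ζ • v))
      (fderiv ℂ f (z + ζ • v) v - fderiv ℂ f (z₀ + ζ • v) v) ζ :=
    fun ζ => (hline z ζ).sub (hline z₀ ζ)
  have hdiff : Differentiable ℂ (fun ζ : ℂ => f (z + ζ • v) - f (z₀ + ζ • v)) :=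
    fun ζ => (hd ζ).differentiableAt
  have hbound := Complex.norm_deriv_le_of_forall_mem_sphere_norm_le (c := 0) (R := 1)
    (C := ε / 2) one_pos hdiff.diffContOnCl (fun ζ hζ => by
      have hζ1 : ‖ζ‖ = 1 := by simpa using hζ
      have hz1 : ‖z - z₀‖ < 1 := by
        rw [← dist_eq_norm]; exact hz.trans_le (min_le_right _ _)
      rw [← dist_eq_norm]
      refine (H _ ?_ _ ?_ ?_).le
      · rw [mem_closedBall, dist_eq_norm]
        calc ‖z + ζ • v - z₀‖ = ‖(z - z₀) + ζ • v‖ := by congr 1; abel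
          _ ≤ ‖z - z₀‖ + ‖ζ • v‖ := norm_add_le _ _
          _ ≤ 1 + ‖v‖ := by rw [norm_smul, hζ1]; linarith
      · rw [mem_closedBall, dist_eq_norm, add_sub_cancel_left, norm_smul, hζ1]; linarith
      · rw [dist_add_right]; exact hz.trans_le (min_le_left _ _))
  rw [(hd 0).deriv] at hbound
  simp only [zero_smul, add_zero, div_one] at hbound
  rw [dist_eq_norm]
  linarith

/-- The vectors with bounded orbit under a sequence of linear maps. -/
def boundedOrbits (L : ℕ → V →L[ℂ] V) : Submodule ℂ V where
  carrier := {v | ∃ M, ∀ n, ‖L n v‖ ≤ M}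
  zero_mem' := ⟨0, by simp⟩
  add_mem' := by
    rintro v w ⟨M, hM⟩ ⟨N, hN⟩
    refine ⟨M + N, fun n => ?_⟩
    rw [map_add]
    exact (norm_add_le _ _).trans (add_le_add (hM n) (hN n))
  smul_mem' := by
    rintro c v ⟨M, hM⟩
    refine ⟨‖c‖ * M, fun n => ?_⟩
    rw [map_smul, norm_smul]
    exact mul_le_mul_of_nonneg_left (hM n) (norm_nonneg _)

theorem mem_boundedOrbits {L : ℕ → V →L[ℂ] V} {v : V} :
    v ∈ boundedOrbits L ↔ ∃ M, ∀ n, ‖L n v‖ ≤ M := Iff.rfl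

/-- A nonnegative sequence with `a (n+1) ≤ r * a n + M`, `r < 1`, is bounded. -/
theorem exists_bound_of_affine_recurrence {a : ℕ → ℝ} {r M : ℝ} (hr0 : 0 ≤ r) (hr : r < 1)
    (h : ∀ n, a (n + 1) ≤ r * a n + M) : ∃ C, ∀ n, a n ≤ C := by
  refine ⟨max (a 0) (M / (1 - r)), fun n => ?_⟩
  induction n with
  | zero => exact le_max_left _ _
  | succ n ih =>
    have h1 : M ≤ (1 - r) * max (a 0) (M / (1 - r)) := by
      have := le_max_right (a 0) (M / (1 - r))
      rwa [div_le_iff₀' (by linarith)] at this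
    nlinarith [h n, mul_le_mul_of_nonneg_left ih hr0]

/-- If an automorphism of a finite-dimensional space has no nonzero bounded orbit, then every
vector is the sum of a forward bounded and a backward bounded one. -/
theorem boundedOrbits_pow_sup_eq_top [FiniteDimensional ℂ V] (B : V ≃L[ℂ] V)
    (h : ∀ v, v ∈ boundedOrbits (fun n => ((B ^ n : V ≃L[ℂ] V) : V →L[ℂ] V)) →
      v ∈ boundedOrbits (fun n => ((B⁻¹ ^ n : V ≃L[ℂ] V) : V →L[ℂ] V)) → v = 0) :
    boundedOrbits (fun n => ((B ^ n : V ≃L[ℂ] V) : V →L[ℂ] V)) ⊔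
      boundedOrbits (fun n => ((B⁻¹ ^ n : V ≃L[ℂ] V) : V →L[ℂ] V)) = ⊤ := by
  set Bl : Module.End ℂ V := (B : V →L[ℂ] V).toLinearMap with hBl
  have hBlv : ∀ v, Bl v = B v := fun v => rfl
  have hpow : ∀ n v, (B ^ (n + 1)) v = (B ^ n) (B v) := fun n v => by rw [pow_succ]; rfl
  have hpow' : ∀ n v, (B⁻¹ ^ (n + 1)) (B v) = (B⁻¹ ^ n) v := fun n v => by
    have : B⁻¹ ^ (n + 1) * B = B⁻¹ ^ n := by rw [pow_succ]; group
    rw [← this]; rfl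
  rw [eq_top_iff, ← Module.End.iSup_maxGenEigenspace_eq_top Bl]
  refine iSup_le fun μ v hv => ?_
  obtain ⟨m, hm⟩ := (Module.End.mem_maxGenEigenspace Bl μ v).1 hv
  clear hv
  have hB : ∀ v : V, B v = μ • v + (Bl - μ • (1 : Module.End ℂ V)) v := fun v => by
    simp [hBlv]
  rcases lt_trichotomy ‖μ‖ 1 with hμ | hμ | hμ
  · refine Submodule.mem_sup_left ?_
    induction m generalizing v with
    | zero => rw [pow_zero, Module.End.one_apply] at hm; rw [hm]; exact zero_mem _
    | succ m ih =>
      obtain ⟨M, hM⟩ := ih ((Bl - μ • (1 : Module.End ℂ V)) v) (by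
        rwa [pow_succ] at hm)
      refine exists_bound_of_affine_recurrence (norm_nonneg μ) hμ (M := M) fun n => ?_
      have : (B ^ (n + 1)) v = μ • (B ^ n) v + (B ^ n) ((Bl - μ • (1 : Module.End ℂ V)) v) := by
        rw [hpow, hB v, map_add, map_smul]
      change ‖(B ^ (n + 1)) v‖ ≤ _
      rw [this]
      refine (norm_add_le _ _).trans ?_
      rw [norm_smul]
      exact add_le_add le_rfl (hM n)
  · suffices v = 0 by rw [this]; exact zero_mem _
    induction m generalizing v with
    | zero => rwa [pow_zero, Module.End.one_apply] at hm
    | succ m ih =>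
      have h0 := ih ((Bl - μ • (1 : Module.End ℂ V)) v) (by rwa [pow_succ] at hm)
      have hBv : B v = μ • v := by rw [hB v, h0, add_zero]
      refine h v ⟨‖v‖, fun n => ?_⟩ ⟨‖v‖, fun n => ?_⟩
      · refine le_of_eq ?_
        change ‖(B ^ n) v‖ = _
        induction n with
        | zero => rfl
        | succ n ihn => rw [hpow, hBv, map_smul, norm_smul, hμ, one_mul, ihn]
      · refine le_of_eq ?_
        change ‖(B⁻¹ ^ n) v‖ = _
        induction n with
        | zero => rfl
        | succ n ihn => rw [← ihn, ← hpow' n v, hBv, map_smul, norm_smul, hμ, one_mul]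
  · refine Submodule.mem_sup_right ?_
    have hμ0 : 0 < ‖μ‖ := one_pos.trans hμ
    induction m generalizing v with
    | zero => rw [pow_zero, Module.End.one_apply] at hm; rw [hm]; exact zero_mem _
    | succ m ih =>
      obtain ⟨M, hM⟩ := ih ((Bl - μ • (1 : Module.End ℂ V)) v) (by
        rwa [pow_succ] at hm)
      refine exists_bound_of_affine_recurrence (r := ‖μ‖⁻¹) (inv_nonneg.2 hμ0.le)
        (inv_lt_one_of_one_lt₀ hμ) (M := ‖μ‖⁻¹ * M) fun n => ?_
      have h1 : (B⁻¹ ^ n) v = μ • (B⁻¹ ^ (n + 1)) v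
          + (B⁻¹ ^ (n + 1)) ((Bl - μ • (1 : Module.End ℂ V)) v) := by
        rw [← hpow', hB v, map_add, map_smul]
      have h2 : μ • (B⁻¹ ^ (n + 1)) v = (B⁻¹ ^ n) v
          - (B⁻¹ ^ (n + 1)) ((Bl - μ • (1 : Module.End ℂ V)) v) := by
        rw [h1, add_sub_cancel_right]
      have h3 : ‖μ‖ * ‖(B⁻¹ ^ (n + 1)) v‖ ≤ ‖(B⁻¹ ^ n) v‖ + M := by
        rw [← norm_smul, h2]
        exact (norm_sub_le _ _).trans (add_le_add le_rfl (hM (n + 1)))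
      change ‖(B⁻¹ ^ (n + 1)) v‖ ≤ ‖μ‖⁻¹ * ‖(B⁻¹ ^ n) v‖ + ‖μ‖⁻¹ * M
      rw [← mul_add, ← div_eq_inv_mul, le_div_iff₀' hμ0]
      exact h3

/-- Solvability of a first order recurrence over `ℤ` in a group. -/
theorem exists_int_recurrence {G : Type*} [Group G] (A : ℤ → G) :
    ∃ Φ : ℤ → G, Φ 0 = 1 ∧ ∀ i, Φ (i + 1) = A i * Φ i := by
  let pos : ℕ → G := fun n => Nat.rec 1 (fun k g => A k * g) n
  let neg : ℕ → G := fun n => Nat.rec 1 (fun k g => (A (-(k + 1 : ℤ)))⁻¹ * g) n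
  refine ⟨fun i => if 0 ≤ i then pos i.toNat else neg (-i).toNat, rfl, fun i => ?_⟩
  rcases le_or_gt 0 i with hi | hi
  · lift i to ℕ using hi
    have : (0 : ℤ) ≤ i + 1 := by positivity
    have h2 : ((i : ℤ) + 1).toNat = i + 1 := by omega
    simp only [this, h2, if_true, Int.toNat_natCast, Int.natCast_nonneg]
    rfl
  · obtain ⟨n, rfl⟩ : ∃ n : ℕ, i = -(n + 1 : ℤ) := ⟨(-i - 1).toNat, by omega⟩
    have h1 : ¬ (0 : ℤ) ≤ -(n + 1 : ℤ) := by omega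
    have h2 : (- -(n + 1 : ℤ)).toNat = n + 1 := by omega
    have h3 : -(n + 1 : ℤ) + 1 = -n := by ring
    have h4 : neg (n + 1) = (A (-(n + 1 : ℤ)))⁻¹ * neg n := rfl
    simp only [h1, h2, h3, if_false, h4, mul_inv_cancel_left]
    rcases Nat.eq_zero_or_pos n with rfl | hn
    · rfl
    · have h5 : ¬ (0 : ℤ) ≤ -(n : ℤ) := by omega
      simp
      omega

/-- A periodic linear recurrence without nonzero bounded solutions splits into forward bounded
and backward bounded solutions. -/
theorem exists_splitting_of_periodic [FiniteDimensional ℂ V] (A : ℤ → V ≃L[ℂ] V) {n : ℕ}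
    (hn : 1 ≤ n) (hper : ∀ i, A (i + n) = A i)
    (h : ∀ x : ℤ → V, (∀ i, x (i + 1) = A i (x i)) → (∃ M, ∀ i, ‖x i‖ ≤ M) → x 0 = 0) (v : V) :
    ∃ s u : ℤ → V, (∀ i, s (i + 1) = A i (s i)) ∧ (∀ i, u (i + 1) = A i (u i)) ∧
      s 0 + u 0 = v ∧ (∃ M, ∀ i : ℕ, ‖s i‖ ≤ M) ∧ (∃ M, ∀ i : ℕ, ‖u (-i)‖ ≤ M) := by
  obtain ⟨Φ, hΦ0, hΦ⟩ := exists_int_recurrence A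
  have hΦn : ∀ i, Φ (i + n) = Φ i * Φ n := by
    intro i
    induction i using Int.induction_on with
    | zero => simp [hΦ0]
    | succ i ih =>
      have : (i : ℤ) + 1 + n = (i + n) + 1 := by ring
      rw [this, hΦ, hper, ih, hΦ, mul_assoc]
    | pred i ih =>
      have h1 := hΦ (-(i : ℤ) - 1)
      have h2 := hΦ (-(i : ℤ) - 1 + n)
      rw [sub_add_cancel] at h1
      have h3 : -(i : ℤ) - 1 + n + 1 = -i + n := by ring
      rw [h3, ih, hper, h1, mul_assoc] at h2
      exact (mul_left_cancel h2).symm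
  set B := Φ n with hB
  have hΦq : ∀ (q : ℕ) i, Φ (i + q * n) = Φ i * B ^ q := by
    intro q
    induction q with
    | zero => simp
    | succ q ih =>
      intro i
      have : i + ((q + 1 : ℕ) : ℤ) * n = (i + q * n) + n := by push_cast; ring
      rw [this, hΦn, ih, pow_succ, mul_assoc]
  have hΦq' : ∀ (q : ℕ) i, Φ (i - q * n) = Φ i * B⁻¹ ^ q := by
    intro q i
    have := hΦq q (i - q * n)
    rw [sub_add_cancel] at this
    rw [this, inv_pow, mul_inv_cancel_right]
  set R := ∑ r ∈ Finset.range n, ‖(Φ r : V →L[ℂ] V)‖ with hR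
  have hle : ∀ (r : ℕ), r < n → ∀ (y : V) (M : ℝ), ‖y‖ ≤ M → ‖Φ r y‖ ≤ R * M := by
    intro r hr y M hy
    have h1 : ‖(Φ r : V →L[ℂ] V)‖ ≤ R :=
      Finset.single_le_sum (f := fun r : ℕ => ‖(Φ r : V →L[ℂ] V)‖)
        (fun _ _ => norm_nonneg _) (Finset.mem_range.2 hr)
    exact ((Φ r : V →L[ℂ] V).le_opNorm y).trans
      (mul_le_mul h1 hy (norm_nonneg _) ((norm_nonneg _).trans h1))
  have hfwd : ∀ v, v ∈ boundedOrbits (fun n => ((B ^ n : V ≃L[ℂ] V) : V →L[ℂ] V)) →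
      ∃ M, ∀ i : ℕ, ‖Φ i v‖ ≤ M := by
    rintro v ⟨M, hM⟩
    refine ⟨R * M, fun i => ?_⟩
    have h1 : (i : ℤ) = (i % n : ℕ) + (i / n : ℕ) * n := by
      have := Nat.mod_add_div' i n
      exact_mod_cast this.symm
    rw [h1, hΦq]
    exact hle _ (Nat.mod_lt _ hn) _ M (hM _)
  have hbwd : ∀ v, v ∈ boundedOrbits (fun n => ((B⁻¹ ^ n : V ≃L[ℂ] V) : V →L[ℂ] V)) →
      ∃ M, ∀ i : ℕ, ‖Φ (-i) v‖ ≤ M := by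
    rintro v ⟨M, hM⟩
    refine ⟨R * M, fun i => ?_⟩
    have hn' : (0 : ℤ) < n := by exact_mod_cast hn
    obtain ⟨r, hr⟩ := Int.eq_ofNat_of_zero_le (Int.emod_nonneg (-(i : ℤ)) hn'.ne')
    have hr' : r < n := by
      have := Int.emod_lt_of_pos (-(i : ℤ)) hn'
      omega
    have hd : -(i : ℤ) / n ≤ 0 := Int.ediv_nonpos_of_nonpos_of_neg (by omega) hn'
    obtain ⟨q, hq⟩ := Int.eq_ofNat_of_zero_le (neg_nonneg.2 hd)
    have h1 : -(i : ℤ) = r - q * n := by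
      have := Int.emod_add_mul_ediv (-(i : ℤ)) n
      rw [← hr, ← hq]
      linarith
    rw [h1, hΦq']
    exact hle _ hr' _ M (hM _)
  have hsol : ∀ v i, Φ (i + 1) v = A i (Φ i v) := fun v i => by rw [hΦ]; rfl
  have hΦ0v : ∀ v, Φ 0 v = v := fun v => by rw [hΦ0]; rfl
  have htop := boundedOrbits_pow_sup_eq_top B fun v h1 h2 => by
    obtain ⟨M, hM⟩ := hfwd v h1
    obtain ⟨N, hN⟩ := hbwd v h2
    rw [← hΦ0v v]
    refine h (fun i => Φ i v) (hsol v) ⟨max M N, fun i => ?_⟩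
    obtain ⟨j, rfl | rfl⟩ := Int.eq_nat_or_neg i
    · exact (hM j).trans (le_max_left _ _)
    · exact (hN j).trans (le_max_right _ _)
  obtain ⟨s, hs, u, hu, rfl⟩ := Submodule.mem_sup.1 (htop ▸ Submodule.mem_top (x := v))
  exact ⟨fun i => Φ i s, fun i => Φ i u, hsol s, hsol u, by simp only [hΦ0v], hfwd s hs,
    hbwd u hu⟩

/-- A bounded sequence that near each late index reaches twice its value decays geometrically. -/
theorem exists_geometric_decay {K : ℝ} (hK : 1 ≤ K) {N : ℕ} (hN : 1 ≤ N) :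
    ∃ C l : ℝ, 0 < C ∧ 0 < l ∧ l < 1 ∧ ∀ a : ℕ → ℝ, (∀ n, 0 ≤ a n) →
      (∀ n, a (n + 1) ≤ K * a n) → (∃ M, ∀ n, a n ≤ M) →
      (∀ n, N ≤ n → ∃ i, n ≤ i + N ∧ 2 * a n ≤ a i) → ∀ n, a n ≤ C * l ^ n * a 0 := by
  have hK0 : 0 < K := one_pos.trans_le hK
  set l : ℝ := (1 / 2 : ℝ) ^ (1 / (N : ℝ)) with hl
  have hN0 : (0 : ℝ) < N := by exact_mod_cast hN
  have hl0 : 0 < l := Real.rpow_pos_of_pos (by norm_num) _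
  have hl1 : l < 1 := Real.rpow_lt_one (by norm_num) (by norm_num) (by positivity)
  have hlN : l ^ N = 1 / 2 := by
    rw [hl, ← Real.rpow_natCast, ← Real.rpow_mul (by norm_num), one_div_mul_cancel hN0.ne',
      Real.rpow_one]
  refine ⟨2 * K ^ N, l, by positivity, hl0, hl1, fun a ha hgrow ⟨M, hM⟩ h n => ?_⟩
  have hpow : ∀ n, a n ≤ K ^ n * a 0 := by
    intro n
    induction n with
    | zero => simp
    | succ n ih =>
      calc a (n + 1) ≤ K * a n := hgrow n
        _ ≤ K * (K ^ n * a 0) := mul_le_mul_of_nonneg_left ih hK0.le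
        _ = K ^ (n + 1) * a 0 := by ring
  have hbdd : BddAbove (range a) := ⟨M, by rintro _ ⟨n, rfl⟩; exact hM n⟩
  have hM0 : ∀ n, a n ≤ K ^ N * a 0 := by
    have h0 : 0 ≤ ⨆ n, a n := (ha 0).trans (le_ciSup hbdd 0)
    have hsup : ⨆ n, a n ≤ max (K ^ N * a 0) ((⨆ n, a n) / 2) := by
      refine ciSup_le fun n => ?_
      rcases lt_or_ge n N with hn | hn
      · refine le_max_of_le_left ((hpow n).trans ?_)
        exact mul_le_mul_of_nonneg_right (pow_le_pow_right₀ hK hn.le) (ha 0)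
      · obtain ⟨i, -, hi⟩ := h n hn
        refine le_max_of_le_right ?_
        linarith [le_ciSup hbdd i]
    have h3 : 0 ≤ K ^ N * a 0 := mul_nonneg (by positivity) (ha 0)
    intro n
    refine (le_ciSup hbdd n).trans ?_
    rcases le_max_iff.1 hsup with h4 | h4 <;> linarith
  have hdec : ∀ j n, j * N ≤ n → a n ≤ (1 / 2) ^ j * (K ^ N * a 0) := by
    intro j
    induction j with
    | zero => intro n _; simpa using hM0 n
    | succ j ih =>
      intro n hn
      have hn' : j * N + N ≤ n := by linarith
      obtain ⟨i, hi, h2⟩ := h n (by omega)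
      have := ih i (by omega)
      rw [pow_succ]
      linarith
  have h1 := hdec (n / N) n (Nat.div_mul_le_self n N)
  have h2 : (1 / 2 : ℝ) ^ (n / N) ≤ 2 * l ^ n := by
    have h3 : l ^ n = (1 / 2) ^ (n / N) * l ^ (n % N) := by
      rw [← hlN, ← pow_mul, ← pow_add, Nat.div_add_mod]
    have h4 : l ^ N ≤ l ^ (n % N) :=
      pow_le_pow_of_le_one hl0.le hl1.le (Nat.mod_lt _ hN).le
    rw [hlN] at h4
    rw [h3]
    nlinarith [show (0 : ℝ) < (1 / 2) ^ (n / N) by positivity]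
  calc a n ≤ (1 / 2) ^ (n / N) * (K ^ N * a 0) := h1
    _ ≤ 2 * l ^ n * (K ^ N * a 0) :=
      mul_le_mul_of_nonneg_right h2 (mul_nonneg (by positivity) (ha 0))
    _ = 2 * K ^ N * l ^ n * a 0 := by ring

end General

/-- A bounded function into a proper space converges along every ultrafilter. -/
theorem exists_tendsto_ultrafilter_of_norm_le {V ι : Type*}
    [NormedAddCommGroup V] [ProperSpace V] (g : Ultrafilter ι)
    {x : ι → V} {b : ℝ} (hb : ∀ m, ‖x m‖ ≤ b) : ∃ y, Tendsto x g (𝓝 y) := by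
  obtain ⟨y, -, hy⟩ := (isCompact_closedBall (0 : V) b).ultrafilter_le_nhds (g.map x) (by
    rw [le_principal_iff]
    exact Filter.mem_map.2 (univ_mem' fun m => by simpa using hb m))
  exact ⟨y, hy⟩

theorem tendsto_hyperfilter_zero_of_le_one_div {a : ℕ → ℝ} (h0 : ∀ m, 0 ≤ a m)
    (h : ∀ m, a m ≤ 1 / ((m : ℝ) + 1)) : Tendsto a (hyperfilter ℕ) (𝓝 0) :=
  (squeeze_zero h0 h tendsto_one_div_add_atTop_nhds_zero_nat).mono_left Nat.hyperfilter_le_atTop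

theorem orbit_unique {X : Type*} {T : X → X} (hT : Function.Injective T) {w w' : ℤ → X}
    (hw : ∀ i, T (w i) = w (i + 1)) (hw' : ∀ i, T (w' i) = w' (i + 1)) (h : w 0 = w' 0) : w = w' := by
  funext i
  induction i using Int.induction_on with
  | zero => exact h
  | succ i ih => rw [← hw, ← hw', ih]
  | pred i ih => exact hT (by rw [hw, hw', sub_add_cancel, ih])

section Cocycle

variable {X V : Type*} [NormedAddCommGroup V] [NormedSpace ℂ V]

/-- `x` solves the linear recurrence given by the cocycle `A` along the sequence `w`. -/
def IsSolution (A : X → V ≃L[ℂ] V) (w : ℤ → X) (x : ℤ → V) : Prop :=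
  ∀ i, x (i + 1) = A (w i) (x i)

namespace IsSolution

variable {A : X → V ≃L[ℂ] V} {w : ℤ → X} {x y : ℤ → V} {K : ℝ}

theorem add (hx : IsSolution A w x) (hy : IsSolution A w y) :
    IsSolution A w (fun i => x i + y i) := fun i => by
  simp only [hx i, hy i, map_add]

theorem sub (hx : IsSolution A w x) (hy : IsSolution A w y) :
    IsSolution A w (fun i => x i - y i) := fun i => by
  simp only [hx i, hy i, map_sub]

theorem smul (hx : IsSolution A w x) (c : ℂ) : IsSolution A w (fun i => c • x i) := fun i => by
  simp only [hx i, map_smul]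

theorem shift (hx : IsSolution A w x) (j : ℤ) :
    IsSolution A (fun i => w (i + j)) (fun i => x (i + j)) := fun i => by
  have : i + 1 + j = i + j + 1 := by ring
  simp only [this, hx (i + j)]

theorem norm_succ_le (hx : IsSolution A w x) (hK : ∀ z, ‖(A z : V →L[ℂ] V)‖ ≤ K) (i : ℤ) :
    ‖x (i + 1)‖ ≤ K * ‖x i‖ := by
  rw [hx i]
  exact (A (w i) : V →L[ℂ] V).le_of_opNorm_le (hK _) _

theorem norm_le_succ (hx : IsSolution A w x) (hK' : ∀ z, ‖((A z).symm : V →L[ℂ] V)‖ ≤ K)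
    (i : ℤ) : ‖x i‖ ≤ K * ‖x (i + 1)‖ := by
  have : x i = (A (w i)).symm (x (i + 1)) := by rw [hx i, ContinuousLinearEquiv.symm_apply_apply]
  rw [this]
  exact ((A (w i)).symm : V →L[ℂ] V).le_of_opNorm_le (hK' _) _

theorem norm_le_pow (hx : IsSolution A w x) (hK0 : 0 ≤ K) (hK : ∀ z, ‖(A z : V →L[ℂ] V)‖ ≤ K)
    (hK' : ∀ z, ‖((A z).symm : V →L[ℂ] V)‖ ≤ K) (i : ℤ) : ‖x i‖ ≤ K ^ i.natAbs * ‖x 0‖ := by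
  induction i using Int.induction_on with
  | zero => simp
  | succ i ih =>
    have h1 : ((i : ℤ) + 1).natAbs = (i : ℤ).natAbs + 1 := by omega
    rw [h1, pow_succ', mul_assoc]
    exact (hx.norm_succ_le hK i).trans (mul_le_mul_of_nonneg_left ih hK0)
  | pred i ih =>
    have h1 : (-(i : ℤ) - 1).natAbs = (-(i : ℤ)).natAbs + 1 := by omega
    have h2 := hx.norm_le_succ hK' (-(i : ℤ) - 1)
    rw [sub_add_cancel] at h2
    rw [h1, pow_succ', mul_assoc]
    exact h2.trans (mul_le_mul_of_nonneg_left ih hK0)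

end IsSolution

theorem exists_isSolution (A : X → V ≃L[ℂ] V) (w : ℤ → X) (v : V) :
    ∃ x, IsSolution A w x ∧ x 0 = v := by
  obtain ⟨Φ, h0, h⟩ := exists_int_recurrence (fun i => A (w i))
  exact ⟨fun i => Φ i v, fun i => by simp only [h i]; rfl, by simp only [h0]; rfl⟩

variable {T : X → X} {A : X → V ≃L[ℂ] V} {K : ℝ}

/-- Quasi-hyperbolicity of a cocycle: bounded solutions along orbits vanish. -/
def QuasiHyperbolic (T : X → X) (A : X → V ≃L[ℂ] V) : Prop :=
  ∀ w : ℤ → X, (∀ i, T (w i) = w (i + 1)) → ∀ x, IsSolution A w x →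
    (∃ M, ∀ i, ‖x i‖ ≤ M) → x 0 = 0

theorem QuasiHyperbolic.eq_zero_of_add_eq_zero (hQ : QuasiHyperbolic T A) (hK0 : 0 ≤ K)
    (hK : ∀ z, ‖(A z : V →L[ℂ] V)‖ ≤ K) (hK' : ∀ z, ‖((A z).symm : V →L[ℂ] V)‖ ≤ K)
    {w : ℤ → X} (hw : ∀ i, T (w i) = w (i + 1)) {s u : ℤ → V} (hs : IsSolution A w s)
    (hu : IsSolution A w u) (hsb : ∃ M, ∀ n : ℕ, ‖s n‖ ≤ M) (hub : ∃ M, ∀ n : ℕ, ‖u (-n)‖ ≤ M)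
    (h : s 0 + u 0 = 0) : s 0 = 0 := by
  obtain ⟨M, hM⟩ := hsb
  obtain ⟨N, hN⟩ := hub
  refine hQ w hw s hs ⟨max M N, fun i => ?_⟩
  obtain ⟨j, rfl | rfl⟩ := Int.eq_nat_or_neg i
  · exact (hM j).trans (le_max_left _ _)
  · have h1 := (hs.add hu).norm_le_pow hK0 hK hK' (-(j : ℤ))
    simp only [h, norm_zero, mul_zero] at h1
    have h2 : s (-j) = -u (-j) := eq_neg_of_add_eq_zero_left (norm_le_zero_iff.1 h1)
    rw [h2, norm_neg]
    exact (hN j).trans (le_max_right _ _)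

variable [MetricSpace X]

theorem exists_orbit_tendsto [CompactSpace X] (hT : Continuous T) {ι : Type*}
    (g : Ultrafilter ι) {w : ι → ℤ → X}
    (hw : ∀ i, Tendsto (fun m => dist (T (w m i)) (w m (i + 1))) g (𝓝 0)) :
    ∃ w' : ℤ → X, (∀ i, Tendsto (fun m => w m i) g (𝓝 (w' i))) ∧ ∀ i, T (w' i) = w' (i + 1) := by
  have h : ∀ i, ∃ y, Tendsto (fun m => w m i) g (𝓝 y) := fun i => by
    obtain ⟨y, -, hy⟩ := (isCompact_univ (X := X)).ultrafilter_le_nhds (g.map fun m => w m i)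
      (by simp)
    exact ⟨y, hy⟩
  choose w' hw' using h
  refine ⟨w', hw', fun i => ?_⟩
  have h1 : Tendsto (fun m => dist (T (w m i)) (w m (i + 1))) g
      (𝓝 (dist (T (w' i)) (w' (i + 1)))) :=
    ((hT.tendsto _).comp (hw' i)).dist (hw' (i + 1))
  exact dist_eq_zero.1 (tendsto_nhds_unique h1 (hw i))

theorem exists_isSolution_tendsto [ProperSpace V]
    (hA : Continuous fun z => (A z : V →L[ℂ] V)) (hK0 : 0 ≤ K)
    (hK : ∀ z, ‖(A z : V →L[ℂ] V)‖ ≤ K) (hK' : ∀ z, ‖((A z).symm : V →L[ℂ] V)‖ ≤ K)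
    {ι : Type*} (g : Ultrafilter ι) {w : ι → ℤ → X} {w' : ℤ → X}
    (hw : ∀ i, Tendsto (fun m => w m i) g (𝓝 (w' i))) {x : ι → ℤ → V}
    (hx : ∀ m, IsSolution A (w m) (x m)) {b : ℝ} (hb : ∀ m, ‖x m 0‖ ≤ b) :
    ∃ x' : ℤ → V, (∀ i, Tendsto (fun m => x m i) g (𝓝 (x' i))) ∧ IsSolution A w' x' := by
  have h : ∀ i, ∃ y, Tendsto (fun m => x m i) g (𝓝 y) := fun i =>
    exists_tendsto_ultrafilter_of_norm_le g (b := K ^ i.natAbs * b) fun m =>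
      ((hx m).norm_le_pow hK0 hK hK' i).trans
        (mul_le_mul_of_nonneg_left (hb m) (pow_nonneg hK0 _))
  choose x' hx' using h
  refine ⟨x', hx', fun i => ?_⟩
  have h1 : Tendsto (fun m => (A (w m i) : V →L[ℂ] V) (x m i)) g (𝓝 (A (w' i) (x' i))) :=
    ((isBoundedBilinearMap_apply (𝕜 := ℂ) (E := V) (F := V)).continuous.tendsto (_, _)).comp
      (((hA.tendsto (w' i)).comp (hw i)).prodMk_nhds (hx' i))
  refine tendsto_nhds_unique (hx' (i + 1)) (h1.congr fun m => ?_)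
  exact (hx m i).symm

/-- Limits of splittings along pseudo-orbits with vanishing error are splittings along orbits. -/
theorem exists_splitting_tendsto [CompactSpace X] [ProperSpace V] (hT : Continuous T)
    (hA : Continuous fun z => (A z : V →L[ℂ] V)) (hK0 : 0 ≤ K)
    (hK : ∀ z, ‖(A z : V →L[ℂ] V)‖ ≤ K) (hK' : ∀ z, ‖((A z).symm : V →L[ℂ] V)‖ ≤ K)
    {ι : Type*} (g : Ultrafilter ι) {w : ι → ℤ → X}
    (hw : ∀ i, Tendsto (fun m => dist (T (w m i)) (w m (i + 1))) g (𝓝 0))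
    {s u : ι → ℤ → V} (hs : ∀ m, IsSolution A (w m) (s m)) (hu : ∀ m, IsSolution A (w m) (u m))
    {b : ℝ} (hsb : ∀ m, ∀ n : ℕ, ‖s m n‖ ≤ b) (hub : ∀ m, ∀ n : ℕ, ‖u m (-n)‖ ≤ b) {v : V}
    (hv : Tendsto (fun m => s m 0 + u m 0) g (𝓝 v)) :
    ∃ (w' : ℤ → X) (s' u' : ℤ → V), (∀ i, Tendsto (fun m => w m i) g (𝓝 (w' i))) ∧
      (∀ i, T (w' i) = w' (i + 1)) ∧ IsSolution A w' s' ∧ IsSolution A w' u' ∧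
      (∀ n : ℕ, ‖s' n‖ ≤ b) ∧ (∀ n : ℕ, ‖u' (-n)‖ ≤ b) ∧ s' 0 + u' 0 = v ∧
      Tendsto (fun m => s m 0) g (𝓝 (s' 0)) := by
  obtain ⟨w', hw', hT'⟩ := exists_orbit_tendsto hT g hw
  obtain ⟨s', hs', hss⟩ := exists_isSolution_tendsto hA hK0 hK hK' g hw' hs
    fun m => by simpa using hsb m 0
  obtain ⟨u', hu', huu⟩ := exists_isSolution_tendsto hA hK0 hK hK' g hw' hu
    fun m => by simpa using hub m 0
  exact ⟨w', s', u', hw', hT', hss, huu,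
    fun n => le_of_tendsto (hs' n).norm (Eventually.of_forall fun m => hsb m n),
    fun n => le_of_tendsto (hu' (-n)).norm (Eventually.of_forall fun m => hub m n),
    tendsto_nhds_unique ((hs' 0).add (hu' 0)) hv, hs' 0⟩

/-- Along pseudo-orbits, every solution doubles within a uniform time. -/
theorem QuasiHyperbolic.exists_uniform_doubling [CompactSpace X] [ProperSpace V]
    (hQ : QuasiHyperbolic T A) (hT : Continuous T)
    (hA : Continuous fun z => (A z : V →L[ℂ] V)) (hK0 : 0 ≤ K)
    (hK : ∀ z, ‖(A z : V →L[ℂ] V)‖ ≤ K) (hK' : ∀ z, ‖((A z).symm : V →L[ℂ] V)‖ ≤ K) :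
    ∃ ε : ℝ, 0 < ε ∧ ∃ N : ℕ, 1 ≤ N ∧ ∀ w : ℤ → X, (∀ i, dist (T (w i)) (w (i + 1)) ≤ ε) →
      ∀ x, IsSolution A w x → ∀ j, ∃ i, |i - j| ≤ (N : ℤ) ∧ 2 * ‖x j‖ ≤ ‖x i‖ := by
  suffices h : ∃ m : ℕ, ∀ w : ℤ → X, (∀ i, dist (T (w i)) (w (i + 1)) ≤ 1 / ((m : ℝ) + 1)) →
      ∀ x, IsSolution A w x → ‖x 0‖ = 1 → ∃ i, |i| ≤ (m : ℤ) + 1 ∧ 2 ≤ ‖x i‖ by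
    obtain ⟨m, hm⟩ := h
    refine ⟨1 / ((m : ℝ) + 1), by positivity, m + 1, by omega, fun w hw x hx j => ?_⟩
    by_cases h0 : x j = 0
    · exact ⟨j, by simp; positivity, by simp [h0]⟩
    have h0' : 0 < ‖x j‖ := norm_pos_iff.2 h0
    obtain ⟨i, hi, h2⟩ := hm (fun i => w (i + j)) (fun i => by
        have := hw (i + j)
        rwa [add_right_comm] at this) _
      ((hx.shift j).smul ((‖x j‖⁻¹ : ℝ) : ℂ)) (by
        simp [norm_smul, h0'.ne'])
    refine ⟨i + j, by simpa using hi, ?_⟩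
    rw [norm_smul, Complex.norm_real, norm_inv, norm_norm, ← div_eq_inv_mul,
      le_div_iff₀ h0'] at h2
    exact h2
  by_contra! hcon
  choose w hw x hx hx0 hlt using hcon
  obtain ⟨w', hw', hT'⟩ := exists_orbit_tendsto hT (hyperfilter ℕ) (w := w) fun i =>
    tendsto_hyperfilter_zero_of_le_one_div (fun m => dist_nonneg) fun m => hw m i
  obtain ⟨x', hx', hsol⟩ := exists_isSolution_tendsto hA hK0 hK hK' (hyperfilter ℕ) hw' hx
    (b := 1) fun m => (hx0 m).le
  have h1 : ‖x' 0‖ = 1 :=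
    tendsto_nhds_unique (hx' 0).norm (by simp only [hx0]; exact tendsto_const_nhds)
  have h2 : x' 0 = 0 := by
    refine hQ w' hT' x' hsol ⟨2, fun i => ?_⟩
    refine le_of_tendsto (hx' i).norm ?_
    refine Nat.hyperfilter_le_atTop (Filter.mem_of_superset (Ici_mem_atTop i.natAbs) fun m hm => ?_)
    refine (hlt m i ?_).le
    have : i.natAbs ≤ m := hm
    rw [Int.abs_eq_natAbs]
    omega
  rw [h2, norm_zero] at h1
  exact zero_ne_one h1

/-- Half-bounded solutions along pseudo-orbits decay exponentially, at a uniform rate. -/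
theorem QuasiHyperbolic.exists_uniform_decay [CompactSpace X] [ProperSpace V]
    (hQ : QuasiHyperbolic T A) (hT : Continuous T)
    (hA : Continuous fun z => (A z : V →L[ℂ] V)) (hK1 : 1 ≤ K)
    (hK : ∀ z, ‖(A z : V →L[ℂ] V)‖ ≤ K) (hK' : ∀ z, ‖((A z).symm : V →L[ℂ] V)‖ ≤ K) :
    ∃ ε : ℝ, 0 < ε ∧ ∃ C l : ℝ, 0 < C ∧ 0 < l ∧ l < 1 ∧
      ∀ w : ℤ → X, (∀ i, dist (T (w i)) (w (i + 1)) ≤ ε) → ∀ x, IsSolution A w x →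
      ((∃ M, ∀ n : ℕ, ‖x n‖ ≤ M) → ∀ n : ℕ, ‖x n‖ ≤ C * l ^ n * ‖x 0‖) ∧
      ((∃ M, ∀ n : ℕ, ‖x (-n)‖ ≤ M) → ∀ n : ℕ, ‖x (-n)‖ ≤ C * l ^ n * ‖x 0‖) := by
  obtain ⟨ε, hε, N, hN, hdbl⟩ := hQ.exists_uniform_doubling hT hA (zero_le_one.trans hK1) hK hK'
  obtain ⟨C, l, hC, hl0, hl1, H⟩ := exists_geometric_decay hK1 hN
  refine ⟨ε, hε, C, l, hC, hl0, hl1, fun w hw x hx => ⟨fun hb n => ?_, fun hb n => ?_⟩⟩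
  · refine H (fun n => ‖x n‖) (fun n => norm_nonneg _) (fun n => ?_) hb (fun n hn => ?_) n
    · simpa using hx.norm_succ_le hK n
    · obtain ⟨i, hi, h2⟩ := hdbl w hw x hx n
      rw [abs_le] at hi
      lift i to ℕ using by omega
      exact ⟨i, by omega, h2⟩
  · have := H (fun n => ‖x (-n)‖) (fun n => norm_nonneg _) (fun n => ?_) hb (fun n hn => ?_) n
    · simpa using this
    · have h1 := hx.norm_le_succ hK' (-((n + 1 : ℕ) : ℤ))
      have h2 : -((n + 1 : ℕ) : ℤ) + 1 = -n := by push_cast; ring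
      rwa [h2] at h1
    · obtain ⟨i, hi, h2⟩ := hdbl w hw x hx (-n)
      rw [abs_le] at hi
      obtain ⟨i', hi'⟩ := Int.eq_ofNat_of_zero_le (a := -i) (by omega)
      obtain rfl : i = -i' := by omega
      exact ⟨i', by omega, h2⟩

/-- Uniform transversality of forward and backward bounded solutions along pseudo-orbits. -/
theorem QuasiHyperbolic.exists_uniform_splitting [CompactSpace X] [ProperSpace V]
    (hQ : QuasiHyperbolic T A) (hT : Continuous T)
    (hA : Continuous fun z => (A z : V →L[ℂ] V)) (hK1 : 1 ≤ K)
    (hK : ∀ z, ‖(A z : V →L[ℂ] V)‖ ≤ K) (hK' : ∀ z, ‖((A z).symm : V →L[ℂ] V)‖ ≤ K) :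
    ∃ ε : ℝ, 0 < ε ∧ ∃ C : ℝ, 0 ≤ C ∧
      ∀ w : ℤ → X, (∀ i, dist (T (w i)) (w (i + 1)) ≤ ε) → ∀ s u, IsSolution A w s →
      IsSolution A w u → (∃ M, ∀ n : ℕ, ‖s n‖ ≤ M) → (∃ M, ∀ n : ℕ, ‖u (-n)‖ ≤ M) →
      (∀ n : ℕ, ‖s n‖ ≤ C * ‖s 0 + u 0‖) ∧ ∀ n : ℕ, ‖u (-n)‖ ≤ C * ‖s 0 + u 0‖ := by
  have hK0 := zero_le_one.trans hK1
  obtain ⟨ε, hε, C, l, hC, hl0, hl1, hdec⟩ := hQ.exists_uniform_decay hT hA hK1 hK hK'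
  have hdec' : ∀ (n : ℕ) (r : ℝ), 0 ≤ r → C * l ^ n * r ≤ C * r := fun n r hr =>
    mul_le_mul_of_nonneg_right (mul_le_of_le_one_right hC.le (pow_le_one₀ hl0.le hl1.le)) hr
  have hC1 : ∀ r : ℝ, 0 ≤ r → r ≤ (C + 1) * r := fun r hr => by nlinarith
  suffices h : ∃ m : ℕ, ∀ w : ℤ → X, (∀ i, dist (T (w i)) (w (i + 1)) ≤ ε) →
      (∀ i, dist (T (w i)) (w (i + 1)) ≤ 1 / ((m : ℝ) + 1)) → ∀ s u, IsSolution A w s →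
      IsSolution A w u → (∃ M, ∀ n : ℕ, ‖s n‖ ≤ M) → (∃ M, ∀ n : ℕ, ‖u (-n)‖ ≤ M) →
      ‖s 0‖ = 1 → 1 / ((m : ℝ) + 1) < ‖s 0 + u 0‖ by
    obtain ⟨m, hm⟩ := h
    have hm0 : (0 : ℝ) < (m : ℝ) + 1 := by positivity
    refine ⟨min ε (1 / ((m : ℝ) + 1)), lt_min hε (by positivity), C * ((m : ℝ) + 2),
      by positivity, fun w hw s u hs hu hsb hub => ?_⟩
    have hw1 := fun i => (hw i).trans (min_le_left _ _)
    have key : ‖s 0‖ ≤ ((m : ℝ) + 1) * ‖s 0 + u 0‖ := by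
      by_cases h0 : s 0 = 0
      · rw [h0, norm_zero]; positivity
      have h0' : 0 < ‖s 0‖ := norm_pos_iff.2 h0
      obtain ⟨M, hM⟩ := hsb
      obtain ⟨M', hM'⟩ := hub
      set c : ℂ := ((‖s 0‖⁻¹ : ℝ) : ℂ) with hc
      have hcn : ‖c‖ = ‖s 0‖⁻¹ := by rw [hc, Complex.norm_real, norm_inv, norm_norm]
      have h1 := hm w hw1 (fun i => (hw i).trans (min_le_right _ _)) _ _ (hs.smul c) (hu.smul c)
        ⟨‖c‖ * M, fun n => by
          rw [norm_smul]; exact mul_le_mul_of_nonneg_left (hM n) (norm_nonneg _)⟩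
        ⟨‖c‖ * M', fun n => by
          rw [norm_smul]; exact mul_le_mul_of_nonneg_left (hM' n) (norm_nonneg _)⟩
        (by rw [norm_smul, hcn, inv_mul_cancel₀ h0'.ne'])
      rw [← smul_add, norm_smul, hcn, ← div_eq_inv_mul, div_lt_div_iff₀ hm0 h0'] at h1
      linarith
    have hu0 : ‖u 0‖ ≤ ((m : ℝ) + 2) * ‖s 0 + u 0‖ := by
      have : ‖u 0‖ ≤ ‖s 0 + u 0‖ + ‖s 0‖ := by
        calc ‖u 0‖ = ‖(s 0 + u 0) - s 0‖ := by rw [add_sub_cancel_left]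
          _ ≤ _ := norm_sub_le _ _
      linarith
    have hs0 : ‖s 0‖ ≤ ((m : ℝ) + 2) * ‖s 0 + u 0‖ := by linarith [norm_nonneg (s 0 + u 0)]
    refine ⟨fun n => ?_, fun n => ?_⟩
    · refine ((hdec w hw1 s hs).1 hsb n).trans ((hdec' n _ (norm_nonneg _)).trans ?_)
      rw [mul_assoc]
      exact mul_le_mul_of_nonneg_left hs0 hC.le
    · refine ((hdec w hw1 u hu).2 hub n).trans ((hdec' n _ (norm_nonneg _)).trans ?_)
      rw [mul_assoc]
      exact mul_le_mul_of_nonneg_left hu0 hC.le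
  by_contra! hcon
  choose w hw hwm s u hs hu hsb hub hs0 hle using hcon
  have hu0 : ∀ m, ‖u m 0‖ ≤ 2 := fun m => by
    have h1 : (1 : ℝ) / ((m : ℝ) + 1) ≤ 1 := by
      rw [div_le_one (by positivity)]; linarith [(Nat.cast_nonneg m : (0 : ℝ) ≤ m)]
    calc ‖u m 0‖ = ‖(s m 0 + u m 0) - s m 0‖ := by rw [add_sub_cancel_left]
      _ ≤ ‖s m 0 + u m 0‖ + ‖s m 0‖ := norm_sub_le _ _
      _ ≤ 2 := by linarith [hle m, hs0 m]
  obtain ⟨w', s', u', -, hT', hs', hu', hsb', hub', h0, hlim⟩ :=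
    exists_splitting_tendsto hT hA hK0 hK hK' (hyperfilter ℕ) (w := w)
      (fun i => tendsto_hyperfilter_zero_of_le_one_div (fun m => dist_nonneg) fun m => hwm m i)
      hs hu (b := C * 2)
      (fun m n => ((hdec _ (hw m) _ (hs m)).1 (hsb m) n).trans ((hdec' n _ (norm_nonneg _)).trans
        (mul_le_mul_of_nonneg_left (by linarith [hs0 m]) hC.le)))
      (fun m n => ((hdec _ (hw m) _ (hu m)).2 (hub m) n).trans ((hdec' n _ (norm_nonneg _)).trans
        (mul_le_mul_of_nonneg_left (hu0 m) hC.le)))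
      (v := 0) (tendsto_zero_iff_norm_tendsto_zero.2
        (tendsto_hyperfilter_zero_of_le_one_div (fun m => norm_nonneg _) hle))
  have h1 : s' 0 = 0 :=
    hQ.eq_zero_of_add_eq_zero hK0 hK hK' hT' hs' hu' ⟨_, hsb'⟩ ⟨_, hub'⟩ h0
  have h2 : ‖s' 0‖ = 1 :=
    tendsto_nhds_unique hlim.norm (by simp only [hs0]; exact tendsto_const_nhds)
  rw [h1, norm_zero] at h2
  exact zero_ne_one h2

/-- At a chain recurrent point of a quasi-hyperbolic cocycle, every vector is the sum of a forward
bounded and a backward bounded one. -/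
theorem QuasiHyperbolic.exists_splitting [CompactSpace X] [FiniteDimensional ℂ V]
    (hQ : QuasiHyperbolic T A) (hT : Continuous T)
    (hA : Continuous fun z => (A z : V →L[ℂ] V)) (hK1 : 1 ≤ K)
    (hK : ∀ z, ‖(A z : V →L[ℂ] V)‖ ≤ K) (hK' : ∀ z, ‖((A z).symm : V →L[ℂ] V)‖ ≤ K) {z : X}
    (hz : ∀ ε > (0 : ℝ), ∃ n : ℕ, 1 ≤ n ∧ ∃ w : ℕ → X, w 0 = z ∧ w n = z ∧
      ∀ j < n, dist (T (w j)) (w (j + 1)) < ε) (v : V) :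
    ∃ (w : ℤ → X) (s u : ℤ → V), w 0 = z ∧ (∀ i, T (w i) = w (i + 1)) ∧ IsSolution A w s ∧
      IsSolution A w u ∧ (∃ M, ∀ n : ℕ, ‖s n‖ ≤ M) ∧ (∃ M, ∀ n : ℕ, ‖u (-n)‖ ≤ M) ∧
      s 0 + u 0 = v := by
  have : ProperSpace V := FiniteDimensional.proper ℂ V
  have hK0 := zero_le_one.trans hK1
  obtain ⟨ε₁, hε₁, N, hN, hdbl⟩ := hQ.exists_uniform_doubling hT hA hK0 hK hK'
  obtain ⟨ε₂, hε₂, C, hC, hspl⟩ := hQ.exists_uniform_splitting hT hA hK1 hK hK'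
  have key : ∀ m : ℕ, ∃ (w : ℤ → X) (s u : ℤ → V), w 0 = z ∧
      (∀ i, dist (T (w i)) (w (i + 1)) ≤ 1 / ((m : ℝ) + 1)) ∧ IsSolution A w s ∧
      IsSolution A w u ∧ (∀ n : ℕ, ‖s n‖ ≤ C * ‖v‖) ∧ (∀ n : ℕ, ‖u (-n)‖ ≤ C * ‖v‖) ∧
      s 0 + u 0 = v := by
    intro m
    obtain ⟨n, hn, c, hc0, hcn, hc⟩ := hz (min (1 / ((m : ℝ) + 1)) (min ε₁ ε₂))
      (lt_min (by positivity) (lt_min hε₁ hε₂))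
    have hn' : (0 : ℤ) < n := by exact_mod_cast hn
    set w : ℤ → X := fun i => c (i % n).toNat with hw
    have hmod : ∀ i : ℤ, (i % n).toNat < n := fun i => by
      have := Int.emod_lt_of_pos i hn'
      have := Int.emod_nonneg i hn'.ne'
      omega
    have hsucc : ∀ i, w (i + 1) = c ((i % n).toNat + 1) := by
      intro i
      have h1 := Int.emod_lt_of_pos i hn'
      have h2 := Int.emod_nonneg i hn'.ne'
      rcases (by omega : i % n + 1 < n ∨ i % n + 1 = n) with h | h
      · have h3 : (i + 1) % n = i % n + 1 := by
          rw [← Int.emod_add_emod, Int.emod_eq_of_lt (by omega) h]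
        simp only [hw, h3]
        congr 1
        omega
      · have h3 : (i + 1) % n = 0 := by
          rw [← Int.emod_add_emod, h, Int.emod_self]
        have h4 : (i % n).toNat + 1 = n := by omega
        simp only [hw, h3, h4, Int.toNat_zero, hc0, hcn]
    have hps : ∀ i, dist (T (w i)) (w (i + 1)) ≤ min (1 / ((m : ℝ) + 1)) (min ε₁ ε₂) := fun i => by
      rw [hsucc]
      exact (hc _ (hmod i)).le
    have hps₁ := fun i => (hps i).trans ((min_le_right _ _).trans (min_le_left _ _))
    have hps₂ := fun i => (hps i).trans ((min_le_right _ _).trans (min_le_right _ _))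
    obtain ⟨s, u, hs, hu, hsu, hsb, hub⟩ := exists_splitting_of_periodic (fun i => A (w i)) hn
      (fun i => by simp [hw]) (fun x hx ⟨M, hM⟩ => by
        have hbdd : BddAbove (range fun i => ‖x i‖) := ⟨M, by rintro _ ⟨i, rfl⟩; exact hM i⟩
        have hsup : ⨆ i, ‖x i‖ ≤ (⨆ i, ‖x i‖) / 2 := ciSup_le fun j => by
          obtain ⟨i, -, h2⟩ := hdbl w hps₁ x hx j
          have := le_ciSup hbdd i
          linarith
        have h0 := le_ciSup hbdd 0
        exact norm_le_zero_iff.1 (by linarith [norm_nonneg (x 0)])) v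
    obtain ⟨h1, h2⟩ := hspl w hps₂ s u hs hu hsb hub
    rw [hsu] at h1 h2
    exact ⟨w, s, u, by simp [hw, hc0], fun i => (hps i).trans (min_le_left _ _), hs, hu, h1, h2,
      hsu⟩
  choose w s u hw0 hw hs hu hsb hub hsu using key
  obtain ⟨w', s', u', hw', hT', hs', hu', hsb', hub', h0, -⟩ :=
    exists_splitting_tendsto hT hA hK0 hK hK' (hyperfilter ℕ) (w := w)
      (fun i => tendsto_hyperfilter_zero_of_le_one_div (fun m => dist_nonneg) fun m => hw m i)
      hs hu hsb hub (v := v) (by simp only [hsu]; exact tendsto_const_nhds)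
  refine ⟨w', s', u', ?_, hT', hs', hu', ⟨_, hsb'⟩, ⟨_, hub'⟩, h0⟩
  exact tendsto_nhds_unique (hw' 0) (by simp only [hw0]; exact tendsto_const_nhds)

/-- The splitting into forward and backward bounded vectors is continuous. -/
theorem QuasiHyperbolic.continuous_splitting [CompactSpace X] [ProperSpace V]
    (hQ : QuasiHyperbolic T A) (hT : Continuous T) (hTi : Function.Injective T)
    (hA : Continuous fun z => (A z : V →L[ℂ] V)) (hK1 : 1 ≤ K)
    (hK : ∀ z, ‖(A z : V →L[ℂ] V)‖ ≤ K) (hK' : ∀ z, ‖((A z).symm : V →L[ℂ] V)‖ ≤ K)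
    {w : X → ℤ → X} (hw0 : ∀ z, w z 0 = z) (hw : ∀ z i, T (w z i) = w z (i + 1))
    {s u : X → ℤ → V} (hs : ∀ z, IsSolution A (w z) (s z)) (hu : ∀ z, IsSolution A (w z) (u z))
    (hsb : ∀ z, ∃ M, ∀ n : ℕ, ‖s z n‖ ≤ M) (hub : ∀ z, ∃ M, ∀ n : ℕ, ‖u z (-n)‖ ≤ M)
    {v : V} (hv : ∀ z, s z 0 + u z 0 = v) : Continuous fun z => s z 0 := by
  have hK0 := zero_le_one.trans hK1
  obtain ⟨ε, hε, C, hC, hspl⟩ := hQ.exists_uniform_splitting hT hA hK1 hK hK'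
  have hspl' := fun z => hspl (w z) (fun i => by rw [hw, dist_self]; exact hε.le) _ _ (hs z) (hu z)
    (hsb z) (hub z)
  simp only [hv] at hspl'
  refine continuous_iff_continuousAt.2 fun z => (tendsto_iff_ultrafilter _ _ _).2 fun g hg => ?_
  obtain ⟨w', s', u', hw', hT', hs', hu', hsb', hub', h0, hlim⟩ :=
    exists_splitting_tendsto hT hA hK0 hK hK' g (w := w)
      (fun i => by simp only [hw, dist_self]; exact tendsto_const_nhds)
      hs hu (fun z => (hspl' z).1) (fun z => (hspl' z).2) (v := v)
      (by simp only [hv]; exact tendsto_const_nhds)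
  have hz : w' 0 = z := tendsto_nhds_unique (hw' 0) (by simp only [hw0]; exact hg)
  obtain rfl : w' = w z := orbit_unique hTi hT' (hw z) (by rw [hz, hw0])
  have h1 : s' 0 - s z 0 = 0 := by
    refine hQ.eq_zero_of_add_eq_zero hK0 hK hK' hT' (hs'.sub (hs z)) (hu'.sub (hu z))
      ⟨C * ‖v‖ + C * ‖v‖, fun n => (norm_sub_le _ _).trans (add_le_add (hsb' n) ((hspl' z).1 n))⟩
      ⟨C * ‖v‖ + C * ‖v‖, fun n => (norm_sub_le _ _).trans (add_le_add (hub' n) ((hspl' z).2 n))⟩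
      ?_
    rw [sub_add_sub_comm, h0, hv, sub_self]
  rw [sub_eq_zero] at h1
  rwa [h1] at hlim

end Cocycle

section Diffeomorphism

variable {E : Type*} [NormedAddCommGroup E] [NormedSpace ℂ E] {f finv : E → E}

theorem fderiv_iterate_succ (hf : Differentiable ℂ f) (n : ℕ) (z v : E) :
    fderiv ℂ (f^[n + 1]) z v = fderiv ℂ f (f^[n] z) (fderiv ℂ (f^[n]) z v) := by
  rw [Function.iterate_succ', fderiv_comp z (hf _) (hf.iterate n z)]
  rfl

theorem fderiv_iterate_succ' (hf : Differentiable ℂ f) (n : ℕ) (z v : E) :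
    fderiv ℂ (f^[n + 1]) z v = fderiv ℂ (f^[n]) (f z) (fderiv ℂ f z v) := by
  rw [Function.iterate_succ, fderiv_comp z (hf.iterate n _) (hf z)]
  rfl

theorem fderiv_leftInverse_apply (hf : Differentiable ℂ f) (hfinv : Differentiable ℂ finv)
    (hli : Function.LeftInverse finv f) (z v : E) :
    fderiv ℂ finv (f z) (fderiv ℂ f z v) = v := by
  have h := fderiv_comp z (hfinv (f z)) (hf z)
  rw [hli.comp_eq_id, fderiv_id] at h
  exact (DFunLike.congr_fun h v).symm

theorem fderiv_rightInverse_apply (hf : Differentiable ℂ f) (hfinv : Differentiable ℂ finv)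
    (hli : Function.LeftInverse finv f) (hri : Function.RightInverse finv f) (z v : E) :
    fderiv ℂ f z (fderiv ℂ finv (f z) v) = v := by
  have h := fderiv_leftInverse_apply hfinv hf hri (f z) v
  rwa [hli z] at h

/-- The derivative of a diffeomorphism as a continuous linear equivalence. -/
def fderivEquiv (hf : Differentiable ℂ f) (hfinv : Differentiable ℂ finv)
    (hli : Function.LeftInverse finv f) (hri : Function.RightInverse finv f) (z : E) : E ≃L[ℂ] E :=
  ContinuousLinearEquiv.equivOfInverse (fderiv ℂ f z) (fderiv ℂ finv (f z))
    (fderiv_leftInverse_apply hf hfinv hli z) (fderiv_rightInverse_apply hf hfinv hli hri z)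

theorem orbitZ_succ {E : Type*} {f finv : E → E} (hri : Function.RightInverse finv f)
    (z : E) (i : ℤ) :
    f (orbitZ f finv z i) = orbitZ f finv z (i + 1) := by
  rcases le_or_gt 0 i with hi | hi
  · lift i to ℕ using hi
    have h1 : (0 : ℤ) ≤ i + 1 := by positivity
    have h2 : ((i : ℤ) + 1).toNat = i + 1 := by omega
    simp only [orbitZ, h1, h2, Int.natCast_nonneg, if_true, Int.toNat_natCast,
      Function.iterate_succ_apply']
  · obtain ⟨n, rfl⟩ : ∃ n : ℕ, i = -(n + 1 : ℤ) := ⟨(-i - 1).toNat, by omega⟩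
    have h1 : ¬ (0 : ℤ) ≤ -(n + 1 : ℤ) := by omega
    have h2 : (- -(n + 1 : ℤ)).toNat = n + 1 := by omega
    have h3 : -(n + 1 : ℤ) + 1 = -n := by ring
    simp only [orbitZ, h1, h2, h3, if_false, Function.iterate_succ_apply', hri _]
    rcases Nat.eq_zero_or_pos n with rfl | hn
    · rfl
    · have h4 : ¬ (0 : ℤ) ≤ -(n : ℤ) := by omega
      rw [if_neg h4, neg_neg, Int.toNat_natCast]

theorem orbitZ_mem {E : Type*} {f finv : E → E} (hri : Function.RightInverse finv f)
    {S : Set E} (hS : Invariant f S) {z : E} (hz : z ∈ S) (i : ℤ) : orbitZ f finv z i ∈ S := by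
  have hmem : ∀ y, f y ∈ S ↔ y ∈ S := fun y => by
    conv_rhs => rw [← hS]
    rfl
  induction i using Int.induction_on with
  | zero => exact hz
  | succ i ih => rw [← orbitZ_succ hri, hmem]; exact ih
  | pred i ih => rwa [← hmem, orbitZ_succ hri, sub_add_cancel]

section Solutions

variable {w x : ℤ → E}

theorem solution_add_nat (hf : Differentiable ℂ f) (hw : ∀ i, f (w i) = w (i + 1))
    (hx : ∀ i, x (i + 1) = fderiv ℂ f (w i) (x i)) (j : ℤ) (n : ℕ) :
    x (j + n) = fderiv ℂ (f^[n]) (w j) (x j) := by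
  induction n generalizing j with
  | zero => simp [fderiv_id]
  | succ n ih =>
    rw [fderiv_iterate_succ' hf, hw, ← hx, ← ih]
    congr 1
    push_cast
    ring

theorem solution_sub_nat (hf : Differentiable ℂ f) (hfinv : Differentiable ℂ finv)
    (hli : Function.LeftInverse finv f) (hw : ∀ i, f (w i) = w (i + 1))
    (hx : ∀ i, x (i + 1) = fderiv ℂ f (w i) (x i)) (j : ℤ) (n : ℕ) :
    x (j - n) = fderiv ℂ (finv^[n]) (w j) (x j) := by
  induction n generalizing j with
  | zero => simp [fderiv_id]
  | succ n ih =>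
    obtain ⟨i, rfl⟩ : ∃ i, j = i + 1 := ⟨j - 1, by ring⟩
    rw [fderiv_iterate_succ' hfinv, hx, ← hw, hli, fderiv_leftInverse_apply hf hfinv hli, ← ih]
    congr 1
    push_cast
    ring

end Solutions

/-- On a compact hyperbolic set, bounded solutions of the variational equation vanish. -/
theorem IsHyperbolicSet.eq_zero_of_bounded {S : Set E} (hS : IsCompact S)
    (h : IsHyperbolicSet f finv S) (hf : Differentiable ℂ f) (hfinv : Differentiable ℂ finv)
    (hli : Function.LeftInverse finv f) {w x : ℤ → E} (hwS : ∀ i, w i ∈ S)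
    (hw : ∀ i, f (w i) = w (i + 1)) (hx : ∀ i, x (i + 1) = fderiv ℂ f (w i) (x i))
    {M : ℝ} (hM : ∀ i, ‖x i‖ ≤ M) (j : ℤ) : x j = 0 := by
  obtain ⟨Es, Eu, P, Cs, Cu, ls, lu, hCs, hCu, hls0, hls1, hlu, hPc, hP, hPs, hPu, hEs, hEu,
    hds, hdu⟩ := h
  obtain ⟨D, hD⟩ := hS.exists_bound_of_continuousOn hPc
  have hPs' : ∀ i, P (w i) (x i) ∈ Es (w i) := fun i => (hP _ (hwS i) _).1
  have hPu' : ∀ i, x i - P (w i) (x i) ∈ Eu (w i) := fun i => (hP _ (hwS i) _).2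
  have hs : ∀ i, P (w (i + 1)) (x (i + 1)) = fderiv ℂ f (w i) (P (w i) (x i)) := by
    intro i
    have h1 : fderiv ℂ f (w i) (P (w i) (x i)) ∈ Es (w (i + 1)) := by
      rw [← hw, ← hEs _ (hwS i)]
      exact Submodule.mem_map_of_mem (hPs' i)
    have h2 : fderiv ℂ f (w i) (x i - P (w i) (x i)) ∈ Eu (w (i + 1)) := by
      rw [← hw, ← hEu _ (hwS i)]
      exact Submodule.mem_map_of_mem (hPu' i)
    have h3 : x (i + 1) = fderiv ℂ f (w i) (P (w i) (x i))
        + fderiv ℂ f (w i) (x i - P (w i) (x i)) := by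
      rw [← map_add, add_sub_cancel, hx]
    rw [h3, map_add, hPs _ (hwS _) _ h1, hPu _ (hwS _) _ h2, add_zero]
  have hu : ∀ i, x (i + 1) - P (w (i + 1)) (x (i + 1))
      = fderiv ℂ f (w i) (x i - P (w i) (x i)) := fun i => by rw [map_sub, hs, hx]
  have hsM : ∀ i, ‖P (w i) (x i)‖ ≤ D * M := fun i =>
    ((P (w i)).le_opNorm _).trans (mul_le_mul (hD _ (hwS i)) (hM i) (norm_nonneg _)
      ((norm_nonneg _).trans (hD _ (hwS i))))
  have huM : ∀ i, ‖x i - P (w i) (x i)‖ ≤ M + D * M := fun i =>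
    (norm_sub_le _ _).trans (add_le_add (hM i) (hsM i))
  have hs0 : P (w j) (x j) = 0 := by
    have hlim : Tendsto (fun n : ℕ => Cs * ls ^ n * (D * M)) atTop (𝓝 (Cs * 0 * (D * M))) :=
      ((tendsto_pow_atTop_nhds_zero_of_lt_one hls0.le hls1).const_mul Cs).mul_const _
    rw [mul_zero, zero_mul] at hlim
    refine norm_le_zero_iff.1 (ge_of_tendsto hlim (eventually_atTop.2 ⟨1, fun n hn => ?_⟩))
    have h1 := solution_add_nat (x := fun i => P (w i) (x i)) hf hw hs (j - n) n
    simp only [sub_add_cancel] at h1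
    rw [h1]
    exact (hds _ (hwS _) n hn _ (hPs' _)).trans
      (mul_le_mul_of_nonneg_left (hsM _) (by positivity))
  have hu0 : x j - P (w j) (x j) = 0 := by
    have hlim : Tendsto (fun n : ℕ => Cu * (lu ^ n)⁻¹ * (M + D * M)) atTop
        (𝓝 (Cu * 0 * (M + D * M))) :=
      ((tendsto_pow_atTop_atTop_of_one_lt hlu).inv_tendsto_atTop.const_mul Cu).mul_const _
    rw [mul_zero, zero_mul] at hlim
    refine norm_le_zero_iff.1 (ge_of_tendsto hlim (eventually_atTop.2 ⟨1, fun n hn => ?_⟩))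
    have h1 := solution_sub_nat (x := fun i => x i - P (w i) (x i)) hf hfinv hli hw hu (j + n) n
    simp only [add_sub_cancel_right] at h1
    rw [h1]
    have : 0 < lu := one_pos.trans hlu
    exact (hdu _ (hwS _) n hn _ (hPu' _)).trans
      (mul_le_mul_of_nonneg_left (huM _) (by positivity))
  rwa [hs0, sub_zero] at hu0

theorem map_boundedOrbits_iterate (hf : Differentiable ℂ f) (hfinv : Differentiable ℂ finv)
    (hli : Function.LeftInverse finv f) (hri : Function.RightInverse finv f) (z : E) :
    (boundedOrbits fun n => fderiv ℂ (f^[n]) z).map (fderiv ℂ f z).toLinearMap =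
      boundedOrbits fun n => fderiv ℂ (f^[n]) (f z) := by
  refine le_antisymm ?_ fun v hv => ?_
  · rintro _ ⟨v, ⟨M, hM⟩, rfl⟩
    refine ⟨M, fun n => ?_⟩
    have := hM (n + 1)
    rwa [fderiv_iterate_succ' hf] at this
  · obtain ⟨M, hM⟩ := hv
    have hv := fderiv_rightInverse_apply hf hfinv hli hri z v
    refine ⟨fderiv ℂ finv (f z) v, ⟨max M ‖fderiv ℂ finv (f z) v‖, fun n => ?_⟩, hv⟩
    cases n with
    | zero => simp [fderiv_id]
    | succ n =>
      rw [fderiv_iterate_succ' hf, hv]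
      exact (hM n).trans (le_max_left _ _)

theorem map_boundedOrbits_iterate_inverse (hf : Differentiable ℂ f)
    (hfinv : Differentiable ℂ finv) (hli : Function.LeftInverse finv f)
    (hri : Function.RightInverse finv f) (z : E) :
    (boundedOrbits fun n => fderiv ℂ (finv^[n]) z).map (fderiv ℂ f z).toLinearMap =
      boundedOrbits fun n => fderiv ℂ (finv^[n]) (f z) := by
  have h := map_boundedOrbits_iterate hfinv hf hri hli (f z)
  rw [hli z] at h
  rw [← h, ← Submodule.map_comp]
  convert Submodule.map_id _
  ext v
  exact fderiv_rightInverse_apply hf hfinv hli hri z v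

/-- A compact chain recurrent quasi-hyperbolic set is hyperbolic. -/
theorem isHyperbolicSet_of_quasiHyperbolic [FiniteDimensional ℂ E] (hf : Differentiable ℂ f)
    (hfinv : Differentiable ℂ finv) (hli : Function.LeftInverse finv f)
    (hri : Function.RightInverse finv f) {S : Set E} (hS : IsCompact S) (hinvS : Invariant f S)
    (hcr : IsChainRecurrent f S)
    (hQ : ∀ w : ℤ → E, (∀ i, w i ∈ S) → (∀ i, f (w i) = w (i + 1)) → ∀ x : ℤ → E,
      (∀ i, x (i + 1) = fderiv ℂ f (w i) (x i)) → (∃ M, ∀ i, ‖x i‖ ≤ M) → x 0 = 0) :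
    IsHyperbolicSet f finv S := by
  have hproper : ProperSpace E := FiniteDimensional.proper ℂ E
  have hcpt : CompactSpace S := isCompact_iff_compactSpace.1 hS
  have hmem : ∀ y ∈ S, f y ∈ S := fun y hy => by rwa [← hinvS] at hy
  let T : S → S := fun z => ⟨f z, hmem z z.2⟩
  let A : S → E ≃L[ℂ] E := fun z => fderivEquiv hf hfinv hli hri z
  have hT : Continuous T := (hf.continuous.comp continuous_subtype_val).subtype_mk _
  have hTi : Function.Injective T := fun y z h =>
    Subtype.ext (hli.injective (congrArg Subtype.val h))
  have hDf := continuous_fderiv_of_differentiable hf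
  have hA : Continuous fun z => (A z : E →L[ℂ] E) := hDf.comp continuous_subtype_val
  obtain ⟨K₁, hK₁⟩ := hS.exists_bound_of_continuousOn hDf.continuousOn
  obtain ⟨K₂, hK₂⟩ := hS.exists_bound_of_continuousOn
    (continuous_fderiv_of_differentiable hfinv).continuousOn
  set K := max 1 (max K₁ K₂) with hKdef
  have hK1 : 1 ≤ K := le_max_left _ _
  have hK0 : 0 ≤ K := zero_le_one.trans hK1
  have hK : ∀ z, ‖(A z : E →L[ℂ] E)‖ ≤ K := fun z =>
    (hK₁ z z.2).trans ((le_max_left _ _).trans (le_max_right _ _))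
  have hK' : ∀ z, ‖((A z).symm : E →L[ℂ] E)‖ ≤ K := fun z =>
    (hK₂ (f z) (hmem z z.2)).trans ((le_max_right _ _).trans (le_max_right _ _))
  have horb : ∀ {w : ℤ → S}, (∀ i, T (w i) = w (i + 1)) →
      ∀ i, f (w i : E) = w (i + 1) := fun hw i => congrArg Subtype.val (hw i)
  have hQ' : QuasiHyperbolic T A := fun w hw x hx hb =>
    hQ (fun i => w i) (fun i => (w i).2) (horb hw) x hx hb
  have hfwd : ∀ {w : ℤ → S} {x : ℤ → E}, (∀ i, T (w i) = w (i + 1)) → IsSolution A w x →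
      ∀ n : ℕ, x n = fderiv ℂ (f^[n]) (w 0) (x 0) := fun {w x} hw hx n => by
    have := solution_add_nat (w := fun i => (w i : E)) (x := x) hf (horb hw) hx 0 n
    rwa [zero_add] at this
  have hbwd : ∀ {w : ℤ → S} {x : ℤ → E}, (∀ i, T (w i) = w (i + 1)) → IsSolution A w x →
      ∀ n : ℕ, x (-n) = fderiv ℂ (finv^[n]) (w 0) (x 0) := fun {w x} hw hx n => by
    have := solution_sub_nat (w := fun i => (w i : E)) (x := x) hf hfinv hli (horb hw) hx 0 n
    rwa [zero_sub] at this
  let O : S → ℤ → S := fun z i => ⟨orbitZ f finv z i, orbitZ_mem hri hinvS z.2 i⟩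
  have hO : ∀ z i, T (O z i) = O z (i + 1) := fun z i => Subtype.ext (orbitZ_succ hri _ _)
  have hO0 : ∀ z, O z 0 = z := fun z => rfl
  set Es : E → Submodule ℂ E := fun z => boundedOrbits fun n => fderiv ℂ (f^[n]) z with hEs
  set Eu : E → Submodule ℂ E := fun z => boundedOrbits fun n => fderiv ℂ (finv^[n]) z with hEu
  have hdisj : ∀ z ∈ S, ∀ v ∈ Es z, v ∈ Eu z → v = 0 := by
    rintro z hz v ⟨M, hM⟩ ⟨N, hN⟩
    obtain ⟨x, hx, rfl⟩ := exists_isSolution A (O ⟨z, hz⟩) v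
    refine hQ' _ (hO _) x hx ⟨max M N, fun i => ?_⟩
    obtain ⟨j, rfl | rfl⟩ := Int.eq_nat_or_neg i
    · rw [hfwd (hO _) hx]
      exact (hM j).trans (le_max_left _ _)
    · rw [hbwd (hO _) hx]
      exact (hN j).trans (le_max_right _ _)
  have hsum : ∀ z ∈ S, ∀ v, ∃ s ∈ Es z, v - s ∈ Eu z := by
    intro z hz v
    obtain ⟨w, s, u, hw0, hw, hs, hu, ⟨M, hM⟩, ⟨N, hN⟩, rfl⟩ :=
      hQ'.exists_splitting hT hA hK1 hK hK' (z := ⟨z, hz⟩) (fun ε hε => by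
        obtain ⟨n, hn, w, hwS, hw0, hwn, hw⟩ := hcr z hz ε hε
        refine ⟨n, hn, fun j => ⟨w (min j n), hwS _ (min_le_right _ _)⟩, Subtype.ext ?_,
          Subtype.ext ?_, fun j hj => ?_⟩
        · simp [hw0]
        · simp [hwn]
        · rw [Subtype.dist_eq, dist_eq_norm]
          have := hw j hj
          simpa [T, min_eq_left hj.le, min_eq_left (Nat.succ_le_of_lt hj)] using this) v
    refine ⟨s 0, ⟨M, fun n => ?_⟩, ?_⟩
    · have := hM n
      rwa [hfwd hw hs, hw0] at this
    · rw [add_sub_cancel_left]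
      refine ⟨N, fun n => ?_⟩
      have := hN n
      rwa [hbwd hw hu, hw0] at this
  have hproj : ∀ z ∈ S, ∃ P : E →L[ℂ] E, ∀ v, P v ∈ Es z ∧ v - P v ∈ Eu z := by
    intro z hz
    have hcompl : IsCompl (Es z) (Eu z) := by
      refine ⟨Submodule.disjoint_def.2 (hdisj z hz), codisjoint_iff.2 (eq_top_iff.2 fun v _ => ?_)⟩
      obtain ⟨s, hs, hu⟩ := hsum z hz v
      exact Submodule.mem_sup.2 ⟨s, hs, v - s, hu, add_sub_cancel _ _⟩
    refine ⟨((Es z).projection (Eu z) hcompl).toContinuousLinearMap, fun v =>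
      ⟨Submodule.projection_apply_mem hcompl v, ?_⟩⟩
    obtain ⟨s, hs, hu⟩ := hsum z hz v
    have h1 : (Es z).projection (Eu z) hcompl v = s := by
      conv_lhs => rw [← add_sub_cancel s v, map_add,
        Submodule.projection_apply_of_mem_left hcompl hs,
        (Submodule.projection_apply_eq_zero_iff hcompl).2 hu, add_zero]
    change v - (Es z).projection (Eu z) hcompl v ∈ Eu z
    rwa [h1]
  choose! P hP using hproj
  obtain ⟨ε, hε, C, l, hC, hl0, hl1, hdec⟩ := hQ'.exists_uniform_decay hT hA hK1 hK hK'
  have hdec' := fun z => hdec (O z) fun i => by rw [hO, dist_self]; exact hε.le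
  refine ⟨Es, Eu, P, C, C, l, l⁻¹, hC, hC, hl0, hl1, (one_lt_inv₀ hl0).2 hl1, ?_, hP,
    fun z hz v hv => ?_, fun z hz v hv => ?_,
    fun z _ => map_boundedOrbits_iterate hf hfinv hli hri z,
    fun z _ => map_boundedOrbits_iterate_inverse hf hfinv hli hri z,
    fun z hz n _ v hv => ?_, fun z hz n _ v hv => ?_⟩
  · refine continuousOn_clm_apply.2 fun v => continuousOn_iff_continuous_domRestrict.2 ?_
    choose s hs hs0 using fun z : S => exists_isSolution A (O z) (P z v)
    choose u hu hu0 using fun z : S => exists_isSolution A (O z) (v - P z v)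
    have := hQ'.continuous_splitting hT hTi hA hK1 hK hK' hO0 hO hs hu
      (fun z => by
        obtain ⟨M, hM⟩ := (hP z z.2 v).1
        refine ⟨M, fun n => ?_⟩
        rw [hfwd (hO z) (hs z), hs0]
        exact hM n)
      (fun z => by
        obtain ⟨M, hM⟩ := (hP z z.2 v).2
        refine ⟨M, fun n => ?_⟩
        rw [hbwd (hO z) (hu z), hu0]
        exact hM n)
      (v := v) (fun z => by rw [hs0, hu0, add_sub_cancel])
    simp only [hs0] at this
    exact this
  · exact (sub_eq_zero.1 (hdisj z hz _ (sub_mem hv (hP z hz v).1) (hP z hz v).2)).symm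
  · refine hdisj z hz _ (hP z hz v).1 ?_
    have := sub_mem hv (hP z hz v).2
    rwa [_root_.sub_sub_cancel] at this
  · obtain ⟨M, hM⟩ := hv
    obtain ⟨x, hx, rfl⟩ := exists_isSolution A (O ⟨z, hz⟩) v
    have h1 := hfwd (hO _) hx
    have := (hdec' _ x hx).1 ⟨M, fun n => by rw [h1]; exact hM n⟩ n
    rwa [h1] at this
  · obtain ⟨M, hM⟩ := hv
    obtain ⟨x, hx, rfl⟩ := exists_isSolution A (O ⟨z, hz⟩) v
    have h1 := hbwd (hO _) hx
    have := (hdec' _ x hx).2 ⟨M, fun n => by rw [h1]; exact hM n⟩ n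
    rw [h1] at this
    rwa [inv_pow, inv_inv]

end Diffeomorphism

/-- (Churchill–Franke–Selgrade, Sacker–Sell) A compact chain recurrent invariant
set `S` of a diffeomorphism `f` of `ℂ^k` (`k ≥ 2`) is uniformly hyperbolic iff it
is quasi-hyperbolic: along every orbit from `S`, the homogeneous recurrence
`ξ_{i+1} = Df(z_i)·ξ_i` (`i ∈ ℤ`) has no nonzero bounded solution. -/
theorem hyperbolic_iff_quasi_hyperbolic (k : ℕ) (hk : 2 ≤ k)
    (f finv : Ck k → Ck k) (hf : Differentiable ℂ f) (hfinv : Differentiable ℂ finv)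
    (hli : Function.LeftInverse finv f) (hri : Function.RightInverse finv f)
    (S : Set (Ck k)) (hS : IsCompact S) (hinvS : Invariant f S)
    (hcr : IsChainRecurrent f S) :
    IsHyperbolicSet f finv S ↔
      ∀ z0 ∈ S, ∀ ξ : lp (fun _ : ℤ => Ck k) ∞,
        (∀ i : ℤ, ξ (i + 1) = fderiv ℂ f (orbitZ f finv z0 i) (ξ i)) → ξ = 0 := by
  constructor
  · intro h z0 hz0 ξ hξ
    refine lp.ext (funext fun j => ?_)
    exact h.eq_zero_of_bounded hS hf hfinv hli (orbitZ_mem hri hinvS hz0) (orbitZ_succ hri z0)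
      hξ (lp.norm_apply_le_norm ENNReal.top_ne_zero ξ) j
  · intro h
    refine isHyperbolicSet_of_quasiHyperbolic hf hfinv hli hri hS hinvS hcr
      fun w hwS hw x hx hb => ?_
    obtain ⟨M, hM⟩ := hb
    have hw' : orbitZ f finv (w 0) = w :=
      orbit_unique hli.injective (orbitZ_succ hri _) hw rfl
    have hmem : Memℓp x ∞ := memℓp_infty ⟨M, by rintro _ ⟨i, rfl⟩; exact hM i⟩
    have h0 := h (w 0) (hwS 0) ⟨x, hmem⟩ (by rw [hw']; exact hx)
    exact congrFun (congrArg Subtype.val h0) 0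
end
end

section
/- Let Λ ⊆ ℂ be a compact q-invariant set and A = g(Λ). Suppose there are constants C_u > 0 and λ_u > 1 such that |D(qⁿ)(x)| ≥ C_u⁻¹·λ_uⁿ for all x ∈ Λ and n ≥ 1. Then for every w ∈ Σ(A, H₀), the bounded linear operator DF(w; H₀) on l_∞(ℤ, ℂ²) is invertible and ‖DF(w; H₀)⁻¹‖ ≤ 2C_u/(λ_u − 1) + 1. -/
noncomputable section
open Set Metric Topology Filter ENNReal

/-- The quadratic map `q(x) = x² + c`. -/
def qmap (c : ℂ) : ℂ → ℂ := fun x => x ^ 2 + c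

/-- The Hénon map `H_b(x,y) = (x² + c − b·y, x)`; `H₀(x,y) = (q(x), x)`. -/
def henon (c b : ℂ) : ℂ × ℂ → ℂ × ℂ := fun p => (p.1 ^ 2 + c - b * p.2, p.1)

/-- `g(x) = (q(x), x)`. -/
def gmap (c : ℂ) : ℂ → ℂ × ℂ := fun x => (qmap c x, x)

/-- `Σ(S, f)`: bi-infinite orbit sequences of `f` lying in `S`, topologized as a
subspace of the product space `ℤ → X`. -/
def SigmaSet {X : Type*} (f : X → X) (S : Set X) : Set (ℤ → X) :=
  {z | (∀ i, z i ∈ S) ∧ ∀ i, f (z i) = z (i + 1)}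

/-- The shift on bi-infinite sequences. -/
def shiftSeq {X : Type*} (z : ℤ → X) : ℤ → X := fun i => z (i + 1)

lemma shiftSeq_mem {X : Type*} {f : X → X} {S : Set X} {z : ℤ → X}
    (hz : z ∈ SigmaSet f S) : shiftSeq z ∈ SigmaSet f S :=
  ⟨fun i => hz.1 (i + 1), fun i => hz.2 (i + 1)⟩

/-- The shift map `σ` as a self-map of `Σ(S, f)`. -/
def sigmaShift {X : Type*} (f : X → X) (S : Set X) :
    (SigmaSet f S) → (SigmaSet f S) :=
  fun z => ⟨shiftSeq z.1, shiftSeq_mem z.2⟩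

/-- The product `a i * a (i + 1) * ⋯ * a (i + n - 1)` of `n` consecutive multipliers. -/
def cocycle (a : ℤ → ℂ) (i : ℤ) (n : ℕ) : ℂ := ∏ k ∈ Finset.range n, a (i + k)

lemma cocycle_succ (a : ℤ → ℂ) (i : ℤ) (n : ℕ) :
    cocycle a i (n + 1) = cocycle a i n * a (i + n) := Finset.prod_range_succ _ _

lemma cocycle_succ' (a : ℤ → ℂ) (i : ℤ) (n : ℕ) :
    cocycle a i (n + 1) = a i * cocycle a (i + 1) n := by
  rw [cocycle, Finset.prod_range_succ', mul_comm, cocycle]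
  congr 1
  · simp
  · refine Finset.prod_congr rfl fun k _ => ?_
    congr 1
    push_cast
    ring

lemma differentiable_qmap_iterate (c : ℂ) (n : ℕ) : Differentiable ℂ ((qmap c)^[n]) := by
  have h : Differentiable ℂ (qmap c) := by unfold qmap; fun_prop
  exact h.iterate n

/-- Along an orbit of `qmap c`, the chain rule computes the derivative of the iterates. -/
lemma deriv_qmap_iterate (c : ℂ) {x : ℤ → ℂ} (hx : ∀ i, x (i + 1) = qmap c (x i)) (i : ℤ)
    (n : ℕ) : deriv ((qmap c)^[n]) (x i) = cocycle (fun j => 2 * x j) i n := by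
  induction n generalizing i with
  | zero => simp [cocycle]
  | succ n ih =>
    have hq : HasDerivAt (qmap c) (2 * x i) (x i) := by
      unfold qmap
      simpa using (hasDerivAt_pow 2 (x i)).add_const c
    have hn := (differentiable_qmap_iterate c n (qmap c (x i))).hasDerivAt
    rw [cocycle_succ', ← ih, Function.iterate_succ, (hn.comp _ hq).deriv, hx, mul_comm]

section Expanding

variable {a : ℤ → ℂ} {C l : ℝ}

lemma norm_inv_cocycle_le (hC : 0 < C) (hl : 1 < l)
    (h : ∀ i, ∀ n : ℕ, 1 ≤ n → C⁻¹ * l ^ n ≤ ‖cocycle a i n‖) (i : ℤ) (n : ℕ) :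
    ‖(cocycle a i (n + 1))⁻¹‖ ≤ C * l⁻¹ * l⁻¹ ^ n := by
  have hl0 : 0 < l := by linarith
  rw [norm_inv]
  refine (inv_anti₀ (by positivity) (h i (n + 1) (by omega))).trans_eq ?_
  rw [mul_inv, inv_inv, ← inv_pow, pow_succ']
  ring

/-- A bounded solution of `v (i + 1) - a i * v i = u i` exists, with an explicit bound. -/
lemma exists_bounded_solution (hC : 0 < C) (hl : 1 < l)
    (h : ∀ i, ∀ n : ℕ, 1 ≤ n → C⁻¹ * l ^ n ≤ ‖cocycle a i n‖) {u : ℤ → ℂ} {M : ℝ}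
    (hu : ∀ i, ‖u i‖ ≤ M) :
    ∃ v : ℤ → ℂ, (∀ i, v (i + 1) - a i * v i = u i) ∧ ∀ i, ‖v i‖ ≤ C / (l - 1) * M := by
  have hl0 : 0 < l := by linarith
  have hl1 : l⁻¹ < 1 := inv_lt_one_of_one_lt₀ hl
  have hbound (i : ℤ) (n : ℕ) :
      ‖u (i + n) * (cocycle a i (n + 1))⁻¹‖ ≤ M * (C * l⁻¹) * l⁻¹ ^ n := by
    rw [norm_mul, mul_assoc]
    exact mul_le_mul (hu _) (norm_inv_cocycle_le hC hl h i n) (norm_nonneg _)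
      ((norm_nonneg _).trans (hu i))
  have hgeom := (hasSum_geometric_of_lt_one (by positivity) hl1).mul_left (M * (C * l⁻¹))
  have hsum (i : ℤ) : Summable fun n : ℕ => u (i + n) * (cocycle a i (n + 1))⁻¹ :=
    Summable.of_norm_bounded hgeom.summable (hbound i)
  refine ⟨fun i => -∑' n : ℕ, u (i + n) * (cocycle a i (n + 1))⁻¹, fun i => ?_, fun i => ?_⟩
  · have ha : a i ≠ 0 := by
      have h1 : 0 < ‖cocycle a i 1‖ := lt_of_lt_of_le (by positivity) (h i 1 le_rfl)
      simpa [cocycle] using h1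
    have hmul : a i * ∑' n : ℕ, u (i + n) * (cocycle a i (n + 1))⁻¹ =
        ∑' n : ℕ, u (i + n) * (cocycle a (i + 1) n)⁻¹ := by
      rw [← tsum_mul_left]
      refine tsum_congr fun n => ?_
      rw [cocycle_succ', mul_inv]
      field_simp
    have hs : Summable fun n : ℕ => u (i + n) * (cocycle a (i + 1) n)⁻¹ := by
      refine ((hsum i).mul_left (a i)).congr fun n => ?_
      rw [cocycle_succ', mul_inv]
      field_simp
    have hshift : ∑' n : ℕ, u (i + (n + 1 : ℕ)) * (cocycle a (i + 1) (n + 1))⁻¹ =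
        ∑' n : ℕ, u (i + 1 + n) * (cocycle a (i + 1) (n + 1))⁻¹ :=
      tsum_congr fun n => by rw [show i + ((n + 1 : ℕ) : ℤ) = i + 1 + n by push_cast; ring]
    rw [mul_neg, hmul, hs.tsum_eq_zero_add, hshift]
    simp [cocycle]
  · rw [norm_neg]
    refine (tsum_of_norm_bounded hgeom (hbound i)).trans_eq ?_
    have : l - 1 ≠ 0 := by linarith
    have : 1 - l⁻¹ ≠ 0 := by linarith
    field_simp

/-- A bounded solution of the homogeneous equation `v (i + 1) = a i * v i` vanishes. -/
lemma eq_zero_of_bounded_of_homogeneous (hC : 0 < C) (hl : 1 < l)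
    (h : ∀ i, ∀ n : ℕ, 1 ≤ n → C⁻¹ * l ^ n ≤ ‖cocycle a i n‖) {v : ℤ → ℂ} {M : ℝ}
    (hv : ∀ i, ‖v i‖ ≤ M) (hrec : ∀ i, v (i + 1) = a i * v i) (i : ℤ) : v i = 0 := by
  have hl0 : 0 < l := by linarith
  have hiter (n : ℕ) : v (i + n) = cocycle a i n * v i := by
    induction n with
    | zero => simp [cocycle]
    | succ n ih =>
      rw [cocycle_succ, show i + ((n + 1 : ℕ) : ℤ) = i + n + 1 by push_cast; ring, hrec, ih]
      ring
  by_contra hne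
  have hpos : 0 < C⁻¹ * ‖v i‖ := by positivity
  obtain ⟨n, hn⟩ := ((tendsto_pow_atTop_atTop_of_one_lt hl).const_mul_atTop hpos
    |>.eventually_gt_atTop M |>.and (eventually_ge_atTop 1)).exists
  have h1 := mul_le_mul_of_nonneg_right (h i n hn.2) (norm_nonneg (v i))
  rw [← norm_mul, ← hiter] at h1
  linarith [hv (i + n), hn.1]

end Expanding

/-- The operator `ξ ↦ (ξ (i + 1) - L i (ξ i))` on bounded sequences, where `L i` is the linear map
`(s, t) ↦ (a i * s, s)` and `a` is bounded. -/
def bandOperator (a : ℤ → ℂ) (K : ℝ) (ha : ∀ i, ‖a i‖ ≤ K) :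
    lp (fun _ : ℤ => ℂ × ℂ) ∞ →ₗ[ℂ] lp (fun _ : ℤ => ℂ × ℂ) ∞ where
  toFun ξ := ⟨fun i => ((ξ (i + 1)).1 - a i * (ξ i).1, (ξ (i + 1)).2 - (ξ i).1), by
    refine memℓp_infty ⟨max (‖ξ‖ + K * ‖ξ‖) (‖ξ‖ + ‖ξ‖), ?_⟩
    rintro _ ⟨i, rfl⟩
    have hb (j : ℤ) : ‖ξ j‖ ≤ ‖ξ‖ := lp.norm_apply_le_norm ENNReal.top_ne_zero ξ j
    have h1 (j : ℤ) : ‖(ξ j).1‖ ≤ ‖ξ‖ := (norm_fst_le _).trans (hb j)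
    have h2 (j : ℤ) : ‖(ξ j).2‖ ≤ ‖ξ‖ := (norm_snd_le _).trans (hb j)
    refine max_le_max ((norm_sub_le _ _).trans ?_) ((norm_sub_le _ _).trans ?_)
    · rw [norm_mul]
      exact add_le_add (h1 _) (mul_le_mul (ha i) (h1 i) (norm_nonneg _)
        ((norm_nonneg _).trans (ha i)))
    · exact add_le_add (h2 _) (h1 _)⟩
  map_add' ξ η := by
    refine lp.ext (funext fun i => Prod.ext ?_ ?_)
    · change (ξ (i + 1)).1 + (η (i + 1)).1 - a i * ((ξ i).1 + (η i).1) =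
        (ξ (i + 1)).1 - a i * (ξ i).1 + ((η (i + 1)).1 - a i * (η i).1)
      ring
    · change (ξ (i + 1)).2 + (η (i + 1)).2 - ((ξ i).1 + (η i).1) =
        (ξ (i + 1)).2 - (ξ i).1 + ((η (i + 1)).2 - (η i).1)
      ring
  map_smul' r ξ := by
    ext i <;> simp <;> ring

lemma bandOperator_apply (a : ℤ → ℂ) (K : ℝ) (ha : ∀ i, ‖a i‖ ≤ K)
    (ξ : lp (fun _ : ℤ => ℂ × ℂ) ∞) (i : ℤ) :
    bandOperator a K ha ξ i = ((ξ (i + 1)).1 - a i * (ξ i).1, (ξ (i + 1)).2 - (ξ i).1) := rfl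

lemma norm_bandOperator_le (a : ℤ → ℂ) (K : ℝ) (ha : ∀ i, ‖a i‖ ≤ K)
    (ξ : lp (fun _ : ℤ => ℂ × ℂ) ∞) : ‖bandOperator a K ha ξ‖ ≤ (K + 2) * ‖ξ‖ := by
  have hK : 0 ≤ K := (norm_nonneg _).trans (ha 0)
  have hb (j : ℤ) : ‖ξ j‖ ≤ ‖ξ‖ := lp.norm_apply_le_norm ENNReal.top_ne_zero ξ j
  have h1 (j : ℤ) : ‖(ξ j).1‖ ≤ ‖ξ‖ := (norm_fst_le _).trans (hb j)
  have h2 (j : ℤ) : ‖(ξ j).2‖ ≤ ‖ξ‖ := (norm_snd_le _).trans (hb j)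
  have hξ := norm_nonneg ξ
  refine lp.norm_le_of_forall_le (by positivity) fun i => ?_
  rw [bandOperator_apply]
  refine max_le ((norm_sub_le _ _).trans ?_) ((norm_sub_le _ _).trans ?_)
  · rw [norm_mul]
    have := mul_le_mul (ha i) (h1 i) (norm_nonneg _) hK
    linarith [h1 (i + 1)]
  · nlinarith [h2 (i + 1), h1 i]

lemma bandOperator_injective {a : ℤ → ℂ} {K C l : ℝ} (ha : ∀ i, ‖a i‖ ≤ K) (hC : 0 < C)
    (hl : 1 < l) (h : ∀ i, ∀ n : ℕ, 1 ≤ n → C⁻¹ * l ^ n ≤ ‖cocycle a i n‖) :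
    Function.Injective (bandOperator a K ha) := by
  refine (injective_iff_map_eq_zero _).2 fun ξ hξ => ?_
  have hcoord (i : ℤ) : (ξ (i + 1)).1 - a i * (ξ i).1 = 0 ∧ (ξ (i + 1)).2 - (ξ i).1 = 0 := by
    have := bandOperator_apply a K ha ξ i
    rw [hξ] at this
    exact ⟨(congrArg Prod.fst this).symm, (congrArg Prod.snd this).symm⟩
  have hfst : ∀ i, (ξ i).1 = 0 :=
    eq_zero_of_bounded_of_homogeneous (v := fun i => (ξ i).1) hC hl h
      (fun i => (norm_fst_le _).trans (lp.norm_apply_le_norm ENNReal.top_ne_zero ξ i))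
      fun i => sub_eq_zero.1 (hcoord i).1
  refine lp.ext (funext fun i => Prod.ext (hfst i) ?_)
  have := (hcoord (i - 1)).2
  rwa [hfst, sub_zero, sub_add_cancel] at this

lemma exists_bandOperator_eq {a : ℤ → ℂ} {K C l : ℝ} (ha : ∀ i, ‖a i‖ ≤ K) (hC : 0 < C)
    (hl : 1 < l) (h : ∀ i, ∀ n : ℕ, 1 ≤ n → C⁻¹ * l ^ n ≤ ‖cocycle a i n‖)
    (η : lp (fun _ : ℤ => ℂ × ℂ) ∞) :
    ∃ ξ, bandOperator a K ha ξ = η ∧ ‖ξ‖ ≤ (C / (l - 1) + 1) * ‖η‖ := by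
  have hη (j : ℤ) : ‖η j‖ ≤ ‖η‖ := lp.norm_apply_le_norm ENNReal.top_ne_zero η j
  obtain ⟨v, hv, hvb⟩ := exists_bounded_solution hC hl h (u := fun i => (η i).1)
    fun i => (norm_fst_le _).trans (hη i)
  have hbound (i : ℤ) : ‖(v i, v (i - 1) + (η (i - 1)).2)‖ ≤ (C / (l - 1) + 1) * ‖η‖ := by
    refine max_le ?_ ((norm_add_le _ _).trans ?_)
    · linarith [hvb i, norm_nonneg η]
    · linarith [hvb (i - 1), (norm_snd_le (η (i - 1))).trans (hη (i - 1))]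
  refine ⟨⟨fun i => (v i, v (i - 1) + (η (i - 1)).2), memℓp_infty
    ⟨(C / (l - 1) + 1) * ‖η‖, ?_⟩⟩, ?_, ?_⟩
  · rintro _ ⟨i, rfl⟩
    exact hbound i
  · refine lp.ext (funext fun i => Prod.ext ?_ ?_)
    · exact hv i
    · simp [bandOperator_apply]
  · exact lp.norm_le_of_forall_le ((norm_nonneg _).trans (hbound 0)) hbound

/-- If `|D(qⁿ)(x)| ≥ C_u⁻¹·λ_uⁿ` on a compact `q`-invariant set `Λ` (`C_u > 0`,
`λ_u > 1`) and `A = g(Λ)`, then for every `w ∈ Σ(A, H₀)` the operator `DF(w; H₀)`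
on `l_∞(ℤ, ℂ²)` is invertible with `‖DF(w; H₀)⁻¹‖ ≤ 2C_u/(λ_u − 1) + 1`. -/
theorem DF_inverse_norm_bound (c : ℂ) (Λ : Set ℂ) (hcomp : IsCompact Λ)
    (hinv : Invariant (qmap c) Λ)
    (Cu lamu : ℝ) (hCu : 0 < Cu) (hlamu : 1 < lamu)
    (hexp : ∀ x ∈ Λ, ∀ n : ℕ, 1 ≤ n → Cu⁻¹ * lamu ^ n ≤ ‖deriv ((qmap c)^[n]) x‖) :
    ∀ w : ℤ → ℂ × ℂ, w ∈ SigmaSet (henon c 0) (gmap c '' Λ) →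
      ∃ T : (lp (fun _ : ℤ => ℂ × ℂ) ∞) ≃L[ℂ] (lp (fun _ : ℤ => ℂ × ℂ) ∞),
        (∀ ξ : lp (fun _ : ℤ => ℂ × ℂ) ∞, ∀ i : ℤ,
          T ξ i = ((ξ (i + 1)).1 - 2 * (w i).1 * (ξ i).1, (ξ (i + 1)).2 - (ξ i).1)) ∧
        ‖(T.symm : (lp (fun _ : ℤ => ℂ × ℂ) ∞) →L[ℂ] (lp (fun _ : ℤ => ℂ × ℂ) ∞))‖ ≤
          2 * Cu / (lamu - 1) + 1 := by
  intro w hw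
  have hmem (i : ℤ) : (w i).1 ∈ Λ := by
    obtain ⟨x, hx, hxw⟩ := hw.1 i
    rw [← hxw]
    exact hinv.symm.subset hx
  have horbit (i : ℤ) : (w (i + 1)).1 = qmap c (w i).1 := by
    rw [← hw.2 i]
    simp [henon, qmap]
  obtain ⟨R, hR⟩ := hcomp.isBounded.exists_norm_le
  have ha (i : ℤ) : ‖2 * (w i).1‖ ≤ 2 * R := by
    simpa using hR _ (hmem i)
  have hcoc (i : ℤ) (n : ℕ) (hn : 1 ≤ n) :
      Cu⁻¹ * lamu ^ n ≤ ‖cocycle (fun j => 2 * (w j).1) i n‖ := by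
    rw [← deriv_qmap_iterate c horbit]
    exact hexp _ (hmem i) n hn
  have hinj := bandOperator_injective ha hCu hlamu hcoc
  have hsol := exists_bandOperator_eq ha hCu hlamu hcoc
  let e := LinearEquiv.ofBijective (bandOperator _ (2 * R) ha)
    ⟨hinj, fun η => (hsol η).imp fun _ hξ => hξ.1⟩
  have hsymm (η) : ‖e.symm η‖ ≤ (Cu / (lamu - 1) + 1) * ‖η‖ := by
    obtain ⟨ξ, hξ, hle⟩ := hsol η
    rwa [show e.symm η = ξ from e.symm_apply_eq.2 hξ.symm]
  refine ⟨e.toContinuousLinearEquivOfBounds _ _ (norm_bandOperator_le _ _ ha) hsymm,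
    fun ξ i => rfl, ?_⟩
  have hpos : 0 < Cu / (lamu - 1) := div_pos hCu (by linarith)
  refine ContinuousLinearMap.opNorm_le_bound _ ?_ fun η => (hsymm η).trans ?_
  · rw [mul_div_assoc]
    positivity
  · gcongr
    linarith
end
end
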